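/- arXiv:1411.5673 — 2 statements merged into one kernel-verified Lean document; each statement's English description precedes it below -/
import Mathlib

section
/- For each γ, γ' ∈ (0,1) with γ + γ' < 1 there exists a constant C₀ = C₀(γ, γ') > 0 such that for every Borel set A ⊆ [0,1]² with λ(A) = γ there exists a bijection φ₀ : [0,1]² → [0,1]² satisfying: (1) φ₀ is C₀-bi-Lipschitz, i.e. (1/C₀)·|x − y| ≤ |φ₀(x) − φ₀(y)| ≤ C₀·|x − y| for all x, y ∈ [0,1]²; (2) φ₀(x) = x for all x ∈ ∂[0,1]²; (3) λ(φ₀(A)) ≥ 1 − γ'. -/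
open MeasureTheory Set

noncomputable section

/-- The closed unit square `[0,1]²` in the Euclidean plane. -/
def unitSq : Set (EuclideanSpace ℝ (Fin 2)) := {x | ∀ i, x i ∈ Set.Icc (0:ℝ) 1}

/-- The topological boundary of the unit square: points of `[0,1]²` with at least one
coordinate in `{0,1}`. -/
def unitSqBdry : Set (EuclideanSpace ℝ (Fin 2)) :=
  {x ∈ unitSq | ∃ i, x i = 0 ∨ x i = 1}


/-- forward difference matrix, zero last row -/
def dMat (N : ℕ) : Matrix (Fin N) (Fin N) ℝ :=
  fun i j => if (i:ℕ) + 1 < N then (if (j:ℕ) = i + 1 then 1 else 0) - (if j = i then 1 else 0) else 0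

lemma dMat_sum {N : ℕ} (v : Fin N → ℝ) (i : Fin N) :
    ∑ j, dMat N i j * v j = if h : (i:ℕ) + 1 < N then v ⟨i+1, h⟩ - v i else 0 := by
  unfold dMat
  by_cases h : (i:ℕ) + 1 < N
  · simp only [h, if_true, dif_pos, sub_mul, Finset.sum_sub_distrib, ite_mul, one_mul, zero_mul]
    congr 1
    · rw [Finset.sum_eq_single (⟨i+1, h⟩ : Fin N)]
      · simp
      · intro b _ hb
        rw [if_neg]
        intro h'; apply hb; ext; exact h'
      · simp
    · simp
  · simp [h]

lemma dMat_sum' {N : ℕ} (v : Fin N → ℝ) (hv : ∀ i : Fin N, (i:ℕ) + 1 = N → v i = 0) (k : Fin N) :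
    ∑ j, v j * dMat N j k = (if h : 0 < (k:ℕ) then v ⟨k-1, by omega⟩ else 0) - v k := by
  unfold dMat
  have : ∀ j : Fin N, v j * (if (j:ℕ) + 1 < N then (if (k:ℕ) = j + 1 then (1:ℝ) else 0) - (if k = j then 1 else 0) else 0)
      = (if (k:ℕ) = j + 1 then v j else 0) - (if k = j then v j else 0) := by
    intro j
    by_cases h : (j:ℕ) + 1 < N
    · simp [h, mul_sub]
    · have h2 : (j:ℕ) + 1 = N := by omega
      simp [h, hv j h2]
  simp only [this, Finset.sum_sub_distrib]
  congr 1
  · by_cases h : 0 < (k:ℕ)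
    · rw [Finset.sum_eq_single (⟨k-1, by omega⟩ : Fin N)]
      · simp [h]; intro h'; omega
      · intro b _ hb
        rw [if_neg]
        intro h'; apply hb; ext; simp; omega
      · simp
    · simp only [h, dif_neg, not_false_eq_true]
      apply Finset.sum_eq_zero
      intro b _
      rw [if_neg]; omega
  · simp

/-- Frobenius product. -/
def fro {N : ℕ} (A B : Matrix (Fin N) (Fin N) ℝ) : ℝ := ∑ i, ∑ j, A i j * B i j

lemma fro_eq {N : ℕ} (A B : Matrix (Fin N) (Fin N) ℝ) : fro A B = (A.transpose * B).trace := by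
  unfold fro
  simp only [Matrix.trace, Matrix.diag, Matrix.mul_apply, Matrix.transpose_apply]
  rw [Finset.sum_comm]

lemma fro_self_nonneg {N : ℕ} (A : Matrix (Fin N) (Fin N) ℝ) : 0 ≤ fro A A :=
  Finset.sum_nonneg fun _ _ => Finset.sum_nonneg fun _ _ => mul_self_nonneg _

lemma fro_self_eq_zero {N : ℕ} {A : Matrix (Fin N) (Fin N) ℝ} (h : fro A A = 0) : A = 0 := by
  ext i j
  have h1 := (Finset.sum_eq_zero_iff_of_nonneg (f := fun i => ∑ j, A i j * A i j)
    (fun _ _ => Finset.sum_nonneg fun _ _ => mul_self_nonneg _)).mp h i (Finset.mem_univ _)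
  have h2 := (Finset.sum_eq_zero_iff_of_nonneg (f := fun j => A i j * A i j)
    (fun _ _ => mul_self_nonneg _)).mp h1 j (Finset.mem_univ _)
  simpa using h2

lemma fro_comm {N : ℕ} (A B : Matrix (Fin N) (Fin N) ℝ) : fro A B = fro B A := by
  simp [fro, mul_comm]

lemma fro_add {N : ℕ} (A B C : Matrix (Fin N) (Fin N) ℝ) : fro A (B + C) = fro A B + fro A C := by
  simp [fro, mul_add, Finset.sum_add_distrib]

lemma fro_transpose {N : ℕ} (A B : Matrix (Fin N) (Fin N) ℝ) :
    fro A.transpose B.transpose = fro A B := by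
  unfold fro; rw [Finset.sum_comm]; rfl

lemma fro_mul_left {N : ℕ} (D A B : Matrix (Fin N) (Fin N) ℝ) :
    fro A (D.transpose * B) = fro (D * A) B := by
  simp only [fro_eq, Matrix.transpose_mul, Matrix.mul_assoc]

lemma fro_mul_right {N : ℕ} (D A B : Matrix (Fin N) (Fin N) ℝ) :
    fro A (B * D) = fro (A * D.transpose) B := by
  simp only [fro_eq, Matrix.transpose_mul, Matrix.transpose_transpose]
  rw [← Matrix.mul_assoc, Matrix.trace_mul_comm, Matrix.mul_assoc]

def onesM (N : ℕ) : Matrix (Fin N) (Fin N) ℝ := fun _ _ => 1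

/-- key energy identity -/
lemma cross_energy {N : ℕ} (D W : Matrix (Fin N) (Fin N) ℝ) :
    fro (D.transpose * D * W) (W * (D.transpose * D)) =
      fro (D * W * D.transpose) (D * W * D.transpose) := by
  rw [fro_comm, Matrix.mul_assoc, fro_mul_left, ← Matrix.mul_assoc, ← Matrix.mul_assoc,
    fro_comm, fro_mul_right]

lemma poisson {N : ℕ} (G : Matrix (Fin N) (Fin N) ℝ) (hG : ∑ i, ∑ j, G i j = 0) :
    ∃ W : Matrix (Fin N) (Fin N) ℝ,
      (dMat N).transpose * dMat N * W + W * ((dMat N).transpose * dMat N) = G := by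
  set D := dMat N with hD
  have hD1 : ∀ i, ∑ j, D i j = 0 := by
    intro i
    have := dMat_sum (fun _ => (1:ℝ)) i
    simpa using this
  let T : Matrix (Fin N) (Fin N) ℝ →ₗ[ℝ] Matrix (Fin N) (Fin N) ℝ :=
    { toFun := fun W => D.transpose * D * W + W * (D.transpose * D) + fro (onesM N) W • onesM N
      map_add' := by
        intro A B
        simp only [mul_add, add_mul, fro_add, add_smul]; abel
      map_smul' := by
        intro c A
        have : fro (onesM N) (c • A) = c * fro (onesM N) A := by
          simp [fro, onesM, Finset.mul_sum]
        simp [this, mul_smul] }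
  have hT : ∀ W, T W = D.transpose * D * W + W * (D.transpose * D) + fro (onesM N) W • onesM N :=
    fun _ => rfl
  have e1 : ∀ W : Matrix (Fin N) (Fin N) ℝ, fro W (D.transpose * D * W) = fro (D*W) (D*W) := by
    intro W; rw [Matrix.mul_assoc, fro_mul_left]
  have e2 : ∀ W : Matrix (Fin N) (Fin N) ℝ,
      fro W (W * (D.transpose * D)) = fro (W*D.transpose) (W*D.transpose) := by
    intro W; rw [← Matrix.mul_assoc, fro_mul_right]
  have e3 : ∀ W : Matrix (Fin N) (Fin N) ℝ, fro W (fro (onesM N) W • onesM N) =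
      fro (onesM N) W * fro (onesM N) W := by
    intro W
    conv_rhs => rw [fro_comm (onesM N) W]
    rw [fro_comm (onesM N) W]
    simp only [fro, onesM, Matrix.smul_apply, smul_eq_mul, mul_one, Finset.sum_mul]
  have inj : Function.Injective T := by
    rw [injective_iff_map_eq_zero]
    intro W hW
    have h0 : fro W (T W) = 0 := by rw [hW]; simp [fro]
    rw [hT, fro_add, fro_add, e1, e2, e3] at h0
    have p1 := fro_self_nonneg (D*W)
    have p2 := fro_self_nonneg (W*D.transpose)
    have p3 := mul_self_nonneg (fro (onesM N) W)
    have q1 : D * W = 0 := fro_self_eq_zero (by linarith)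
    have q2 : W * D.transpose = 0 := fro_self_eq_zero (by linarith)
    have q3 : fro (onesM N) W = 0 := by nlinarith
    have r1 : ∀ (i : ℕ) (h : i < N) (j : Fin N), W ⟨i, h⟩ j = W ⟨0, by omega⟩ j := by
      intro i
      induction i with
      | zero => intros; rfl
      | succ i ih =>
        intro h j
        have := congrFun (congrFun q1 ⟨i, by omega⟩) j
        rw [Matrix.mul_apply, dMat_sum (fun l => W l j)] at this
        simp only [h, dif_pos, Matrix.zero_apply] at this
        rw [← ih (by omega) j]; linarith
    have r2 : ∀ (i : ℕ) (h : i < N) (j : Fin N), W j ⟨i, h⟩ = W j ⟨0, by omega⟩ := by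
      intro i
      induction i with
      | zero => intros; rfl
      | succ i ih =>
        intro h j
        have := congrFun (congrFun q2 j) ⟨i, by omega⟩
        rw [Matrix.mul_apply] at this
        simp only [Matrix.transpose_apply] at this
        have h3 := dMat_sum (fun l => W j l) ⟨i, by omega⟩
        simp only [mul_comm] at h3
        rw [h3] at this
        simp only [h, dif_pos, Matrix.zero_apply] at this
        rw [← ih (by omega) j]; linarith
    ext i j
    have hN : 0 < N := by have := i.2; omega
    have hc : ∀ a b, W a b = W ⟨0, hN⟩ ⟨0, hN⟩ := by
      intro a b
      rw [← r2 b b.2, ← r1 a a.2]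
    rw [hc i j]
    have : fro (onesM N) W = (N:ℝ) * N * W ⟨0, hN⟩ ⟨0, hN⟩ := by
      simp only [fro, onesM, hc]
      simp; ring
    rw [this] at q3
    have : (N:ℝ) ≠ 0 := by positivity
    simpa [this] using q3
  obtain ⟨W, hW⟩ := (LinearMap.injective_iff_surjective.mp inj) G
  refine ⟨W, ?_⟩
  have s1 : fro (onesM N) (D.transpose * D * W) = 0 := by
    rw [Matrix.mul_assoc, fro_mul_left]
    have : D * onesM N = 0 := by
      ext i j; simp [Matrix.mul_apply, onesM, hD1]
    rw [this]; simp [fro]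
  have s2 : fro (onesM N) (W * (D.transpose * D)) = 0 := by
    rw [← Matrix.mul_assoc, fro_mul_right]
    have : onesM N * D.transpose = 0 := by
      ext i j; simp [Matrix.mul_apply, onesM, hD1]
    rw [this]; simp [fro]
  have s3 : fro (onesM N) G = 0 := by simpa [fro, onesM] using hG
  have s4 : fro (onesM N) (fro (onesM N) W • onesM N) = N * N * fro (onesM N) W := by
    simp [fro, onesM, Finset.mul_sum, mul_assoc]
  rw [← hW, hT, fro_add, fro_add, s1, s2, s4] at s3
  by_cases hN : N = 0
  · subst hN; ext i; exact i.elim0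
  have : (N:ℝ) ≠ 0 := by positivity
  have s5 : fro (onesM N) W = 0 := by simpa [this] using s3
  rw [← hW, hT, s5]; simp

/-- grid data produced from the Poisson solution -/
structure Adm (N : ℕ) (G : ℕ → ℕ → ℝ) (u : ℕ → ℕ → ℝ) : Prop where
  zero_left : ∀ i, u i 0 = 0
  zero_right : ∀ i, u i N = 0
  vert : ∑ i ∈ Finset.range N, ∑ k ∈ Finset.range N, (u i (k+1) - u i k)^2 ≤
    ∑ i ∈ Finset.range N, ∑ k ∈ Finset.range N, (G i k)^2
  horiz : ∑ k ∈ Finset.range N, ∑ i ∈ Finset.range (N-1), (u (i+1) k - u i k)^2 ≤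
    ∑ i ∈ Finset.range N, ∑ k ∈ Finset.range N, (G i k)^2
  gain : (∑ i ∈ Finset.range N, ∑ k ∈ Finset.range N, (G i k)^2) / 2 ≤
    ∑ i ∈ Finset.range N, ∑ k ∈ Finset.range N, G i k * (u i (k+1) - u i k)

lemma adm_of_poisson {N : ℕ} (G : ℕ → ℕ → ℝ) (M W : Matrix (Fin N) (Fin N) ℝ)
    (hM : ∀ i j : Fin N, M i j = G i j)
    (hW : (dMat N).transpose * dMat N * W + W * ((dMat N).transpose * dMat N) = M)
    (hg : fro M M / 2 ≤ fro M (W * ((dMat N).transpose * dMat N))) :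
    ∃ u, Adm N G u := by
  set D := dMat N with hD
  set U := W * D.transpose with hU
  have hUl : ∀ i k : Fin N, (k:ℕ) + 1 = N → U i k = 0 := by
    intro i k hk
    rw [hU, Matrix.mul_apply]
    simp only [Matrix.transpose_apply]
    have h3 := dMat_sum (fun l => W i l) k
    simp only [mul_comm] at h3
    rw [h3, dif_neg]; omega
  let u : ℕ → ℕ → ℝ := fun i k =>
    if h : i < N ∧ 0 < k ∧ k ≤ N then - U ⟨i, h.1⟩ ⟨k-1, by omega⟩ else 0
  have hE : ∑ i ∈ Finset.range N, ∑ k ∈ Finset.range N, (G i k)^2 = fro M M := by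
    simp only [Finset.sum_range, fro, hM, sq]
  have hdiff : ∀ i k : Fin N, u i (k+1) - u i k = (W * (D.transpose * D)) i k := by
    intro i k
    rw [← Matrix.mul_assoc, ← hU, Matrix.mul_apply, dMat_sum' (fun l => U i l) (hUl i)]
    have h1 : u i (k+1) = - U i k := by
      simp only [u]
      rw [dif_pos ⟨i.2, by omega, by omega⟩]
      simp
    rw [h1]
    simp only [u]
    by_cases h : 0 < (k:ℕ)
    · rw [dif_pos ⟨i.2, h, by omega⟩, dif_pos h]; ring
    · rw [dif_neg (by tauto), dif_neg h]; ring
  have hexp : fro M M = fro (D.transpose * D * W) (D.transpose * D * W) +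
      fro (W * (D.transpose * D)) (W * (D.transpose * D)) +
      2 * fro (D * W * D.transpose) (D * W * D.transpose) := by
    rw [← cross_energy, ← hW, fro_add, fro_comm _ (D.transpose * D * W),
      fro_comm _ (W * (D.transpose * D)), fro_add, fro_add,
      fro_comm (W * (D.transpose * D)) (D.transpose * D * W)]
    ring
  have n1 := fro_self_nonneg (D.transpose * D * W)
  have n2 := fro_self_nonneg (W * (D.transpose * D))
  have n3 := fro_self_nonneg (D * W * D.transpose)
  refine ⟨u, ?_, ?_, ?_, ?_, ?_⟩
  · intro i; simp [u]
  · intro i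
    simp only [u]
    split_ifs with h
    · rw [hUl _ _ (by simp; omega)]; simp
    · rfl
  · rw [hE]
    simp only [Finset.sum_range, hdiff]
    have : ∑ i, ∑ k, (W * (D.transpose * D)) i k ^ 2 = fro (W * (D.transpose * D)) (W * (D.transpose * D)) := by
      simp only [fro, sq]
    rw [this]; linarith
  · rw [hE]
    have key : ∑ k ∈ Finset.range N, ∑ i ∈ Finset.range (N-1), (u (i+1) k - u i k)^2 ≤
        fro (D * U) (D * U) := by
      rcases N with _ | n
      · simp [fro]
      simp only [Nat.add_sub_cancel]
      rw [Finset.sum_range_succ']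
      have z : ∑ i ∈ Finset.range n, (u (i+1) 0 - u i 0)^2 = 0 := by simp [u]
      have hf : fro (D * U) (D * U) = ∑ k, ∑ i, (D * U) i k * (D * U) i k := by
        unfold fro; exact Finset.sum_comm
      rw [z, add_zero, hf, Fin.sum_univ_castSucc]
      have : 0 ≤ ∑ x, (D * U) x (Fin.last n) * (D * U) x (Fin.last n) :=
        Finset.sum_nonneg fun _ _ => mul_self_nonneg _
      refine le_trans ?_ (le_add_of_nonneg_right this)
      rw [Finset.sum_range]
      apply Finset.sum_le_sum
      intro k _
      rw [Fin.sum_univ_castSucc, Finset.sum_range]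
      refine le_trans ?_ (le_add_of_nonneg_right (mul_self_nonneg _))
      apply Finset.sum_le_sum
      intro i _
      apply le_of_eq
      rw [← sq]
      rw [Matrix.mul_apply, dMat_sum (fun l => U l k.castSucc)]
      rw [dif_pos (by simp)]
      simp only [u]
      rw [dif_pos ⟨by omega, by omega, by omega⟩, dif_pos ⟨by omega, by omega, by omega⟩]
      have a1 : (⟨(k:ℕ)+1-1, by omega⟩ : Fin (n+1)) = k.castSucc := by ext; simp
      have a2 : (⟨(i:ℕ), by omega⟩ : Fin (n+1)) = i.castSucc := by ext; simp
      rw [a1, a2]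
      simp only [Fin.val_castSucc]
      ring
    rw [hU, ← Matrix.mul_assoc] at key
    linarith
  · rw [hE]
    refine hg.trans (le_of_eq ?_)
    simp only [Finset.sum_range, hdiff, fro, hM]

lemma exists_adm (N : ℕ) (G : ℕ → ℕ → ℝ)
    (hG : ∑ i ∈ Finset.range N, ∑ k ∈ Finset.range N, G i k = 0) :
    (∃ u, Adm N G u) ∨ (∃ u, Adm N (fun i k => G k i) u) := by
  let M : Matrix (Fin N) (Fin N) ℝ := fun i j => G i j
  obtain ⟨W, hW⟩ := poisson M (by simpa [Finset.sum_range] using hG)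
  have hs : fro M M = fro M ((dMat N).transpose * dMat N * W) +
      fro M (W * ((dMat N).transpose * dMat N)) := by
    rw [← fro_add, hW]
  by_cases h : fro M M / 2 ≤ fro M (W * ((dMat N).transpose * dMat N))
  · exact Or.inl (adm_of_poisson G M W (fun _ _ => rfl) hW h)
  · right
    have hT := congrArg Matrix.transpose hW
    rw [Matrix.transpose_add] at hT
    have t1 : ((dMat N).transpose * dMat N * W).transpose =
      W.transpose * ((dMat N).transpose * dMat N) := by
      simp [Matrix.transpose_mul]
    have t2 : (W * ((dMat N).transpose * dMat N)).transpose =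
      ((dMat N).transpose * dMat N) * W.transpose := by
      simp [Matrix.transpose_mul]
    refine adm_of_poisson _ M.transpose W.transpose (fun _ _ => rfl) ?_ ?_
    · rw [← hT, t1, t2, add_comm]
    · rw [← t1, fro_transpose, fro_transpose]; linarith
open Classical in
/-- rising sun lemma, one-sided -/
lemma rising_aux (a : ℕ → ℝ) (n : ℕ) (K : ℝ) (hK : 0 < K) :
    ∀ d m : ℕ, m + d = n →
    K^2 * (((Finset.Ico m n).filter (fun k : ℕ => ∃ l, k < l ∧ l ≤ n ∧ K * ((l:ℝ) - k) < |a l - a k|)).card : ℝ)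
      ≤ ∑ t ∈ Finset.Ico m n, (a (t+1) - a t)^2 := by
  intro d
  induction d using Nat.strong_induction_on with
  | _ d ih =>
  intro m hm
  by_cases hd : d = 0
  · have : m = n := by omega
    subst this; simp
  set P : ℕ → Prop := fun k => ∃ l, k < l ∧ l ≤ n ∧ K * ((l:ℝ) - k) < |a l - a k| with hP
  by_cases hb : P m
  · obtain ⟨l, hml, hln, hl⟩ := hb
    have h1 := ih (n - l) (by omega) l (by omega)
    have hsplit : (Finset.Ico m n) = Finset.Ico m l ∪ Finset.Ico l n := by
      rw [Finset.Ico_union_Ico_eq_Ico hml.le hln]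
    have hcard : (((Finset.Ico m n).filter P).card : ℝ) ≤ ((l:ℝ) - m) + (((Finset.Ico l n).filter P).card : ℝ) := by
      rw [hsplit, Finset.filter_union]
      have h2 := Finset.card_union_le ((Finset.Ico m l).filter P) ((Finset.Ico l n).filter P)
      have h3 := Finset.card_filter_le (Finset.Ico m l) P
      rw [Nat.card_Ico] at h3
      have h4 : ((l - m : ℕ) : ℝ) = (l:ℝ) - m := by push_cast [Nat.cast_sub hml.le]; ring
      rw [← h4]
      exact_mod_cast h2.trans (by omega)
    have htel : a l - a m = ∑ t ∈ Finset.Ico m l, (a (t+1) - a t) := by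
      rw [Finset.sum_Ico_sub _ hml.le]
    have hcs : (a l - a m)^2 ≤ ((l:ℝ) - m) * ∑ t ∈ Finset.Ico m l, (a (t+1) - a t)^2 := by
      rw [htel]
      have := sq_sum_le_card_mul_sum_sq (s := Finset.Ico m l) (f := fun t => a (t+1) - a t)
      rw [Nat.card_Ico, Nat.cast_sub hml.le] at this
      exact this
    have hpos : (0:ℝ) < (l:ℝ) - m := by
      have : (m:ℝ) < l := by exact_mod_cast hml
      linarith
    have hsq : (K * ((l:ℝ) - m))^2 ≤ (a l - a m)^2 := by
      rw [← sq_abs (a l - a m)]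
      exact pow_le_pow_left₀ (by positivity) hl.le 2
    have h5 : K^2 * ((l:ℝ) - m) ≤ ∑ t ∈ Finset.Ico m l, (a (t+1) - a t)^2 := by
      have : ((l:ℝ) - m) * (K^2 * ((l:ℝ) - m)) ≤ ((l:ℝ) - m) * ∑ t ∈ Finset.Ico m l, (a (t+1) - a t)^2 := by
        nlinarith
      exact le_of_mul_le_mul_left this hpos
    have h6 : ∑ t ∈ Finset.Ico m n, (a (t+1) - a t)^2 = ∑ t ∈ Finset.Ico m l, (a (t+1) - a t)^2 +
      ∑ t ∈ Finset.Ico l n, (a (t+1) - a t)^2 := (Finset.sum_Ico_consecutive _ hml.le hln).symm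
    rw [h6]
    have : K^2 * (((Finset.Ico m n).filter P).card : ℝ) ≤ K^2 * (((l:ℝ) - m) + (((Finset.Ico l n).filter P).card : ℝ)) := by gcongr
    linarith
  · have h1 := ih (d - 1) (by omega) (m+1) (by omega)
    have hmn : m < n := by omega
    have : (Finset.Ico m n).filter P = (Finset.Ico (m+1) n).filter P := by
      ext k
      simp only [Finset.mem_filter, Finset.mem_Ico]
      constructor
      · rintro ⟨⟨h1, h2⟩, h3⟩
        refine ⟨⟨?_, h2⟩, h3⟩
        rcases Nat.lt_or_ge m k with h | h
        · exact h
        · have : k = m := by omega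
          subst this; exact absurd h3 hb
      · rintro ⟨⟨h1, h2⟩, h3⟩
        exact ⟨⟨by omega, h2⟩, h3⟩
    rw [this]
    refine h1.trans ?_
    rw [Finset.sum_eq_sum_Ico_succ_bot hmn]
    have := sq_nonneg (a (m+1) - a m)
    linarith

open Classical in
lemma rising_two (a : ℕ → ℝ) (n : ℕ) (K : ℝ) (hK : 0 < K) :
    K^2 * (((Finset.range (n+1)).filter (fun k : ℕ => ∃ l, l ≤ n ∧ K * |(l:ℝ) - k| < |a l - a k|)).card : ℝ)
      ≤ 2 * ∑ t ∈ Finset.range n, (a (t+1) - a t)^2 := by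
  have h1 := rising_aux a n K hK n 0 (by simp)
  have h2 := rising_aux (fun k => a (n - k)) n K hK n 0 (by simp)
  set S1 := (Finset.Ico 0 n).filter (fun k : ℕ => ∃ l, k < l ∧ l ≤ n ∧ K * ((l:ℝ) - k) < |a l - a k|)
  set S2 := (Finset.Ico 0 n).filter (fun k : ℕ => ∃ l, k < l ∧ l ≤ n ∧ K * ((l:ℝ) - k) < |a (n - l) - a (n - k)|)
  have hs : ∑ t ∈ Finset.Ico 0 n, (a (n - (t+1)) - a (n - t))^2 = ∑ t ∈ Finset.range n, (a (t+1) - a t)^2 := by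
    rw [← Finset.range_eq_Ico, ← Finset.sum_range_reflect]
    apply Finset.sum_congr rfl
    intro j hj
    have hj := Finset.mem_range.mp hj
    have e1 : n - (n - 1 - j + 1) = j := by omega
    have e2 : n - (n - 1 - j) = j + 1 := by omega
    rw [e1, e2]; ring
  have hsub : (Finset.range (n+1)).filter (fun k : ℕ => ∃ l, l ≤ n ∧ K * |(l:ℝ) - k| < |a l - a k|) ⊆
      S1 ∪ S2.image (fun k => n - k) := by
    intro k hk
    simp only [Finset.mem_filter, Finset.mem_range] at hk
    obtain ⟨hkn, l, hln, hl⟩ := hk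
    rw [Finset.mem_union]
    rcases lt_trichotomy k l with h | h | h
    · left
      simp only [S1, Finset.mem_filter, Finset.mem_Ico]
      refine ⟨⟨by omega, by omega⟩, l, h, hln, ?_⟩
      have : (k:ℝ) < l := by exact_mod_cast h
      rwa [abs_of_pos (by linarith)] at hl
    · subst h; simp at hl
    · right
      rw [Finset.mem_image]
      refine ⟨n - k, ?_, by omega⟩
      simp only [S2, Finset.mem_filter, Finset.mem_Ico]
      refine ⟨⟨by omega, by omega⟩, n - l, by omega, by omega, ?_⟩
      have : (l:ℝ) < k := by exact_mod_cast h
      rw [abs_of_neg (by linarith)] at hl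
      have e1 : n - (n - l) = l := by omega
      have e2 : n - (n - k) = k := by omega
      rw [e1, e2, Nat.cast_sub (by omega), Nat.cast_sub (by omega)]
      convert hl using 2; ring
  have hc := (Finset.card_le_card hsub).trans ((Finset.card_union_le _ _).trans
    (Nat.add_le_add_left Finset.card_image_le _))
  rw [hs] at h2
  rw [← Finset.range_eq_Ico] at h1
  have hc' : ((((Finset.range (n+1)).filter (fun k : ℕ => ∃ l, l ≤ n ∧ K * |(l:ℝ) - k| < |a l - a k|)).card : ℕ) : ℝ) ≤ S1.card + S2.card := by exact_mod_cast hc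
  have : K^2 * (((Finset.range (n+1)).filter (fun k : ℕ => ∃ l, l ≤ n ∧ K * |(l:ℝ) - k| < |a l - a k|)).card : ℝ) ≤ K^2 * (S1.card + S2.card) := by
    gcongr
  linarith

/-- a grid point is good when it sees Lipschitz growth along its row and column -/
def GoodPt (N : ℕ) (u : ℕ → ℕ → ℝ) (K : ℝ) (i k : ℕ) : Prop :=
  (∀ l, l ≤ N → |u i l - u i k| ≤ K * |(l:ℝ) - k|) ∧
  (∀ j, j < N → |u j k - u i k| ≤ K * |(j:ℝ) - i|)

lemma good_lip {N : ℕ} {u : ℕ → ℕ → ℝ} {K : ℝ} {i k j l : ℕ} (h1 : GoodPt N u K i k)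
    (h2 : GoodPt N u K j l) (hi : i < N) (hl : l ≤ N) :
    |u i k - u j l| ≤ K * |(i:ℝ) - j| + K * |(k:ℝ) - l| := by
  have a1 := h1.1 l hl
  have a2 := h2.2 i hi
  have : u i k - u j l = -(u i l - u i k) + (u i l - u j l) := by ring
  rw [this]
  refine (abs_add_le _ _).trans ?_
  rw [abs_neg, abs_sub_comm (k:ℝ)]
  linarith

open Classical in
/-- number of bad cells -/
lemma bad_count {N : ℕ} {G u : ℕ → ℕ → ℝ} (h : Adm N G u) {K : ℝ} (hK : 0 < K) :
    K^2 * ((((Finset.range N) ×ˢ (Finset.range N)).filter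
      (fun p => ¬ (GoodPt N u K p.1 p.2 ∧ GoodPt N u K p.1 (p.2+1)))).card : ℝ)
      ≤ 8 * ∑ i ∈ Finset.range N, ∑ k ∈ Finset.range N, (G i k)^2 := by
  set E := ∑ i ∈ Finset.range N, ∑ k ∈ Finset.range N, (G i k)^2 with hE
  -- vertical bad points
  set V := ((Finset.range N) ×ˢ (Finset.range (N+1))).filter
    (fun p : ℕ × ℕ => ∃ l, l ≤ N ∧ K * |(l:ℝ) - p.2| < |u p.1 l - u p.1 p.2|) with hV
  set H := ((Finset.range N) ×ˢ (Finset.range N)).filter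
    (fun p : ℕ × ℕ => ∃ j, j < N ∧ K * |(j:ℝ) - p.1| < |u j p.2 - u p.1 p.2|) with hH
  have cV : K^2 * (V.card : ℝ) ≤ 2 * E := by
    have : (V.card : ℝ) = ∑ i ∈ Finset.range N, (((Finset.range (N+1)).filter
        (fun k : ℕ => ∃ l, l ≤ N ∧ K * |(l:ℝ) - k| < |u i l - u i k|)).card : ℝ) := by
      rw [hV, Finset.card_filter, Finset.sum_product]
      push_cast
      apply Finset.sum_congr rfl
      intro i _
      rw [Finset.card_filter]; push_cast; rfl
    rw [this, Finset.mul_sum]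
    refine (Finset.sum_le_sum fun i _ => rising_two (u i) N K hK).trans ?_
    rw [← Finset.mul_sum]
    have := h.vert
    linarith
  have cH : K^2 * (H.card : ℝ) ≤ 2 * E := by
    have : (H.card : ℝ) = ∑ k ∈ Finset.range N, (((Finset.range N).filter
        (fun i : ℕ => ∃ j, j < N ∧ K * |(j:ℝ) - i| < |u j k - u i k|)).card : ℝ) := by
      rw [hH, Finset.card_filter, Finset.sum_product_right]
      push_cast
      apply Finset.sum_congr rfl
      intro i _
      rw [Finset.card_filter]; push_cast; rfl
    rw [this, Finset.mul_sum]
    rcases N with _ | n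
    · simp [hE]
    have := h.horiz
    refine (Finset.sum_le_sum fun k _ => ?_).trans (?_ : ∑ k ∈ Finset.range (n+1), 2 * ∑ i ∈ Finset.range n, (u (i+1) k - u i k)^2 ≤ _)
    · have := rising_two (fun i => u i k) n K hK
      simp only [Nat.lt_succ_iff]
      exact this
    · rw [← Finset.mul_sum]
      simp only [Nat.add_sub_cancel] at this
      linarith
  have hbad : ((Finset.range N) ×ˢ (Finset.range N)).filter
      (fun p => ¬ (GoodPt N u K p.1 p.2 ∧ GoodPt N u K p.1 (p.2+1))) ⊆
      (V ∪ H) ∪ (V ∪ H).image (fun p => (p.1, p.2 - 1)) := by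
    have key : ∀ i k, i < N → k ≤ N → ¬ GoodPt N u K i k → (i,k) ∈ V ∪ H := by
      intro i k hi hk hg
      rw [Finset.mem_union]
      by_contra hcon
      push Not at hcon
      apply hg
      refine ⟨fun l hl => ?_, fun j hj => ?_⟩
      · by_contra hc
        apply hcon.1
        simp only [hV, Finset.mem_filter, Finset.mem_product, Finset.mem_range]
        exact ⟨⟨hi, by omega⟩, l, hl, not_le.mp hc⟩
      · by_cases hkN : k = N
        · subst hkN
          rw [h.zero_right, h.zero_right]; simp; positivity
        by_contra hc
        apply hcon.2
        simp only [hH, Finset.mem_filter, Finset.mem_product, Finset.mem_range]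
        exact ⟨⟨hi, by omega⟩, j, hj, not_le.mp hc⟩
    rintro ⟨i, k⟩ hp
    simp only [Finset.mem_filter, Finset.mem_product, Finset.mem_range] at hp
    obtain ⟨⟨hi, hk⟩, hg⟩ := hp
    rw [Finset.mem_union]
    by_cases h1 : GoodPt N u K i k
    · right
      rw [Finset.mem_image]
      exact ⟨(i, k+1), key i (k+1) hi hk (fun h2 => hg ⟨h1, h2⟩), by simp⟩
    · left; exact key i k hi hk.le h1
  have hc := (Finset.card_le_card hbad).trans ((Finset.card_union_le _ _).trans
    (Nat.add_le_add_left Finset.card_image_le _))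
  have hc2 := Finset.card_union_le V H
  have hc3 : ((((Finset.range N) ×ˢ (Finset.range N)).filter
      (fun p => ¬ (GoodPt N u K p.1 p.2 ∧ GoodPt N u K p.1 (p.2+1)))).card : ℝ) ≤ 2 * (V.card + H.card) := by
    have : (((Finset.range N) ×ˢ (Finset.range N)).filter
      (fun p => ¬ (GoodPt N u K p.1 p.2 ∧ GoodPt N u K p.1 (p.2+1)))).card ≤ 2 * (V.card + H.card) := by omega
    exact_mod_cast this
  have : K^2 * ((((Finset.range N) ×ˢ (Finset.range N)).filter
      (fun p => ¬ (GoodPt N u K p.1 p.2 ∧ GoodPt N u K p.1 (p.2+1)))).card : ℝ) ≤ K^2 * (2 * (V.card + H.card)) := by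
    gcongr
  linarith

def Qsq : Set (ℝ × ℝ) := Icc 0 1 ×ˢ Icc 0 1
def QB : Set (ℝ × ℝ) := {p ∈ Qsq | p.1 = 0 ∨ p.1 = 1 ∨ p.2 = 0 ∨ p.2 = 1}

/-- plateau points and their values -/
def PlatR (N : ℕ) (u : ℕ → ℕ → ℝ) (K η : ℝ) (p : ℝ × ℝ) (v : ℝ) : Prop :=
  ∃ i k : ℕ, i < N ∧ k ≤ N ∧ GoodPt N u K i k ∧ ((i:ℝ) + η)/N ≤ p.1 ∧ p.1 ≤ ((i:ℝ) + 1 - η)/N ∧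
    η ≤ p.1 ∧ p.1 ≤ 1 - η ∧ p.2 = (k:ℝ)/N ∧ v = u i k / N

lemma abs_idx {η : ℝ} (h0 : 0 < η) (h2 : η < 1/2) {i j : ℕ} {a b N : ℝ} (hN : 0 < N)
    (h3 : ((i:ℝ) + η)/N ≤ a) (h4 : a ≤ ((i:ℝ) + 1 - η)/N)
    (h5 : ((j:ℝ) + η)/N ≤ b) (h6 : b ≤ ((j:ℝ) + 1 - η)/N) :
    |(i:ℝ) - j| / N ≤ |a - b| / η := by
  have aux : ∀ (i j : ℕ) (a b : ℝ), i < j → a ≤ ((i:ℝ) + 1 - η)/N → ((j:ℝ) + η)/N ≤ b →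
      ((j:ℝ) - i)/N ≤ (b - a)/η := by
    intro i j a b hij ha hb
    rw [div_le_div_iff₀ hN h0]
    rw [le_div_iff₀ hN] at ha
    rw [div_le_iff₀ hN] at hb
    have : (i:ℝ) + 1 ≤ j := by exact_mod_cast hij
    nlinarith
  rcases lt_trichotomy i j with h | h | h
  · have h7 := aux i j a b h h4 h5
    have : (i:ℝ) < j := by exact_mod_cast h
    rw [abs_of_neg (by linarith), neg_sub]
    refine le_trans h7 ?_
    gcongr
    rw [abs_sub_comm]; exact le_abs_self _
  · subst h; simp; positivity
  · have h7 := aux j i b a h h6 h3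
    have : (j:ℝ) < i := by exact_mod_cast h
    rw [abs_of_pos (by linarith)]
    refine le_trans h7 ?_
    gcongr
    exact le_abs_self _

lemma plat_lip {N : ℕ} {G u : ℕ → ℕ → ℝ} (h : Adm N G u) (hN : 0 < N) {K η : ℝ} (hK : 0 < K)
    (h0 : 0 < η) (h2 : η < 1/2) {p q : ℝ × ℝ} {v w : ℝ}
    (hp : PlatR N u K η p v) (hq : PlatR N u K η q w) :
    |v - w| ≤ K * (|p.1 - q.1| / η) + K * |p.2 - q.2| := by
  obtain ⟨i, k, hi, hk, hg, a1, a2, a3, a4, a5, rfl⟩ := hp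
  obtain ⟨j, l, hj, hl, hg', b1, b2, b3, b4, b5, rfl⟩ := hq
  have hN' : (0:ℝ) < N := by exact_mod_cast hN
  have c1 := good_lip hg hg' hi hl
  have c2 := abs_idx h0 h2 hN' a1 a2 b1 b2
  have c3 : |p.2 - q.2| = |(k:ℝ) - l| / N := by
    rw [a5, b5, ← sub_div, abs_div, abs_of_pos hN']
  rw [← sub_div, abs_div, abs_of_pos hN', c3]
  have c4 : |u i k - u j l| / N ≤ (K * |(i:ℝ) - j| + K * |(k:ℝ) - l|) / N := by gcongr
  have c5 : (K * |(i:ℝ) - j| + K * |(k:ℝ) - l|) / N = K * (|(i:ℝ) - j|/N) + K * (|(k:ℝ) - l| / N) := by ring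
  have c6 : K * (|(i:ℝ) - j|/N) ≤ K * (|p.1 - q.1| / η) := by gcongr
  linarith

lemma plat_bd {N : ℕ} {G u : ℕ → ℕ → ℝ} (h : Adm N G u) (hN : 0 < N) {K η : ℝ} (hK : 0 < K)
    (h0 : 0 < η) {p q : ℝ × ℝ} {v : ℝ}
    (hp : PlatR N u K η p v) (hq : q ∈ QB) :
    |v| ≤ K * (|p.1 - q.1| / η) + K * |p.2 - q.2| := by
  obtain ⟨i, k, hi, hk, hg, a1, a2, a3, a4, a5, rfl⟩ := hp
  have hN' : (0:ℝ) < N := by exact_mod_cast hN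
  rw [abs_div, abs_of_pos hN']
  have e0 : |u i k| / N ≤ K * p.2 := by
    have := hg.1 0 (by omega)
    rw [h.zero_left, zero_sub, abs_neg] at this
    simp only [Nat.cast_zero, zero_sub, abs_neg, Nat.abs_cast] at this
    rw [a5]
    calc |u i k| / N ≤ K * k / N := by gcongr
      _ = K * (k / N) := by ring
  have e1 : |u i k| / N ≤ K * (1 - p.2) := by
    have := hg.1 N le_rfl
    rw [h.zero_right, zero_sub, abs_neg] at this
    have hk' : (k:ℝ) ≤ N := by exact_mod_cast hk
    rw [abs_of_nonneg (by linarith : (0:ℝ) ≤ N - k)] at this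
    rw [a5]
    calc |u i k| / N ≤ K * (N - k) / N := by gcongr
      _ = K * (1 - k / N) := by field_simp
  have hp2 : 0 ≤ p.2 := by rw [a5]; positivity
  have n1 : 0 ≤ K * (|p.1 - q.1| / η) := by positivity
  have n2 : 0 ≤ K * |p.2 - q.2| := by positivity
  obtain ⟨hqQ, hq⟩ := hq
  have e2 : |u i k| / N ≤ K := by nlinarith
  rcases hq with hq | hq | hq | hq
  · have : 1 ≤ |p.1 - q.1| / η := by
      rw [hq, le_div_iff₀ h0, sub_zero, one_mul]; exact a3.trans (le_abs_self _)
    nlinarith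
  · have : 1 ≤ |p.1 - q.1| / η := by
      rw [hq, le_div_iff₀ h0, abs_sub_comm, one_mul]
      exact (by linarith : η ≤ 1 - p.1).trans (le_abs_self _)
    nlinarith
  · rw [hq, sub_zero, abs_of_nonneg hp2] at *; linarith
  · have : 1 - p.2 ≤ |p.2 - q.2| := by rw [hq, abs_sub_comm]; exact le_abs_self _
    nlinarith

open Classical in
lemma exists_g {N : ℕ} {G u : ℕ → ℕ → ℝ} (h : Adm N G u) (hN : 0 < N) {K η : ℝ} (hK : 0 < K)
    (h0 : 0 < η) (h2 : η < 1/2) :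
    ∃ g : ℝ × ℝ → ℝ,
      (∀ p q, |g p - g q| ≤ 2 * K * max (|p.1 - q.1| / η) |p.2 - q.2|) ∧
      (∀ p ∈ QB, g p = 0) ∧
      (∀ p v, PlatR N u K η p v → g p = v) := by
  let R : ℝ × ℝ → ℝ → Prop := fun p v => (p ∈ QB ∧ v = 0) ∨ PlatR N u K η p v
  have hR : ∀ p q v w, R p v → R q w → |v - w| ≤ K * (|p.1 - q.1| / η) + K * |p.2 - q.2| := by
    intro p q v w hp hq
    rcases hp with ⟨hp, rfl⟩ | hp
    · rcases hq with ⟨hq, rfl⟩ | hq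
      · simp; positivity
      · have := plat_bd h hN hK h0 hq hp
        rw [zero_sub, abs_neg, abs_sub_comm p.1, abs_sub_comm p.2]; exact this
    · rcases hq with ⟨hq, rfl⟩ | hq
      · rw [sub_zero]; exact plat_bd h hN hK h0 hp hq
      · exact plat_lip h hN hK h0 h2 hp hq
  let f : ℝ × ℝ → ℝ := fun p => if H : ∃ v, R p v then H.choose else 0
  have hf : ∀ p v, R p v → f p = v := by
    intro p v hv
    have H : ∃ v, R p v := ⟨v, hv⟩
    have e : f p = H.choose := dif_pos H
    rw [e]
    have := hR p p _ _ H.choose_spec hv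
    simp at this
    linarith
  let S : Set (ℝ × ℝ) := {p | ∃ v, R (η * p.1, p.2) v}
  have hl : LipschitzOnWith (Real.toNNReal (2*K)) (fun p : ℝ × ℝ => f (η * p.1, p.2)) S := by
    apply LipschitzOnWith.of_dist_le_mul
    rintro p ⟨v, hv⟩ q ⟨w, hw⟩
    rw [hf _ _ hv, hf _ _ hw, Real.dist_eq, Real.coe_toNNReal _ (by positivity)]
    refine (hR _ _ _ _ hv hw).trans ?_
    simp only
    have : |η * p.1 - η * q.1| / η = |p.1 - q.1| := by
      rw [← mul_sub, abs_mul, abs_of_pos h0]; field_simp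
    rw [this, Prod.dist_eq, Real.dist_eq, Real.dist_eq]
    have m1 := le_max_left |p.1 - q.1| |p.2 - q.2|
    have m2 := le_max_right |p.1 - q.1| |p.2 - q.2|
    nlinarith
  obtain ⟨g', hg', heq⟩ := hl.extend_real
  have hval : ∀ p v, R p v → g' (p.1/η, p.2) = v := by
    intro p v hv
    have e : (η * (p.1/η), p.2) = p := by
      ext
      · simp; field_simp
      · rfl
    have hm : (p.1/η, p.2) ∈ S := ⟨v, by simp only [e]; exact hv⟩
    rw [← heq hm]
    simp only [e]
    exact hf _ _ hv
  refine ⟨fun p => g' (p.1/η, p.2), ?_, ?_, ?_⟩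
  · intro p q
    have := hg'.dist_le_mul (p.1/η, p.2) (q.1/η, q.2)
    rw [Real.dist_eq, Real.coe_toNNReal _ (by positivity), Prod.dist_eq, Real.dist_eq, Real.dist_eq] at this
    simp only [← sub_div, abs_div, abs_of_pos h0] at this
    exact this
  · intro p hp; exact hval p 0 (Or.inl ⟨hp, rfl⟩)
  · intro p v hv; exact hval p v (Or.inr hv)

def GoodCell (N : ℕ) (u : ℕ → ℕ → ℝ) (K η : ℝ) (i k : ℕ) : Prop :=
  (GoodPt N u K i k ∧ GoodPt N u K i (k+1)) ∧ (η * N ≤ i ∧ (i:ℝ) + 1 ≤ N - η * N)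

open Classical in
lemma bad_cols (N : ℕ) {η : ℝ} (h0 : 0 < η) :
    (((Finset.range N).filter (fun i : ℕ => ¬ (η * N ≤ i ∧ (i:ℝ) + 1 ≤ N - η * N))).card : ℝ) ≤
      2 * (η * N + 1) := by
  have hsub : (Finset.range N).filter (fun i : ℕ => ¬ (η * N ≤ i ∧ (i:ℝ) + 1 ≤ N - η * N)) ⊆
      Finset.range ⌈η * N⌉₊ ∪ (Finset.range ⌈η * N⌉₊).image (fun i => N - 1 - i) := by
    intro i hi
    simp only [Finset.mem_filter, Finset.mem_range] at hi
    obtain ⟨hiN, hi⟩ := hi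
    rw [Finset.mem_union]
    by_cases h : η * N ≤ i
    · right
      rw [Finset.mem_image]
      refine ⟨N - 1 - i, ?_, by omega⟩
      rw [Finset.mem_range, Nat.lt_ceil]
      have : ¬ ((i:ℝ) + 1 ≤ N - η * N) := fun h' => hi ⟨h, h'⟩
      have e : ((N - 1 - i : ℕ) : ℝ) = (N:ℝ) - 1 - i := by
        rw [Nat.cast_sub (by omega), Nat.cast_sub (by omega)]; simp
      rw [e]; linarith
    · left
      rw [Finset.mem_range, Nat.lt_ceil]; linarith
  have hc := (Finset.card_le_card hsub).trans ((Finset.card_union_le _ _).trans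
    (Nat.add_le_add_left Finset.card_image_le _))
  rw [Finset.card_range] at hc
  have h1 := Nat.ceil_lt_add_one (by positivity : 0 ≤ η * N)
  have hc' : (((Finset.range N).filter (fun i : ℕ => ¬ (η * N ≤ i ∧ (i:ℝ) + 1 ≤ N - η * N))).card : ℝ) ≤
    (⌈η * N⌉₊ : ℝ) + ⌈η * N⌉₊ := by exact_mod_cast hc
  linarith

open Classical in
lemma bad_cells {N : ℕ} {G u : ℕ → ℕ → ℝ} (h : Adm N G u) {K η : ℝ} (hK : 0 < K) (h0 : 0 < η) :
    ((((Finset.range N) ×ˢ (Finset.range N)).filter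
      (fun p => ¬ GoodCell N u K η p.1 p.2)).card : ℝ)
      ≤ 8 * (∑ i ∈ Finset.range N, ∑ k ∈ Finset.range N, (G i k)^2) / K^2 + 2 * (η * N + 1) * N := by
  have h1 := bad_count h hK
  have h2 := bad_cols N h0
  set B1 := ((Finset.range N) ×ˢ (Finset.range N)).filter
      (fun p => ¬ (GoodPt N u K p.1 p.2 ∧ GoodPt N u K p.1 (p.2+1)))
  set B2 := (Finset.range N).filter (fun i : ℕ => ¬ (η * N ≤ i ∧ (i:ℝ) + 1 ≤ N - η * N))
  have hsub : ((Finset.range N) ×ˢ (Finset.range N)).filter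
      (fun p => ¬ GoodCell N u K η p.1 p.2) ⊆ B1 ∪ B2 ×ˢ (Finset.range N) := by
    rintro ⟨i, k⟩ hp
    rw [Finset.mem_filter, Finset.mem_product] at hp
    obtain ⟨⟨hp1, hp2⟩, hp3⟩ := hp
    simp only [Finset.mem_range] at hp1 hp2
    simp only [GoodCell] at hp3
    simp only [Finset.mem_filter, Finset.mem_product, Finset.mem_range, B1, B2,
      Finset.mem_union]
    tauto
  have hc := (Finset.card_le_card hsub).trans (Finset.card_union_le _ _)
  rw [Finset.card_product, Finset.card_range] at hc
  have hc' : ((((Finset.range N) ×ˢ (Finset.range N)).filter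
      (fun p => ¬ GoodCell N u K η p.1 p.2)).card : ℝ) ≤ B1.card + B2.card * N := by exact_mod_cast hc
  have h3 : (B1.card : ℝ) ≤ 8 * (∑ i ∈ Finset.range N, ∑ k ∈ Finset.range N, (G i k)^2) / K^2 := by
    rw [le_div_iff₀ (by positivity)]; linarith
  have h4 : (B2.card : ℝ) * N ≤ 2 * (η * N + 1) * N := by gcongr
  linarith

open Classical in
lemma gain_sum {N : ℕ} (hN : 0 < N) (F : Finset (ℕ × ℕ)) (hF : F ⊆ Finset.range N ×ˢ Finset.range N)
    {u : ℕ → ℕ → ℝ} {m v0 K : ℝ} (hm : m = F.card / (N:ℝ)^2)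
    (h : Adm N (fun i k => (if (i,k) ∈ F then 1 else 0) - m) u)
    (hv0 : 0 < v0) (hv : v0 ≤ m * (1 - m)) (hK : K = 100 / v0) (hNK : K^2 ≤ N) :
    v0 / 4 * (N:ℝ)^2 ≤ ∑ p ∈ F, (if GoodCell N u K (1/K^2) p.1 p.2
      then (u p.1 (p.2+1) - u p.1 p.2) - 6 * K * (1/K^2) else - 2 * K) := by
  have hN' : (0:ℝ) < N := by exact_mod_cast hN
  have hK0 : 0 < K := by rw [hK]; positivity
  set η := 1/K^2 with hη
  have hη0 : 0 < η := by positivity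
  set d : ℕ × ℕ → ℝ := fun p => u p.1 (p.2+1) - u p.1 p.2 with hd
  set Q := Finset.range N ×ˢ Finset.range N with hQ
  set f : ℕ × ℕ → ℝ := fun p => if p ∈ F then 1 else 0 with hf
  have sQ : ∀ a : ℕ × ℕ → ℝ, ∑ i ∈ Finset.range N, ∑ k ∈ Finset.range N, a (i,k) = ∑ p ∈ Q, a p := by
    intro a; rw [hQ, Finset.sum_product]
  have hcQ : (Q.card : ℝ) = N^2 := by simp [hQ, sq]
  have sf : ∀ a : ℕ × ℕ → ℝ, ∑ p ∈ Q, f p * a p = ∑ p ∈ F, a p := by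
    intro a
    simp only [hf, ite_mul, one_mul, zero_mul]
    rw [← Finset.sum_filter]
    congr 1
    ext p; simp only [Finset.mem_filter]; exact ⟨fun h => h.2, fun h => ⟨hF h, h⟩⟩
  have sf1 : ∑ p ∈ Q, f p = m * N^2 := by
    have := sf (fun _ => 1)
    simp only [mul_one] at this
    rw [this, hm]; simp; field_simp
  -- energy
  have hE : ∑ i ∈ Finset.range N, ∑ k ∈ Finset.range N, ((if (i,k) ∈ F then (1:ℝ) else 0) - m)^2 = (m * (1-m)) * N^2 := by
    rw [sQ (fun p => (f p - m)^2)]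
    have : ∀ p, (f p - m)^2 = (1 - 2*m) * f p + m^2 := by
      intro p; simp only [hf]; split_ifs <;> ring
    simp only [this, Finset.sum_add_distrib, ← Finset.mul_sum, sf1]
    simp only [Finset.sum_const, nsmul_eq_mul, hcQ]; ring
  have hbad := bad_cells h hK0 hη0
  have hvert := h.vert
  have hgain := h.gain
  simp only [hE] at hbad hvert hgain
  rw [sQ (fun p => (d p)^2)] at hvert
  rw [sQ (fun p => (f p - m) * d p)] at hgain
  have sd : ∑ p ∈ Q, d p = 0 := by
    rw [← sQ]
    apply Finset.sum_eq_zero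
    intro i _
    simp only [hd]
    rw [Finset.sum_range_sub (u i), h.zero_left, h.zero_right, sub_zero]
  have hg2 : ∑ p ∈ Q, (f p - m) * d p = ∑ p ∈ F, d p := by
    simp only [sub_mul, Finset.sum_sub_distrib, ← Finset.mul_sum, sd, sf]; ring
  rw [hg2] at hgain
  -- pointwise
  have hpt : ∀ p, d p - 6*K*η - 3 * K * (if ¬ GoodCell N u K η p.1 p.2 then 1 else 0) - (d p)^2 / (2*K) ≤
      (if GoodCell N u K η p.1 p.2 then d p - 6 * K * η else - 2 * K) := by
    intro p
    have h1 : 0 ≤ (d p)^2 / (2*K) := by positivity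
    have h2 : d p ≤ (d p)^2 / (2*K) + K/2 := by
      have : (d p)^2 / (2*K) + K/2 - d p = (d p - K)^2 / (2*K) := by field_simp; ring
      have : 0 ≤ (d p - K)^2 / (2*K) := by positivity
      linarith
    have h3 : 0 < K * η := by positivity
    by_cases hg : GoodCell N u K η p.1 p.2
    · simp only [hg, not_true_eq_false, if_true, if_false]; linarith
    · simp only [hg, not_false_eq_true, if_true, if_false]; linarith
  refine le_trans ?_ (Finset.sum_le_sum fun p _ => hpt p)
  simp only [Finset.sum_sub_distrib]
  have t1 : ∑ p ∈ F, 6*K*η ≤ 6*K*η*N^2 := by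
    rw [Finset.sum_const, nsmul_eq_mul, ← hcQ, mul_comm]
    gcongr
  have t2 : ∑ p ∈ F, 3 * K * (if ¬ GoodCell N u K η p.1 p.2 then (1:ℝ) else 0) ≤
      3 * K * ((Q.filter (fun p => ¬ GoodCell N u K η p.1 p.2)).card : ℝ) := by
    rw [← Finset.mul_sum, Finset.card_filter]
    push_cast
    have := Finset.sum_le_sum_of_subset_of_nonneg (f := fun p : ℕ × ℕ => if ¬ GoodCell N u K η p.1 p.2 then (1:ℝ) else 0) hF
      (fun p _ _ => by positivity)
    exact mul_le_mul_of_nonneg_left this (by positivity)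
  have t3 : ∑ p ∈ F, (d p)^2 / (2*K) ≤ (m * (1-m)) * N^2 / (2*K) := by
    rw [← Finset.sum_div]
    gcongr
    refine le_trans ?_ hvert
    exact Finset.sum_le_sum_of_subset_of_nonneg hF (fun p _ _ => by positivity)
  have hv4 : m * (1-m) ≤ 1/4 := by nlinarith [sq_nonneg (m - 1/2)]
  set v := m * (1-m)
  have t4 : 3 * K * ((Q.filter (fun p => ¬ GoodCell N u K η p.1 p.2)).card : ℝ) ≤
      3 * K * (8 * (v * N^2) / K^2 + 2 * (η * N + 1) * N) := by gcongr
  have t5 : 3 * K * (8 * (v * N^2) / K^2 + 2 * (η * N + 1) * N) ≤ 18 / K * N^2 := by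
    have a1 : 3 * K * (8 * (v * N^2) / K^2 + 2 * (η * N + 1) * N) = 24 * v / K * N^2 + 6 / K * N^2 + 6 * (K^2) / K * N := by
      rw [hη]; field_simp; ring
    rw [a1]
    have a2 : 24 * v / K * N^2 ≤ 6 / K * N^2 := by gcongr; linarith
    have a3 : 6 * K^2 / K * N ≤ 6 * N / K * N := by gcongr
    have a4 : 6 * N / K * N = 6 / K * (N:ℝ)^2 := by ring
    have a5 : 18 / K * (N:ℝ)^2 = 6 / K * N^2 + 6 / K * N^2 + 6 / K * N^2 := by ring
    linarith
  have t6 : v * N^2 / (2*K) ≤ 1 / K * N^2 := by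
    rw [div_le_iff₀ (by positivity)]
    have : 1 / K * (N:ℝ)^2 * (2*K) = 2 * N^2 := by field_simp
    rw [this]
    have : (0:ℝ) ≤ N^2 := by positivity
    nlinarith
  have t7 : 6*K*η*N^2 = 6 / K * (N:ℝ)^2 := by rw [hη]; field_simp
  have hKi : 1 / K = v0 / 100 := by rw [hK]; field_simp
  have e6 : 6 / K = 6 * (v0/100) := by rw [← hKi]; ring
  have e18 : 18 / K = 18 * (v0/100) := by rw [← hKi]; ring
  rw [hKi] at t6
  rw [e6] at t7
  rw [e18] at t5
  have : (0:ℝ) < N^2 := by positivity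
  have : v0 * (N:ℝ)^2 ≤ v * N^2 := by gcongr
  linarith

def shear (e : ℝ × ℝ → ℝ) (p : ℝ × ℝ) : ℝ × ℝ := (p.1, p.2 + e p)

def Nice (C : ℝ) (φ : ℝ × ℝ → ℝ × ℝ) : Prop :=
  BijOn φ Qsq Qsq ∧
  (∀ p ∈ Qsq, ∀ q ∈ Qsq, dist p q ≤ C * dist (φ p) (φ q) ∧ dist (φ p) (φ q) ≤ C * dist p q) ∧
  ∀ p ∈ QB, φ p = p

def HalfLip (e : ℝ × ℝ → ℝ) : Prop := ∀ p q : ℝ × ℝ, |e p - e q| ≤ 1/2 * max |p.1 - q.1| |p.2 - q.2|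

lemma shear_bilip {e : ℝ × ℝ → ℝ} (he : HalfLip e) (p q : ℝ × ℝ) :
    dist p q ≤ 2 * dist (shear e p) (shear e q) ∧ dist (shear e p) (shear e q) ≤ 2 * dist p q := by
  have h := he p q
  simp only [Prod.dist_eq, Real.dist_eq, shear]
  have e1 : p.2 + e p - (q.2 + e q) = (p.2 - q.2) + (e p - e q) := by ring
  rw [e1]
  have t1 := abs_add_le (p.2 - q.2) (e p - e q)
  have t2 : |p.2 - q.2| ≤ |(p.2 - q.2) + (e p - e q)| + |e p - e q| := by
    have := abs_sub ((p.2 - q.2) + (e p - e q)) (e p - e q)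
    simpa using this
  have hx := abs_nonneg (p.1 - q.1)
  have hy := abs_nonneg (p.2 - q.2)
  generalize |p.1 - q.1| = x at *
  generalize |p.2 - q.2| = y at *
  generalize |p.2 - q.2 + (e p - e q)| = z at *
  generalize |e p - e q| = w at *
  constructor
  · rcases max_cases x y with ⟨h1, h2⟩ | ⟨h1, h2⟩ <;> rw [h1] at h ⊢
    · linarith [le_max_left x z]
    · linarith [le_max_right x z]
  · apply max_le
    · linarith [le_max_left x y]
    · linarith [le_max_right x y]

lemma halfLip_cont {e : ℝ × ℝ → ℝ} (he : HalfLip e) : Continuous e := by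
  have : LipschitzWith 1 e := by
    apply LipschitzWith.of_dist_le_mul
    intro p q
    have := he p q
    rw [Real.dist_eq, Prod.dist_eq, Real.dist_eq, Real.dist_eq]
    have h0 : 0 ≤ max |p.1 - q.1| |p.2 - q.2| := le_max_of_le_left (abs_nonneg _)
    simp only [NNReal.coe_one, one_mul]
    linarith
  exact this.continuous

lemma shear_inj {e : ℝ × ℝ → ℝ} (he : HalfLip e) : Function.Injective (shear e) := by
  intro p q h
  have := (shear_bilip he p q).1
  rw [h, dist_self, mul_zero] at this
  exact dist_le_zero.mp this

/-- intermediate values along vertical segments -/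
lemma shear_ivt {e : ℝ × ℝ → ℝ} (he : HalfLip e) {x a b y : ℝ} (hab : a ≤ b)
    (h1 : a + e (x,a) ≤ y) (h2 : y < b + e (x,b)) : ∃ s ∈ Ico a b, shear e (x,s) = (x,y) := by
  have hc : ContinuousOn (fun s => s + e (x,s)) (Icc a b) := by
    have := halfLip_cont he
    fun_prop
  obtain ⟨s, hs, hs'⟩ := intermediate_value_Icc hab hc ⟨h1, h2.le⟩
  refine ⟨s, ⟨hs.1, lt_of_le_of_ne hs.2 ?_⟩, ?_⟩
  · rintro rfl
    simp only at hs'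
    linarith
  · simp only [shear]; simp only at hs'; rw [hs']

lemma shear_nice {e : ℝ × ℝ → ℝ} (he : HalfLip e) (h0 : ∀ p ∈ QB, e p = 0) : Nice 2 (shear e) := by
  have hfix : ∀ p ∈ QB, shear e p = p := by
    intro p hp; simp [shear, h0 p hp]
  refine ⟨⟨?_, (shear_inj he).injOn, ?_⟩, fun p _ q _ => shear_bilip he p q, hfix⟩
  · rintro ⟨x, y⟩ ⟨hx, hy⟩
    simp only [mem_Icc] at hx hy
    have a1 := he (x,y) (x,0)
    have a2 := he (x,y) (x,1)
    rw [h0 (x,0) ⟨⟨hx, by simp⟩, by simp⟩] at a1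
    rw [h0 (x,1) ⟨⟨hx, by simp⟩, by simp⟩] at a2
    simp only [sub_self, abs_zero, sub_zero] at a1 a2
    rw [max_eq_right (abs_nonneg _), abs_of_nonneg hy.1] at a1
    rw [max_eq_right (abs_nonneg _), abs_of_nonpos (by linarith : y - 1 ≤ 0)] at a2
    rw [abs_le] at a1 a2
    refine ⟨hx, ?_, ?_⟩ <;> simp only [shear] <;> linarith
  · rintro ⟨x, y⟩ ⟨hx, hy⟩
    simp only [mem_Icc] at hx hy
    rcases eq_or_lt_of_le hy.2 with h | h
    · have hm : (x,y) ∈ QB := ⟨⟨hx, hy⟩, by simp [h]⟩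
      exact ⟨(x,y), hm.1, hfix _ hm⟩
    · have b1 := h0 (x,0) ⟨⟨hx, by simp⟩, by simp⟩
      have b2 := h0 (x,1) ⟨⟨hx, by simp⟩, by simp⟩
      obtain ⟨s, hs, hs'⟩ := shear_ivt he (x := x) (y := y) zero_le_one (by rw [b1]; linarith) (by rw [b2]; linarith)
      exact ⟨(x,s), ⟨hx, ⟨hs.1, hs.2.le⟩⟩, hs'⟩

def cell (N : ℕ) (p : ℕ × ℕ) : Set (ℝ × ℝ) :=
  Ico ((p.1:ℝ)/N) (((p.1:ℝ)+1)/N) ×ˢ Ico ((p.2:ℝ)/N) (((p.2:ℝ)+1)/N)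

lemma cell_eq {N : ℕ} (hN : 0 < N) {p : ℕ × ℕ} {z : ℝ × ℝ} (h : z ∈ cell N p) :
    p = (⌊z.1 * N⌋₊, ⌊z.2 * N⌋₊) := by
  have hN' : (0:ℝ) < N := by exact_mod_cast hN
  obtain ⟨⟨h1, h2⟩, ⟨h3, h4⟩⟩ := h
  rw [div_le_iff₀ hN'] at h1 h3
  rw [lt_div_iff₀ hN'] at h2 h4
  ext
  · symm; simp only
    rw [Nat.floor_eq_iff (le_trans (by positivity) h1)]; exact ⟨h1, h2⟩
  · symm; simp only
    rw [Nat.floor_eq_iff (le_trans (by positivity) h3)]; exact ⟨h3, h4⟩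

lemma mem_cell_floor {N : ℕ} (hN : 0 < N) {z : ℝ × ℝ} (h1 : 0 ≤ z.1) (h2 : 0 ≤ z.2) :
    z ∈ cell N (⌊z.1 * N⌋₊, ⌊z.2 * N⌋₊) := by
  have hN' : (0:ℝ) < N := by exact_mod_cast hN
  refine ⟨⟨?_, ?_⟩, ⟨?_, ?_⟩⟩ <;> simp only
  · rw [div_le_iff₀ hN']; exact Nat.floor_le (by positivity)
  · rw [lt_div_iff₀ hN']; exact Nat.lt_floor_add_one _
  · rw [div_le_iff₀ hN']; exact Nat.floor_le (by positivity)
  · rw [lt_div_iff₀ hN']; exact Nat.lt_floor_add_one _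

lemma cell_disj {N : ℕ} (hN : 0 < N) {p q : ℕ × ℕ} (h : p ≠ q) : Disjoint (cell N p) (cell N q) := by
  rw [Set.disjoint_left]
  intro z h1 h2
  exact h ((cell_eq hN h1).trans (cell_eq hN h2).symm)

lemma cell_meas (N : ℕ) (p : ℕ × ℕ) : MeasurableSet (cell N p) := measurableSet_Ico.prod measurableSet_Ico

lemma cell_vol {N : ℕ} (hN : 0 < N) (p : ℕ × ℕ) : volume (cell N p) = ENNReal.ofReal (1/(N:ℝ)^2) := by
  have hN' : (0:ℝ) < N := by exact_mod_cast hN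
  rw [cell, Measure.volume_eq_prod, Measure.prod_prod, Real.volume_Ico, Real.volume_Ico, ← ENNReal.ofReal_mul]
  · congr 1; field_simp; ring
  · have : ((p.1:ℝ)+1)/N - p.1/N = 1/N := by field_simp; ring
    rw [this]; positivity

def cells (N : ℕ) (F : Finset (ℕ × ℕ)) : Set (ℝ × ℝ) := ⋃ p ∈ F, cell N p

lemma cells_meas (N : ℕ) (F : Finset (ℕ × ℕ)) : MeasurableSet (cells N F) :=
  F.measurableSet_biUnion fun p _ => cell_meas N p

lemma cells_vol {N : ℕ} (hN : 0 < N) (F : Finset (ℕ × ℕ)) :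
    volume (cells N F) = ENNReal.ofReal (F.card / (N:ℝ)^2) := by
  rw [cells, measure_biUnion_finset (fun p _ q _ h => cell_disj hN h) (fun p _ => cell_meas N p)]
  simp only [cell_vol hN, Finset.sum_const, nsmul_eq_mul]
  rw [← ENNReal.ofReal_natCast, ← ENNReal.ofReal_mul (by positivity)]
  congr 1; ring

lemma cells_sub {N : ℕ} (hN : 0 < N) (F : Finset (ℕ × ℕ)) (hF : F ⊆ Finset.range N ×ˢ Finset.range N) :
    cells N F ⊆ Qsq := by
  have hN' : (0:ℝ) < N := by exact_mod_cast hN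
  intro z hz
  simp only [cells, mem_iUnion] at hz
  obtain ⟨p, hp, ⟨h1, h2⟩, ⟨h3, h4⟩⟩ := hz
  have := hF hp
  simp only [Finset.mem_product, Finset.mem_range] at this
  have a1 : (p.1:ℝ) + 1 ≤ N := by exact_mod_cast this.1
  have a2 : (p.2:ℝ) + 1 ≤ N := by exact_mod_cast this.2
  have b1 : ((p.1:ℝ) + 1)/N ≤ 1 := by rw [div_le_one hN']; exact a1
  have b2 : ((p.2:ℝ) + 1)/N ≤ 1 := by rw [div_le_one hN']; exact a2
  exact ⟨⟨le_trans (by positivity) h1, by linarith⟩, ⟨le_trans (by positivity) h3, by linarith⟩⟩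

def hgt (e : ℝ × ℝ → ℝ) (N : ℕ) (k : ℕ) (x : ℝ) : ℝ :=
  1/N + (e (x, ((k:ℝ)+1)/N) - e (x, (k:ℝ)/N))

def strip (e : ℝ × ℝ → ℝ) (N : ℕ) (p : ℕ × ℕ) : Set (ℝ × ℝ) :=
  regionBetween (fun x => (p.2:ℝ)/N + e (x, (p.2:ℝ)/N))
    (fun x => ((p.2:ℝ)+1)/N + e (x, ((p.2:ℝ)+1)/N)) (Ico ((p.1:ℝ)/N) (((p.1:ℝ)+1)/N))

lemma strip_sub {e : ℝ × ℝ → ℝ} (he : HalfLip e) {N : ℕ} (p : ℕ × ℕ) :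
    strip e N p ⊆ shear e '' cell N p := by
  rintro ⟨x, y⟩ ⟨hx, hy⟩
  simp only [mem_Ioo] at hx hy
  obtain ⟨s, hs, hs'⟩ := shear_ivt he (x := x) (y := y) (a := (p.2:ℝ)/N) (b := ((p.2:ℝ)+1)/N)
    (by gcongr; linarith) hy.1.le hy.2
  exact ⟨(x,s), ⟨hx, hs⟩, hs'⟩

lemma strip_meas {e : ℝ × ℝ → ℝ} (he : HalfLip e) (N : ℕ) (p : ℕ × ℕ) : MeasurableSet (strip e N p) := by
  have := halfLip_cont he
  apply measurableSet_regionBetween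
  · exact Continuous.measurable (by fun_prop)
  · exact Continuous.measurable (by fun_prop)
  · exact measurableSet_Ico

lemma hgt_cont {e : ℝ × ℝ → ℝ} (he : HalfLip e) (N k : ℕ) : Continuous (hgt e N k) := by
  have := halfLip_cont he
  unfold hgt; fun_prop

lemma intOn_Ico {f : ℝ → ℝ} (hf : Continuous f) (a b : ℝ) : IntegrableOn f (Ico a b) :=
  (hf.integrableOn_Icc (a := a) (b := b)).mono_set Ico_subset_Icc_self

lemma hgt_nonneg {e : ℝ × ℝ → ℝ} (he : HalfLip e) {N : ℕ} (hN : 0 < N) (k : ℕ) (x : ℝ) :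
    0 ≤ hgt e N k x := by
  have hN' : (0:ℝ) < N := by exact_mod_cast hN
  have := he (x, ((k:ℝ)+1)/N) (x, (k:ℝ)/N)
  have e1 : ((k:ℝ)+1)/N - k/N = 1/N := by field_simp; ring
  simp only [e1, sub_self, abs_zero] at this
  rw [max_eq_right (abs_nonneg _), abs_of_pos (by positivity : (0:ℝ) < 1/N), abs_le] at this
  have h2 : (0:ℝ) < 1/N := by positivity
  unfold hgt; linarith

lemma strip_vol {e : ℝ × ℝ → ℝ} (he : HalfLip e) {N : ℕ} (hN : 0 < N) (p : ℕ × ℕ) :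
    volume (strip e N p) =
      ENNReal.ofReal (∫ x in Ico ((p.1:ℝ)/N) (((p.1:ℝ)+1)/N), hgt e N p.2 x) := by
  have hN' : (0:ℝ) < N := by exact_mod_cast hN
  have hc := halfLip_cont he
  have heq : ∀ x : ℝ, ((p.2:ℝ)+1)/N + e (x, ((p.2:ℝ)+1)/N) - ((p.2:ℝ)/N + e (x, (p.2:ℝ)/N)) = hgt e N p.2 x := by
    intro x; unfold hgt; field_simp; ring
  rw [strip, Measure.volume_eq_prod, volume_regionBetween_eq_integral]
  · congr 1
    apply setIntegral_congr_fun measurableSet_Ico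
    intro x _
    exact heq x
  · exact intOn_Ico (by fun_prop) _ _
  · exact intOn_Ico (by fun_prop) _ _
  · exact measurableSet_Ico
  · intro x _
    have := hgt_nonneg he hN p.2 x
    rw [← heq] at this
    linarith

lemma cells_shear {e : ℝ × ℝ → ℝ} (he : HalfLip e) {N : ℕ} (hN : 0 < N) (F : Finset (ℕ × ℕ))
    (c : ℕ × ℕ → ℝ) (hc : ∀ p ∈ F, c p ≤ ∫ x in Ico ((p.1:ℝ)/N) (((p.1:ℝ)+1)/N), hgt e N p.2 x) :
    ENNReal.ofReal (∑ p ∈ F, c p) ≤ volume (shear e '' cells N F) := by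
  have hd : ∀ p q, p ≠ q → Disjoint (strip e N p) (strip e N q) := by
    intro p q h
    exact ((Set.disjoint_image_iff (shear_inj he)).mpr (cell_disj hN h)).mono (strip_sub he p) (strip_sub he q)
  calc ENNReal.ofReal (∑ p ∈ F, c p)
      ≤ ENNReal.ofReal (∑ p ∈ F, ∫ x in Ico ((p.1:ℝ)/N) (((p.1:ℝ)+1)/N), hgt e N p.2 x) := by
        apply ENNReal.ofReal_le_ofReal; exact Finset.sum_le_sum hc
    _ = ∑ p ∈ F, volume (strip e N p) := by
        rw [ENNReal.ofReal_sum_of_nonneg]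
        · simp only [strip_vol he hN]
        · intro p _
          exact setIntegral_nonneg measurableSet_Ico fun x _ => hgt_nonneg he hN p.2 x
    _ = volume (⋃ p ∈ F, strip e N p) := by
        rw [measure_biUnion_finset (fun p _ q _ h => hd p q h) (fun p _ => strip_meas he N p)]
    _ ≤ volume (shear e '' cells N F) := by
        apply measure_mono
        rw [cells, image_iUnion₂]
        exact iUnion₂_mono fun p _ => strip_sub he p

/-- lower bound for cell integrals: crude part -/
lemma int_crude {f : ℝ → ℝ} (hf : Continuous f) {a L m0 : ℝ} (hL : 0 ≤ L)
    (h : ∀ x, m0 ≤ f x) : m0 * L ≤ ∫ x in Ico a (a+L), f x := by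
  have h1 : ∫ x in Ico a (a+L), m0 = m0 * L := by
    rw [setIntegral_const]; simp [measureReal_def, hL, mul_comm]
  rw [← h1]
  exact setIntegral_mono (integrableOn_const (by simp)) (intOn_Ico hf _ _) h

lemma int_plat {f : ℝ → ℝ} (hf : Continuous f) {a b c d m0 v : ℝ} (hab : a ≤ b) (hcd : c ≤ d) (hac : a ≤ c) (hdb : d < b)
    (h : ∀ x, m0 ≤ f x) (hv : ∀ x ∈ Icc c d, f x = v) :
    m0 * (b - a) + (v - m0) * (d - c) ≤ ∫ x in Ico a b, f x := by
  have h1 : ∫ x in Ico a b, m0 = m0 * (b - a) := by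
    rw [setIntegral_const]; simp [measureReal_def, hab, mul_comm]
  have hi : IntegrableOn (fun x => f x - m0) (Ico a b) := intOn_Ico (by fun_prop) _ _
  have h2 : ∫ x in Icc c d, (f x - m0) ≤ ∫ x in Ico a b, (f x - m0) := by
    apply setIntegral_mono_set hi
    · exact Filter.Eventually.of_forall fun x => sub_nonneg.mpr (h x)
    · exact LE.le.eventuallyLE (fun x hx => ⟨hac.trans hx.1, hx.2.trans_lt hdb⟩)
  have h3 : ∫ x in Icc c d, (f x - m0) = (v - m0) * (d - c) := by
    have : ∫ x in Icc c d, (f x - m0) = ∫ x in Icc c d, (v - m0) := by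
      apply setIntegral_congr_fun measurableSet_Icc
      intro x hx; simp only [hv x hx]
    rw [this, setIntegral_const]; simp [measureReal_def, hcd, mul_comm]
  rw [integral_sub (intOn_Ico hf _ _) (integrableOn_const (by simp)), h1] at h2
  linarith

lemma cell_int {N : ℕ} (hN : 0 < N) {u : ℕ → ℕ → ℝ} {K η t : ℝ} {g : ℝ × ℝ → ℝ} (hK : 0 < K)
    (h0 : 0 < η) (h2 : η < 1/2) (ht : 0 < t) (he : HalfLip (fun p => t * g p))
    (hg1 : ∀ p q, |g p - g q| ≤ 2 * K * max (|p.1 - q.1| / η) |p.2 - q.2|)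
    (hg3 : ∀ p v, PlatR N u K η p v → g p = v) {i k : ℕ} (hi : i < N) (hk : k < N) :
    (1/(N:ℝ)^2 - t/N^2 * (2*K) ≤ ∫ x in Ico ((i:ℝ)/N) (((i:ℝ)+1)/N), hgt (fun p => t * g p) N k x) ∧
    (GoodCell N u K η i k → 1/(N:ℝ)^2 + t/N^2 * ((u i (k+1) - u i k) - 6 * K * η) ≤
      ∫ x in Ico ((i:ℝ)/N) (((i:ℝ)+1)/N), hgt (fun p => t * g p) N k x) := by
  have hN' : (0:ℝ) < N := by exact_mod_cast hN
  have hm0 : ∀ x, 1/(N:ℝ) - 2*K*t/N ≤ hgt (fun p => t * g p) N k x := by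
    intro x
    have := hg1 (x, ((k:ℝ)+1)/N) (x, (k:ℝ)/N)
    have e1 : ((k:ℝ)+1)/N - k/N = 1/N := by field_simp; ring
    simp only [e1, sub_self, abs_zero, zero_div] at this
    rw [max_eq_right (abs_nonneg _), abs_of_pos (by positivity : (0:ℝ) < 1/N), abs_le] at this
    have h3 := mul_le_mul_of_nonneg_left this.1 ht.le
    have h4 : t * -(2 * K * (1/N)) = - (2*K*t/N) := by ring
    unfold hgt
    rw [h4] at h3
    linarith
  have hlen : ((i:ℝ)+1)/N = (i:ℝ)/N + 1/N := by field_simp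
  constructor
  · have := int_crude (hgt_cont he N k) (a := (i:ℝ)/N) (L := 1/(N:ℝ)) (by positivity) hm0
    rw [hlen]
    refine le_trans (le_of_eq ?_) this
    field_simp
  · rintro ⟨⟨hp1, hp2⟩, hc1, hc2⟩
    have hval : ∀ x ∈ Icc (((i:ℝ)+η)/N) (((i:ℝ)+1-η)/N),
        hgt (fun p => t * g p) N k x = 1/N + t * (u i (k+1) - u i k)/N := by
      intro x hx
      have hx1 : η ≤ x := by
        refine le_trans ?_ hx.1
        rw [le_div_iff₀ hN']; linarith
      have hx2 : x ≤ 1 - η := by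
        refine le_trans hx.2 ?_
        rw [div_le_iff₀ hN']; linarith
      have a1 := hg3 (x, (k:ℝ)/N) _ ⟨i, k, hi, hk.le, hp1, hx.1, hx.2, hx1, hx2, rfl, rfl⟩
      have a2 := hg3 (x, ((k:ℝ)+1)/N) _ ⟨i, k+1, hi, hk, hp2, hx.1, hx.2, hx1, hx2, by push_cast; rfl, rfl⟩
      simp only [hgt, a1, a2]
      ring
    have hd : u i (k+1) - u i k ≤ K := by
      have := hp1.1 (k+1) hk
      push_cast at this
      rw [add_sub_cancel_left, abs_one, mul_one] at this
      exact (le_abs_self _).trans this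
    have := int_plat (hgt_cont he N k) (a := (i:ℝ)/N) (b := ((i:ℝ)+1)/N) (by gcongr; linarith)
      (by gcongr; linarith) (by gcongr; linarith) (by gcongr; linarith) hm0 hval
    refine le_trans ?_ this
    have e1 : (1/(N:ℝ) - 2*K*t/N) * (((i:ℝ)+1)/N - (i:ℝ)/N) + (1/N + t * (u i (k+1) - u i k)/N - (1/(N:ℝ) - 2*K*t/N)) * (((i:ℝ)+1-η)/N - ((i:ℝ)+η)/N)
      = 1/(N:ℝ)^2 + t/N^2 * ((u i (k+1) - u i k) - 2*η*((u i (k+1) - u i k) + 2 * K)) := by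
      field_simp; ring
    rw [e1]
    have e2 : (0:ℝ) < t/N^2 := by positivity
    refine add_le_add le_rfl (mul_le_mul_of_nonneg_left ?_ e2.le)
    have e3 : η * (u i (k+1) - u i k) ≤ η * K := mul_le_mul_of_nonneg_left hd h0.le
    linarith

lemma shear_gain {N : ℕ} (hN : 0 < N) (F : Finset (ℕ × ℕ)) (hF : F ⊆ Finset.range N ×ˢ Finset.range N)
    {u : ℕ → ℕ → ℝ} {m v0 K : ℝ} (hm : m = F.card / (N:ℝ)^2)
    (h : Adm N (fun i k => (if (i,k) ∈ F then 1 else 0) - m) u)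
    (hv0 : 0 < v0) (hv : v0 ≤ m * (1 - m)) (hK : K = 100 / v0) (hNK : K^2 ≤ N) :
    ∃ φ, Nice 2 φ ∧ ENNReal.ofReal (m + 1/(4*K^3) * (v0/4)) ≤ volume (φ '' cells N F) := by
  classical
  have hN' : (0:ℝ) < N := by exact_mod_cast hN
  have hK0 : 0 < K := by rw [hK]; positivity
  have hK1 : 100 ≤ K := by
    rw [hK, le_div_iff₀ hv0]; nlinarith [sq_nonneg (m - 1/2)]
  have hη0 : 0 < 1/K^2 := by positivity
  have hη1 : 1/K^2 < 1/2 := by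
    apply one_div_lt_one_div_of_lt <;> nlinarith
  obtain ⟨g, hg1, hg2, hg3⟩ := exists_g h hN hK0 hη0 hη1
  set t := 1/(4*K^3) with ht
  have ht0 : 0 < t := by positivity
  have he : HalfLip (fun p => t * g p) := by
    intro p q
    rw [← mul_sub, abs_mul, abs_of_pos ht0]
    have hM : max (|p.1 - q.1| / (1/K^2)) |p.2 - q.2| ≤ K^2 * max |p.1 - q.1| |p.2 - q.2| := by
      apply max_le
      · rw [div_div_eq_mul_div, div_one, mul_comm]
        gcongr; exact le_max_left _ _
      · have h1 : |p.2 - q.2| ≤ max |p.1 - q.1| |p.2 - q.2| := le_max_right _ _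
        have h2 : 0 ≤ |p.2 - q.2| := abs_nonneg _
        have h3 : 1 ≤ K^2 := by nlinarith
        exact h1.trans (le_mul_of_one_le_left (h2.trans h1) h3)
    calc t * |g p - g q| ≤ t * (2 * K * (K^2 * max |p.1 - q.1| |p.2 - q.2|)) := by
          gcongr
          exact (hg1 p q).trans (by gcongr)
      _ = 1/2 * max |p.1 - q.1| |p.2 - q.2| := by rw [ht]; field_simp; ring
  refine ⟨shear (fun p => t * g p), shear_nice he (fun p hp => by simp [hg2 p hp]), ?_⟩
  have hgs := gain_sum hN F hF hm h hv0 hv hK hNK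
  refine le_trans ?_ (cells_shear he hN F (fun p => 1/(N:ℝ)^2 + t/N^2 * (if GoodCell N u K (1/K^2) p.1 p.2
      then (u p.1 (p.2+1) - u p.1 p.2) - 6 * K * (1/K^2) else - 2 * K)) ?_)
  · apply ENNReal.ofReal_le_ofReal
    rw [Finset.sum_add_distrib, ← Finset.mul_sum, Finset.sum_const, nsmul_eq_mul]
    have h1 : (F.card : ℝ) * (1/(N:ℝ)^2) = m := by rw [hm]; ring
    rw [h1]
    have h2 : t * (v0/4) = t/N^2 * (v0/4 * N^2) := by field_simp
    rw [h2]
    gcongr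
  · intro p hp
    have := hF hp
    simp only [Finset.mem_product, Finset.mem_range] at this
    have hci := cell_int hN hK0 hη0 hη1 ht0 he hg1 hg3 this.1 this.2
    split_ifs with hgc
    · exact hci.2 hgc
    · refine le_trans (le_of_eq ?_) hci.1
      ring

lemma nice_vol {φ : ℝ × ℝ → ℝ × ℝ} (h : Nice 2 φ) {E : Set (ℝ × ℝ)} (hE : E ⊆ Qsq) :
    volume (φ '' E) ≤ 4 * volume E := by
  have hL : LipschitzOnWith 2 φ E := by
    apply LipschitzOnWith.of_dist_le_mul
    intro p hp q hq
    exact (h.2.1 p (hE hp) q (hE hq)).2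
  have := hL.hausdorffMeasure_image_le (d := 2) (by norm_num)
  rw [hausdorffMeasure_prod_real] at this
  refine this.trans (le_of_eq ?_)
  congr 1
  norm_num

lemma cell_dist {N : ℕ} {p : ℕ × ℕ} {z w : ℝ × ℝ} (hz : z ∈ cell N p) (hw : w ∈ cell N p) :
    dist z w < 1/N := by
  obtain ⟨⟨h1, h2⟩, ⟨h3, h4⟩⟩ := hz
  obtain ⟨⟨h5, h6⟩, ⟨h7, h8⟩⟩ := hw
  rw [add_div] at h2 h4 h6 h8
  rw [Prod.dist_eq, Real.dist_eq, Real.dist_eq]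
  apply max_lt <;> rw [abs_lt] <;> constructor <;> linarith

lemma volume_edge : volume (Qsq \ (Ico (0:ℝ) 1 ×ˢ Ico (0:ℝ) 1)) = 0 := by
  have h : Qsq \ (Ico (0:ℝ) 1 ×ˢ Ico (0:ℝ) 1) ⊆ ({1} ×ˢ univ) ∪ (univ ×ˢ {1}) := by
    rintro ⟨x, y⟩ ⟨⟨hx, hy⟩, h⟩
    simp only [mem_Icc] at hx hy
    simp only [mem_prod, mem_Ico, not_and_or, not_le, not_lt] at h
    simp only [mem_union, mem_prod, mem_singleton_iff, mem_univ, and_true, true_and]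
    rcases h with (h | h) | (h | h)
    · linarith
    · left; linarith
    · linarith
    · right; linarith
  apply measure_mono_null h
  apply measure_union_null <;> rw [Measure.volume_eq_prod, Measure.prod_prod] <;> simp

lemma volume_Qsq : volume Qsq = 1 := by
  rw [Qsq, Measure.volume_eq_prod, Measure.prod_prod]; simp

lemma approx {A : Set (ℝ × ℝ)} (hA : MeasurableSet A) (hAQ : A ⊆ Qsq) {κ : ℝ} (hκ : 0 < κ) (N0 : ℝ) :
    ∃ N : ℕ, 0 < N ∧ N0 ≤ N ∧ ∃ F ⊆ Finset.range N ×ˢ Finset.range N,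
      volume (A \ cells N F) ≤ ENNReal.ofReal κ ∧ volume (cells N F \ A) ≤ ENNReal.ofReal κ := by
  classical
  have hκ' : ENNReal.ofReal κ ≠ 0 := by simpa using hκ
  set A' := A ∩ (Ico (0:ℝ) 1 ×ˢ Ico (0:ℝ) 1) with hA'
  have hA'm : MeasurableSet A' := hA.inter (measurableSet_Ico.prod measurableSet_Ico)
  have hA'f : volume A' ≠ ⊤ := by
    refine ne_top_of_le_ne_top ?_ (measure_mono (inter_subset_left.trans hAQ))
    rw [volume_Qsq]; simp
  obtain ⟨Kc, hKA, hKc, hKv⟩ := hA'm.exists_isCompact_sdiff_lt hA'f hκ'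
  have hKf : volume Kc ≠ ⊤ := hKc.measure_lt_top.ne
  obtain ⟨U, hKU, hU, hUv⟩ := hKc.exists_isOpen_lt_add (μ := volume) hκ'
  obtain ⟨δ, hδ, hth⟩ := hKc.exists_thickening_subset_open hU hKU
  obtain ⟨N, hN⟩ := exists_nat_gt (max (max N0 1) (1/δ))
  have hN1 : N0 ≤ N := ((le_max_left _ _).trans (le_max_left _ _)).trans hN.le
  have hN2 : (1:ℝ) < N := lt_of_le_of_lt ((le_max_right _ _).trans (le_max_left _ _)) hN
  have hN3 : 1/δ < N := lt_of_le_of_lt (le_max_right _ _) hN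
  have hNp : 0 < N := by
    have : (0:ℝ) < N := by linarith
    exact_mod_cast this
  have hNδ : 1/(N:ℝ) < δ := by
    rw [div_lt_iff₀ (by linarith)]; rw [div_lt_iff₀ hδ] at hN3; linarith
  refine ⟨N, hNp, hN1, (Finset.range N ×ˢ Finset.range N).filter (fun p => (cell N p ∩ Kc).Nonempty),
    Finset.filter_subset _ _, ?_, ?_⟩
  · set F := (Finset.range N ×ˢ Finset.range N).filter (fun p => (cell N p ∩ Kc).Nonempty)
    have hK : Kc ⊆ cells N F := by
      intro z hz
      have hz' := (hKA hz).2
      simp only [mem_prod, mem_Ico] at hz'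
      have hzc := mem_cell_floor hNp hz'.1.1 hz'.2.1
      simp only [cells, mem_iUnion]
      refine ⟨_, ?_, hzc⟩
      simp only [F, Finset.mem_filter, Finset.mem_product, Finset.mem_range]
      refine ⟨⟨?_, ?_⟩, ⟨z, hzc, hz⟩⟩
      · rw [Nat.floor_lt (mul_nonneg hz'.1.1 (by linarith))]; nlinarith
      · rw [Nat.floor_lt (mul_nonneg hz'.2.1 (by linarith))]; nlinarith
    have hs : A \ cells N F ⊆ (Qsq \ (Ico (0:ℝ) 1 ×ˢ Ico (0:ℝ) 1)) ∪ (A' \ Kc) := by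
      rintro z ⟨hz, hz2⟩
      by_cases h : z ∈ (Ico (0:ℝ) 1 ×ˢ Ico (0:ℝ) 1)
      · right; exact ⟨⟨hz, h⟩, fun h' => hz2 (hK h')⟩
      · left; exact ⟨hAQ hz, h⟩
    refine (measure_mono hs).trans ((measure_union_le _ _).trans ?_)
    rw [volume_edge, zero_add]; exact hKv.le
  · set F := (Finset.range N ×ˢ Finset.range N).filter (fun p => (cell N p ∩ Kc).Nonempty)
    have hs : cells N F \ A ⊆ U \ Kc := by
      rintro z ⟨hz, hz2⟩
      refine ⟨hth ?_, fun h => hz2 (hKA h).1⟩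
      simp only [cells, mem_iUnion] at hz
      obtain ⟨p, hp, hzp⟩ := hz
      simp only [F, Finset.mem_filter] at hp
      obtain ⟨_, w, hw, hwK⟩ := hp
      rw [Metric.mem_thickening_iff]
      exact ⟨w, hwK, (cell_dist hzp hw).trans hNδ⟩
    refine (measure_mono hs).trans ?_
    rw [measure_sdiff hKU hKc.measurableSet.nullMeasurableSet hKf]
    rw [tsub_le_iff_left]; exact hUv.le

lemma step_core {γ γ' : ℝ} (hγ : 0 < γ) (hγ1 : γ ≤ 1) (hγ' : 0 < γ') (hγ1' : γ' ≤ 1) {v0 K t κ : ℝ}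
    (hv0 : v0 = γ * γ' / 4) (hK : K = 100 / v0) (ht : t = 1/(4*K^3)) (hκ : κ = t * v0 / 40)
    {A : Set (ℝ × ℝ)} (hA : MeasurableSet A) (hAQ : A ⊆ Qsq) (h1 : γ ≤ volume.real A)
    (h2 : volume.real A ≤ 1 - γ') {N : ℕ} (hN : 0 < N) (hNK : K^2 ≤ N)
    {F : Finset (ℕ × ℕ)} (hF : F ⊆ Finset.range N ×ˢ Finset.range N)
    (hd1 : volume (A \ cells N F) ≤ ENNReal.ofReal κ) (hd2 : volume (cells N F \ A) ≤ ENNReal.ofReal κ)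
    {u : ℕ → ℕ → ℝ} (h : Adm N (fun i k => (if (i,k) ∈ F then 1 else 0) - (F.card : ℝ) / (N:ℝ)^2) u) :
    ∃ φ, Nice 2 φ ∧ volume.real A + t * v0 / 8 ≤ volume.real (φ '' A) := by
  have hv0p : 0 < v0 := by rw [hv0]; positivity
  have hKp : 0 < K := by rw [hK]; positivity
  have htp : 0 < t := by rw [ht]; positivity
  have hκp : 0 < κ := by rw [hκ]; positivity
  have hgg1 : γ * γ' ≤ γ := mul_le_of_le_one_right hγ.le hγ1'
  have hgg2 : γ * γ' ≤ γ' := mul_le_of_le_one_left hγ'.le hγ1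
  have hK1 : 1 ≤ K := by
    rw [hK, le_div_iff₀ hv0p]; linarith
  have ht1 : t ≤ 1 := by
    rw [ht, div_le_one (by positivity)]
    have : 1 ≤ K^3 := one_le_pow₀ hK1
    linarith
  have hκ1 : κ ≤ v0 / 40 := by rw [hκ]; gcongr; exact mul_le_of_le_one_left hv0p.le ht1
  have fin : ∀ E : Set (ℝ × ℝ), E ⊆ Qsq → volume E ≠ ⊤ := fun E hE =>
    ne_top_of_le_ne_top (by rw [volume_Qsq]; simp) (measure_mono hE)
  have hCQ := cells_sub hN F hF
  have toR : ∀ E : Set (ℝ × ℝ), volume E ≤ ENNReal.ofReal κ → volume.real E ≤ κ := fun E hE =>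
    ENNReal.toReal_le_of_le_ofReal hκp.le hE
  set m : ℝ := (F.card : ℝ) / (N:ℝ)^2 with hm
  have hm0 : 0 ≤ m := by positivity
  have hcv : volume.real (cells N F) = m := by
    rw [measureReal_def, cells_vol hN, ENNReal.toReal_ofReal hm0]
  have le_add : ∀ E E' : Set (ℝ × ℝ), E' ⊆ Qsq → E ⊆ Qsq → volume.real E ≤ volume.real E' + volume.real (E \ E') := by
    intro E E' hE' hE
    have h1 : volume.real E ≤ volume.real (E' ∪ (E \ E')) := by
      refine measureReal_mono (fun z hz => by by_cases h : z ∈ E' <;> simp [h, hz]) ?_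
      exact fin _ (union_subset hE' (sdiff_subset.trans hE))
    exact h1.trans (measureReal_union_le _ _)
  have hm1 : m ≤ volume.real A + κ := by
    rw [← hcv]
    exact (le_add _ _ hAQ hCQ).trans (by linarith [toR _ hd2])
  have hm2 : volume.real A ≤ m + κ := by
    rw [← hcv]
    exact (le_add _ _ hCQ hAQ).trans (by linarith [toR _ hd1])
  have hv : v0 ≤ m * (1 - m) := by
    have a1 : γ / 2 ≤ m := by linarith
    have a2 : γ' / 2 ≤ 1 - m := by linarith
    calc v0 = γ / 2 * (γ' / 2) := by rw [hv0]; ring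
      _ ≤ _ := by gcongr
  obtain ⟨φ, hφ, hvol⟩ := shear_gain hN F hF hm h hv0p hv hK hNK
  refine ⟨φ, hφ, ?_⟩
  have hmt := hφ.1.mapsTo
  have imQ : ∀ E : Set (ℝ × ℝ), E ⊆ Qsq → φ '' E ⊆ Qsq := fun E hE => (hmt.mono_left hE).image_subset
  have g1 : m + t * (v0/4) ≤ volume.real (φ '' cells N F) := by
    rw [← ht] at hvol
    exact (ENNReal.ofReal_le_iff_le_toReal (fin _ (imQ _ hCQ))).mp hvol
  have g2 : volume.real (φ '' (cells N F \ A)) ≤ 4 * κ := by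
    have := (nice_vol hφ (sdiff_subset.trans hCQ : cells N F \ A ⊆ Qsq)).trans (mul_le_mul_right hd2 4)
    apply ENNReal.toReal_le_of_le_ofReal (by positivity)
    rw [ENNReal.ofReal_mul (by norm_num)]
    simpa using this
  have g3 : volume.real (φ '' cells N F) ≤ volume.real (φ '' A) + volume.real (φ '' (cells N F \ A)) := by
    refine le_trans ?_ (measureReal_union_le _ _)
    refine measureReal_mono ?_ ?_
    · rw [← image_union]
      apply image_mono
      intro z hz
      by_cases h : z ∈ A <;> simp [h, hz]
    · exact fin _ (union_subset (imQ _ hAQ) (imQ _ (sdiff_subset.trans hCQ)))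
  have : κ * 40 = t * v0 := by rw [hκ]; ring
  linarith

lemma swap_Qsq {p : ℝ × ℝ} : p.swap ∈ Qsq ↔ p ∈ Qsq := by
  simp only [Qsq, mem_prod, Prod.fst_swap, Prod.snd_swap]; tauto

lemma swap_QB {p : ℝ × ℝ} : p.swap ∈ QB ↔ p ∈ QB := by
  simp only [QB, mem_ofPred_eq, swap_Qsq, Prod.fst_swap, Prod.snd_swap]; tauto

lemma pswap_dist (p q : ℝ × ℝ) : dist p.swap q.swap = dist p q := by
  simp only [Prod.dist_eq, Prod.fst_swap, Prod.snd_swap, max_comm]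

lemma swap_vol (E : Set (ℝ × ℝ)) : volume (Prod.swap ⁻¹' E) = volume E := by
  have h : MeasurePreserving (MeasurableEquiv.prodComm : ℝ × ℝ ≃ᵐ ℝ × ℝ) volume volume :=
    Measure.measurePreserving_swap
  exact h.measure_preimage_equiv E

lemma nice_swap {C : ℝ} {φ : ℝ × ℝ → ℝ × ℝ} (h : Nice C φ) :
    Nice C (fun p => (φ p.swap).swap) := by
  obtain ⟨⟨h1, h2, h3⟩, h4, h5⟩ := h
  refine ⟨⟨?_, ?_, ?_⟩, ?_, ?_⟩
  · intro p hp
    exact swap_Qsq.mpr (h1 (swap_Qsq.mpr hp))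
  · intro p hp q hq hpq
    have := h2 (swap_Qsq.mpr hp) (swap_Qsq.mpr hq) (Prod.swap_injective hpq)
    exact Prod.swap_injective this
  · intro p hp
    obtain ⟨q, hq, hqp⟩ := h3 (swap_Qsq.mpr hp)
    exact ⟨q.swap, swap_Qsq.mpr hq, by simp [hqp]⟩
  · intro p hp q hq
    have := h4 _ (swap_Qsq.mpr hp) _ (swap_Qsq.mpr hq)
    simpa only [pswap_dist] using this
  · intro p hp
    simp [h5 _ (swap_QB.mpr hp)]

lemma step {γ γ' : ℝ} (hγ : 0 < γ) (hγ1 : γ ≤ 1) (hγ' : 0 < γ') (hγ1' : γ' ≤ 1) :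
    ∃ δ : ℝ, 0 < δ ∧ ∀ A : Set (ℝ × ℝ), MeasurableSet A → A ⊆ Qsq → γ ≤ volume.real A →
      volume.real A ≤ 1 - γ' → ∃ φ, Nice 2 φ ∧ volume.real A + δ ≤ volume.real (φ '' A) := by
  obtain ⟨v0, hv0⟩ : ∃ v0, v0 = γ * γ' / 4 := ⟨_, rfl⟩
  obtain ⟨K, hK⟩ : ∃ K, K = 100 / v0 := ⟨_, rfl⟩
  obtain ⟨t, ht⟩ : ∃ t, t = 1/(4*K^3) := ⟨_, rfl⟩
  obtain ⟨κ, hκ⟩ : ∃ κ, κ = t * v0 / 40 := ⟨_, rfl⟩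
  have hv0p : 0 < v0 := by rw [hv0]; positivity
  have hKp : 0 < K := by rw [hK]; positivity
  have htp : 0 < t := by rw [ht]; positivity
  have hκp : 0 < κ := by rw [hκ]; positivity
  refine ⟨t * v0 / 8, by positivity, ?_⟩
  intro A hA hAQ h1 h2
  obtain ⟨N, hN, hNK, F, hF, hd1, hd2⟩ := approx hA hAQ hκp (K^2)
  have hN' : (0:ℝ) < N := by exact_mod_cast hN
  have hsum : ∑ i ∈ Finset.range N, ∑ k ∈ Finset.range N,
      ((if (i,k) ∈ F then (1:ℝ) else 0) - (F.card : ℝ) / (N:ℝ)^2) = 0 := by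
    rw [← Finset.sum_product' (f := fun i k => ((if (i,k) ∈ F then (1:ℝ) else 0) - (F.card : ℝ) / (N:ℝ)^2))]
    rw [Finset.sum_sub_distrib, ← Finset.sum_filter]
    have : (Finset.range N ×ˢ Finset.range N).filter (fun x : ℕ × ℕ => (x.1, x.2) ∈ F) = F := by
      ext p; simp only [Finset.mem_filter]; exact ⟨fun h => h.2, fun h => ⟨hF h, h⟩⟩
    rw [this]
    simp only [Finset.sum_const, nsmul_eq_mul, Finset.card_product, Finset.card_range]
    push_cast
    field_simp
    ring
  rcases exists_adm N _ hsum with ⟨u, hu⟩ | ⟨u, hu⟩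
  · exact step_core hγ hγ1 hγ' hγ1' hv0 hK ht hκ hA hAQ h1 h2 hN hNK hF hd1 hd2 hu
  · set F' := F.image Prod.swap with hF'
    have memF' : ∀ p, p ∈ F' ↔ p.swap ∈ F := by
      intro p; rw [hF', Finset.mem_image]
      exact ⟨fun ⟨q, hq, h⟩ => by rw [← h]; simpa using hq, fun h => ⟨_, h, by simp⟩⟩
    have hcard : F'.card = F.card := Finset.card_image_of_injective _ Prod.swap_injective
    have hcells : cells N F' = Prod.swap ⁻¹' cells N F := by
      ext z
      simp only [cells, mem_iUnion, mem_preimage, memF']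
      constructor
      · rintro ⟨p, hp, hz⟩
        exact ⟨p.swap, hp, ⟨hz.2, hz.1⟩⟩
      · rintro ⟨p, hp, hz⟩
        exact ⟨p.swap, by simpa using hp, ⟨hz.2, hz.1⟩⟩
    have hF'N : F' ⊆ Finset.range N ×ˢ Finset.range N := by
      intro p hp
      have := hF ((memF' p).mp hp)
      simp only [Finset.mem_product, Prod.fst_swap, Prod.snd_swap] at this ⊢
      exact ⟨this.2, this.1⟩
    have hvA : volume.real (Prod.swap ⁻¹' A) = volume.real A := by
      rw [measureReal_def, swap_vol, measureReal_def]
    have hu' : Adm N (fun i k => (if (i,k) ∈ F' then 1 else 0) - (F'.card : ℝ) / (N:ℝ)^2) u := by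
      have e : (fun i k : ℕ => (if (i,k) ∈ F' then (1:ℝ) else 0) - (F'.card : ℝ) / (N:ℝ)^2) =
          (fun i k : ℕ => (if (k,i) ∈ F then (1:ℝ) else 0) - (F.card : ℝ) / (N:ℝ)^2) := by
        ext i k
        rw [hcard]
        congr 1
        simp only [memF', Prod.swap_prod_mk]
      rw [e]; exact hu
    obtain ⟨φ, hφ, hv⟩ := step_core hγ hγ1 hγ' hγ1' hv0 hK ht hκ (A := Prod.swap ⁻¹' A)
      (measurable_swap hA) (fun z hz => swap_Qsq.mp (hAQ hz)) (by rw [hvA]; exact h1)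
      (by rw [hvA]; exact h2) hN hNK hF'N
      (by rw [hcells, ← preimage_sdiff, swap_vol]; exact hd1)
      (by rw [hcells, ← preimage_sdiff, swap_vol]; exact hd2) hu'
    refine ⟨_, nice_swap hφ, ?_⟩
    rw [hvA] at hv
    have : φ '' (Prod.swap ⁻¹' A) = Prod.swap ⁻¹' ((fun p => (φ p.swap).swap) '' A) := by
      ext z
      constructor
      · rintro ⟨w, hw, rfl⟩
        exact ⟨w.swap, hw, by simp⟩
      · rintro ⟨w, hw, h⟩
        exact ⟨w.swap, by simpa using hw, Prod.swap_injective h⟩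
    rw [this, measureReal_def, measureReal_def, swap_vol] at hv
    exact hv

lemma nice_comp {C D : ℝ} (hC : 0 ≤ C) (hD : 0 ≤ D) {φ ψ : ℝ × ℝ → ℝ × ℝ} (h : Nice C φ) (h' : Nice D ψ) :
    Nice (C * D) (ψ ∘ φ) := by
  refine ⟨h'.1.comp h.1, ?_, ?_⟩
  · intro p hp q hq
    have a := h.2.1 p hp q hq
    have b := h'.2.1 _ (h.1.mapsTo hp) _ (h.1.mapsTo hq)
    constructor
    · rw [mul_assoc]; exact a.1.trans (by gcongr; exact b.1)
    · rw [mul_comm C D, mul_assoc]; exact b.2.trans (by gcongr; exact a.2)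
  · intro p hp
    simp [h.2.2 p hp, h'.2.2 p hp]

lemma nice_mono {C D : ℝ} (h : C ≤ D) {φ : ℝ × ℝ → ℝ × ℝ} (hφ : Nice C φ) : Nice D φ := by
  refine ⟨hφ.1, ?_, hφ.2.2⟩
  intro p hp q hq
  have a := hφ.2.1 p hp q hq
  exact ⟨a.1.trans (by gcongr), a.2.trans (by gcongr)⟩

lemma nice_meas {C : ℝ} (hC : 0 ≤ C) {φ : ℝ × ℝ → ℝ × ℝ} (hφ : Nice C φ) {A : Set (ℝ × ℝ)}
    (hA : MeasurableSet A) (hAQ : A ⊆ Qsq) : MeasurableSet (φ '' A) := by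
  have hL : LipschitzOnWith ⟨C, hC⟩ φ A := by
    apply LipschitzOnWith.of_dist_le_mul
    intro p hp q hq
    exact (hφ.2.1 p (hAQ hp) q (hAQ hq)).2
  exact hA.image_of_continuousOn_injOn hL.continuousOn (hφ.1.injOn.mono hAQ)

lemma plane {γ γ' : ℝ} (hγ : 0 < γ) (hγ1 : γ ≤ 1) (hγ' : 0 < γ') (hγ1' : γ' ≤ 1) :
    ∃ C : ℝ, 0 < C ∧ ∀ A : Set (ℝ × ℝ), MeasurableSet A → A ⊆ Qsq → γ ≤ volume.real A →
      ∃ φ, Nice C φ ∧ 1 - γ' ≤ volume.real (φ '' A) := by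
  obtain ⟨δ, hδ, hstep⟩ := step hγ hγ1 hγ' hγ1'
  obtain ⟨n, hn⟩ := exists_nat_gt (1/δ)
  refine ⟨2^n, by positivity, ?_⟩
  intro A hA hAQ hA1
  have key : ∀ n : ℕ, ∃ φ, Nice (2^n) φ ∧
      (1 - γ' ≤ volume.real (φ '' A) ∨ γ + n * δ ≤ volume.real (φ '' A)) := by
    intro n
    induction n with
    | zero =>
      refine ⟨id, ⟨bijOn_id _, ?_, ?_⟩, Or.inr ?_⟩
      · intro p _ q _; simp
      · intro p _; rfl
      · simpa using hA1
    | succ n ih =>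
      obtain ⟨φ, hφ, hv⟩ := ih
      by_cases hc : 1 - γ' ≤ volume.real (φ '' A)
      · exact ⟨φ, nice_mono (by gcongr <;> norm_num) hφ, Or.inl hc⟩
      · have hv' := hv.resolve_left hc
        have hnn : 0 ≤ (n:ℝ) * δ := by positivity
        obtain ⟨ψ, hψ, hw⟩ := hstep (φ '' A) (nice_meas (by positivity) hφ hA hAQ)
          ((hφ.1.mapsTo.mono_left hAQ).image_subset) (by linarith) (by linarith)
        refine ⟨ψ ∘ φ, by rw [pow_succ]; exact nice_comp (by positivity) (by norm_num) hφ hψ, Or.inr ?_⟩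
        rw [image_comp]
        push_cast
        linarith
  obtain ⟨φ, hφ, hv⟩ := key n
  refine ⟨φ, hφ, ?_⟩
  rw [div_lt_iff₀ hδ] at hn
  rcases hv with h | h <;> linarith

/-- coordinates -/
def toP : EuclideanSpace ℝ (Fin 2) ≃ᵐ ℝ × ℝ :=
  (MeasurableEquiv.toLp 2 (Fin 2 → ℝ)).symm.trans MeasurableEquiv.finTwoArrow

lemma toP_mp : MeasurePreserving toP volume volume :=
  (EuclideanSpace.volume_preserving_symm_measurableEquiv_toLp (Fin 2)).trans
    (volume_preserving_finTwoArrow ℝ)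

lemma toP_apply (x : EuclideanSpace ℝ (Fin 2)) : toP x = (x 0, x 1) := rfl

lemma toP_sq (x : EuclideanSpace ℝ (Fin 2)) : toP x ∈ Qsq ↔ x ∈ unitSq := by
  rw [toP_apply]
  show (x 0, x 1) ∈ Icc (0:ℝ) 1 ×ˢ Icc (0:ℝ) 1 ↔ ∀ i, x i ∈ Set.Icc (0:ℝ) 1
  rw [Fin.forall_fin_two, mem_prod]

lemma toP_bdry {x : EuclideanSpace ℝ (Fin 2)} (h : x ∈ unitSqBdry) : toP x ∈ QB := by
  obtain ⟨h1, h2⟩ := h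
  refine ⟨(toP_sq x).mpr h1, ?_⟩
  rw [Fin.exists_fin_two] at h2
  rw [toP_apply]
  tauto

lemma toP_dist (x y : EuclideanSpace ℝ (Fin 2)) :
    dist (toP x) (toP y) ≤ ‖x - y‖ ∧ ‖x - y‖ ≤ 2 * dist (toP x) (toP y) := by
  rw [toP_apply, toP_apply, Prod.dist_eq, Real.dist_eq, Real.dist_eq, EuclideanSpace.norm_eq,
    Fin.sum_univ_two]
  simp only [PiLp.sub_apply, Real.norm_eq_abs]
  have ha := abs_nonneg (x 0 - y 0)
  have hb := abs_nonneg (x 1 - y 1)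
  generalize |x 0 - y 0| = a at *
  generalize |x 1 - y 1| = b at *
  constructor
  · apply max_le <;> apply Real.le_sqrt_of_sq_le <;> nlinarith
  · apply Real.sqrt_le_iff.mpr
    have h1 := le_max_left a b
    have h2 := le_max_right a b
    constructor
    · linarith
    · nlinarith

theorem stmt_0 (γ γ' : ℝ) (hγ : γ ∈ Set.Ioo (0:ℝ) 1) (hγ' : γ' ∈ Set.Ioo (0:ℝ) 1)
    (hsum : γ + γ' < 1) :
    ∃ C₀ : ℝ, 0 < C₀ ∧
      ∀ A : Set (EuclideanSpace ℝ (Fin 2)), A ⊆ unitSq → MeasurableSet A →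
        volume A = ENNReal.ofReal γ →
        ∃ φ₀ : EuclideanSpace ℝ (Fin 2) → EuclideanSpace ℝ (Fin 2),
          Set.BijOn φ₀ unitSq unitSq ∧
          (∀ x ∈ unitSq, ∀ y ∈ unitSq,
            (1 / C₀) * ‖x - y‖ ≤ ‖φ₀ x - φ₀ y‖ ∧ ‖φ₀ x - φ₀ y‖ ≤ C₀ * ‖x - y‖) ∧
          (∀ x ∈ unitSqBdry, φ₀ x = x) ∧
          ENNReal.ofReal (1 - γ') ≤ volume (φ₀ '' A) := by
  obtain ⟨C, hC, hplane⟩ := plane hγ.1 hγ.2.le hγ'.1 hγ'.2.le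
  refine ⟨2 * C, by positivity, ?_⟩
  intro A hAQ hA hvA
  have hvol : volume (toP.symm ⁻¹' A) = volume A := toP_mp.symm.measure_preimage_equiv A
  obtain ⟨φ, ⟨hbij, hlip, hfix⟩, hv⟩ := hplane (toP.symm ⁻¹' A) (toP.symm.measurable hA)
    (fun z hz => by
      have := (toP_sq (toP.symm z)).mpr (hAQ hz)
      simpa using this)
    (by rw [measureReal_def, hvol, hvA, ENNReal.toReal_ofReal hγ.1.le])
  refine ⟨fun x => toP.symm (φ (toP x)), ⟨?_, ?_, ?_⟩, ?_, ?_, ?_⟩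
  · intro x hx
    rw [← toP_sq]
    simpa using hbij.mapsTo ((toP_sq x).mpr hx)
  · intro x hx y hy hxy
    exact toP.injective (hbij.injOn ((toP_sq x).mpr hx) ((toP_sq y).mpr hy) (toP.symm.injective hxy))
  · intro y hy
    obtain ⟨z, hz, hzy⟩ := hbij.surjOn ((toP_sq y).mpr hy)
    refine ⟨toP.symm z, ?_, ?_⟩
    · rw [← toP_sq]; simpa using hz
    · simp [hzy]
  · intro x hx y hy
    obtain ⟨l1, l2⟩ := hlip _ ((toP_sq x).mpr hx) _ ((toP_sq y).mpr hy)
    have a := toP_dist x y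
    have b := toP_dist (toP.symm (φ (toP x))) (toP.symm (φ (toP y)))
    simp only [MeasurableEquiv.apply_symm_apply] at b
    have c1 := mul_le_mul_of_nonneg_left b.1 hC.le
    have c2 := mul_le_mul_of_nonneg_left a.1 hC.le
    constructor
    · rw [one_div, inv_mul_le_iff₀ (by positivity)]; linarith
    · linarith
  · intro x hx
    simp [hfix _ (toP_bdry hx)]
  · have e : (fun x => toP.symm (φ (toP x))) '' A = toP ⁻¹' (φ '' (toP.symm ⁻¹' A)) := by
      ext z
      constructor
      · rintro ⟨w, hw, rfl⟩
        exact ⟨toP w, by simpa using hw, by simp⟩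
      · rintro ⟨w, hw, h⟩
        exact ⟨toP.symm w, hw, by simp [h]⟩
    rw [e, toP_mp.measure_preimage_equiv]
    exact ENNReal.ofReal_le_of_le_toReal hv
end
end

section
/- Fix 0 < γ < 1 − γ' < 1 and η > 0. Then there exists ε = ε(γ, γ', η) > 0 such that for every Borel set A ⊆ [0,1]² with λ(A) ∈ [γ, 1 − γ'] there exists a bijection φ : [0,1]² → [0,1]² satisfying: (1) φ is (1+η)-bi-Lipschitz, i.e. (1+η)^{-1}·|x − y| ≤ |φ(x) − φ(y)| ≤ (1+η)·|x − y| for all x, y ∈ [0,1]²; (2) φ(x) = x for all x ∈ ∂[0,1]²; (3) λ(φ(A)) ≥ λ(A) + ε. -/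
open MeasureTheory Set

noncomputable section

abbrev E2 := EuclideanSpace ℝ (Fin 2)

lemma isClosed_unitSq : IsClosed unitSq := by
  have : unitSq = ⋂ i : Fin 2, (fun x : E2 => x i) ⁻¹' Set.Icc (0:ℝ) 1 := by
    ext x; simp [unitSq]
  rw [this]
  exact isClosed_iInter fun i => isClosed_Icc.preimage (by fun_prop)

lemma convex_unitSq : Convex ℝ unitSq := by
  intro x hx y hy a b ha hb hab i
  have := (convex_Icc (0:ℝ) 1) (hx i) (hy i) ha hb hab
  simpa using this

/-- Existence of an exit time. -/
lemma exists_exit (u : E2 → ℝ) (hu0 : ∀ x ∈ unitSqBdry, u x = 0) (p z : E2) (hp : p ∈ unitSq) :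
    ∃ b ∈ Set.Icc (0:ℝ) 1, (∀ t ∈ Set.Icc 0 b, p + t • (z - p) ∈ unitSq) ∧
      u (p + b • (z - p)) = unitSq.indicator u z := by
  by_cases hz : z ∈ unitSq
  · refine ⟨1, by simp, fun t ht => ?_, ?_⟩
    · have := convex_unitSq.add_smul_sub_mem hp hz ht
      exact this
    · simp [hz]
  · have hγ : Continuous (fun t : ℝ => p + t • (z - p)) := by fun_prop
    let T : Set ℝ := Set.Icc 0 1 ∩ (fun t : ℝ => p + t • (z - p)) ⁻¹' unitSq
    have hT : IsCompact T := isCompact_Icc.inter_right (isClosed_unitSq.preimage hγ)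
    have h0T : (0:ℝ) ∈ T := ⟨by simp, by simpa using hp⟩
    obtain ⟨b, hbT, hb⟩ := hT.exists_isGreatest ⟨0, h0T⟩
    refine ⟨b, hbT.1, fun t ht => ?_, ?_⟩
    · have hseg := convex_unitSq.add_smul_sub_mem hp hbT.2 (t := t / b) ?_
      · rcases eq_or_lt_of_le hbT.1.1 with h | h
        · have : t = 0 := le_antisymm (h ▸ ht.2) ht.1
          subst this; simpa using hp
        · have e : p + (t / b) • (p + b • (z - p) - p) = p + t • (z - p) := by
            rw [add_sub_cancel_left, smul_smul, div_mul_cancel₀ _ h.ne']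
          rwa [e] at hseg
      · exact ⟨div_nonneg ht.1 hbT.1.1, div_le_one_of_le₀ ht.2 hbT.1.1⟩
    · rw [Set.indicator_of_notMem hz]
      apply hu0
      refine ⟨hbT.2, ?_⟩
      by_contra hcon
      push Not at hcon
      have hb1 : b < 1 := by
        refine lt_of_le_of_ne hbT.1.2 ?_
        rintro rfl
        apply hz
        simpa using hbT.2
      have hopen : IsOpen {t : ℝ | ∀ i, (p + t • (z - p)) i ∈ Set.Ioo (0:ℝ) 1} := by
        have : {t : ℝ | ∀ i, (p + t • (z - p)) i ∈ Set.Ioo (0:ℝ) 1} =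
          ⋂ i : Fin 2, (fun t : ℝ => (p + t • (z - p)) i) ⁻¹' Set.Ioo (0:ℝ) 1 := by
          ext x; simp
        rw [this]
        exact isOpen_iInter_of_finite fun i => isOpen_Ioo.preimage (by fun_prop)
      have hbmem : b ∈ {t : ℝ | ∀ i, (p + t • (z - p)) i ∈ Set.Ioo (0:ℝ) 1} := fun i =>
        ⟨lt_of_le_of_ne (hbT.2 i).1 (Ne.symm (hcon i).1), lt_of_le_of_ne (hbT.2 i).2 (hcon i).2⟩
      obtain ⟨δ, hδ, hball⟩ := Metric.isOpen_iff.1 hopen b hbmem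
      let t := b + min (δ / 2) (1 - b)
      have hm : 0 < min (δ / 2) (1 - b) := lt_min (by linarith) (by linarith)
      have ht : t ∈ Metric.ball b δ := by
        simp only [Metric.mem_ball, Real.dist_eq, t, add_sub_cancel_left]
        rw [abs_of_pos hm]
        exact lt_of_le_of_lt (min_le_left _ _) (by linarith)
      have h2 : t ∈ T := ⟨⟨by have := hbT.1.1; simp only [t]; linarith,
        by have := min_le_right (δ / 2) (1 - b); simp only [t]; linarith⟩,
        fun i => Set.Ioo_subset_Icc_self (hball ht i)⟩
      have := hb h2
      simp only [t] at this
      linarith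

/-- The upper gradient. -/
def ug (u : E2 → ℝ) (x : E2) : ENNReal := unitSq.indicator (fun x => ‖fderiv ℝ u x‖ₑ) x

lemma measurable_ug (u : E2 → ℝ) (hu : ContDiff ℝ 1 u) : Measurable (ug u) := by
  apply Measurable.indicator _ isClosed_unitSq.measurableSet
  exact (hu.continuous_fderiv one_ne_zero).measurable.enorm

lemma segment_ineq (u : E2 → ℝ) (hu : ContDiff ℝ 1 u) (hu0 : ∀ x ∈ unitSqBdry, u x = 0)
    (p z : E2) (hp : p ∈ unitSq) :
    ‖unitSq.indicator u z - u p‖ₑ ≤ ‖z - p‖ₑ * ∫⁻ t in Set.Ioc (0:ℝ) 1, ug u (p + t • (z - p)) := by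
  obtain ⟨b, hb, hbS, hbz⟩ := exists_exit u hu0 p z hp
  rw [← hbz]
  have hd : ∀ t : ℝ, HasDerivAt (fun t : ℝ => u (p + t • (z - p)))
      (fderiv ℝ u (p + t • (z - p)) (z - p)) t := by
    intro t
    have h1 : HasDerivAt (fun t : ℝ => p + t • (z - p)) (z - p) t := by
      simpa using ((hasDerivAt_id t).smul_const (z - p)).const_add p
    exact ((hu.differentiable one_ne_zero) _).hasFDerivAt.comp_hasDerivAt t h1
  have hc : Continuous (fun t : ℝ => fderiv ℝ u (p + t • (z - p)) (z - p)) := by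
    have := hu.continuous_fderiv one_ne_zero
    fun_prop
  have hftc := intervalIntegral.integral_eq_sub_of_hasDerivAt (a := 0) (b := b)
    (fun t _ => hd t) (hc.intervalIntegrable _ _)
  have e1 : u (p + b • (z - p)) - u p = ∫ t in (0:ℝ)..b, fderiv ℝ u (p + t • (z - p)) (z - p) := by
    rw [hftc]; simp
  rw [e1, intervalIntegral.integral_of_le hb.1]
  calc _ ≤ ∫⁻ t in Set.Ioc 0 b, ‖fderiv ℝ u (p + t • (z - p)) (z - p)‖ₑ :=
        enorm_integral_le_lintegral_enorm _
    _ ≤ ∫⁻ t in Set.Ioc 0 b, ‖z - p‖ₑ * ug u (p + t • (z - p)) := by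
        apply setLIntegral_mono' measurableSet_Ioc
        intro t ht
        have : p + t • (z - p) ∈ unitSq := hbS t ⟨ht.1.le, ht.2⟩
        rw [ug, Set.indicator_of_mem this, mul_comm]
        exact ContinuousLinearMap.le_opENorm _ _
    _ ≤ ∫⁻ t in Set.Ioc 0 1, ‖z - p‖ₑ * ug u (p + t • (z - p)) :=
        lintegral_mono_set (Set.Ioc_subset_Ioc_right hb.2)
    _ = _ := by
        rw [lintegral_const_mul]
        exact (measurable_ug u hu).comp (by fun_prop)


lemma avg_scaled (g : E2 → ENNReal) (L : ℝ) (p : E2)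
    (hp : ∀ ρ > 0, ∫⁻ z in Metric.closedBall p ρ, g z ≤ ENNReal.ofReal (L * ρ ^ 2))
    (r : ℝ) (hr : 0 < r) (t : ℝ) (ht : 0 < t) :
    ∫⁻ z in Metric.closedBall p r, g (p + t • (z - p)) ≤ ENNReal.ofReal (L * r ^ 2) := by
  let f : E2 → E2 := fun z => p + t • (z - p)
  have hf' : ∀ x ∈ Metric.closedBall p r,
      HasFDerivWithinAt f (t • ContinuousLinearMap.id ℝ E2) (Metric.closedBall p r) x := by
    intro x _
    have : HasFDerivAt f (t • ContinuousLinearMap.id ℝ E2) x :=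
      (((hasFDerivAt_id x).sub_const p).const_smul t).const_add p
    exact this.hasFDerivWithinAt
  have hinj : Set.InjOn f (Metric.closedBall p r) := by
    intro x _ y _ hxy
    have h1 : t • (x - p) = t • (y - p) := add_left_cancel hxy
    have h2 := smul_right_injective E2 ht.ne' h1
    exact sub_left_injective h2
  have key := lintegral_image_eq_lintegral_abs_det_fderiv_mul volume
    Metric.isClosed_closedBall.measurableSet hf' hinj g
  have hdet : (t • ContinuousLinearMap.id ℝ E2).det = t ^ 2 := by
    rw [ContinuousLinearMap.det]
    simp
  rw [hdet, abs_of_pos (by positivity), lintegral_const_mul' _ _ ENNReal.ofReal_ne_top] at key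
  have hsub : f '' Metric.closedBall p r ⊆ Metric.closedBall p (t * r) := by
    rintro _ ⟨z, hz, rfl⟩
    simp only [f, Metric.mem_closedBall, dist_eq_norm, add_sub_cancel_left, norm_smul,
      Real.norm_eq_abs, abs_of_pos ht] at hz ⊢
    gcongr
  have h3 : ENNReal.ofReal (t ^ 2) * ∫⁻ z in Metric.closedBall p r, g (f z) ≤
      ENNReal.ofReal (t ^ 2) * ENNReal.ofReal (L * r ^ 2) := by
    rw [← key, ← ENNReal.ofReal_mul (by positivity)]
    refine (lintegral_mono_set hsub).trans ((hp (t * r) (by positivity)).trans ?_)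
    apply le_of_eq; congr 1; ring
  exact (ENNReal.mul_le_mul_iff_right (by simpa using by positivity) ENNReal.ofReal_ne_top).1 h3

lemma ball_avg (u : E2 → ℝ) (hu : ContDiff ℝ 1 u) (hu0 : ∀ x ∈ unitSqBdry, u x = 0)
    (L : ℝ) (p : E2) (hpS : p ∈ unitSq)
    (hp : ∀ ρ > 0, ∫⁻ z in Metric.closedBall p ρ, ug u z ≤ ENNReal.ofReal (L * ρ ^ 2))
    (r : ℝ) (hr : 0 < r) :
    ∫⁻ z in Metric.closedBall p r, ‖unitSq.indicator u z - u p‖ₑ ≤ ENNReal.ofReal (L * r ^ 3) := by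
  have hm := measurable_ug u hu
  calc _ ≤ ∫⁻ z in Metric.closedBall p r, ENNReal.ofReal r *
          ∫⁻ t in Set.Ioc (0:ℝ) 1, ug u (p + t • (z - p)) := by
        apply setLIntegral_mono' Metric.isClosed_closedBall.measurableSet
        intro z hz
        refine (segment_ineq u hu hu0 p z hpS).trans ?_
        gcongr
        rw [← ofReal_norm]
        apply ENNReal.ofReal_le_ofReal
        rwa [← dist_eq_norm]
    _ = ENNReal.ofReal r * ∫⁻ z in Metric.closedBall p r,
          ∫⁻ t in Set.Ioc (0:ℝ) 1, ug u (p + t • (z - p)) := by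
        rw [lintegral_const_mul' _ _ ENNReal.ofReal_ne_top]
    _ = ENNReal.ofReal r * ∫⁻ t in Set.Ioc (0:ℝ) 1, ∫⁻ z in Metric.closedBall p r,
          ug u (p + t • (z - p)) := by
        rw [lintegral_lintegral_swap]
        apply Measurable.aemeasurable
        apply hm.comp
        fun_prop
    _ ≤ ENNReal.ofReal r * ∫⁻ t in Set.Ioc (0:ℝ) 1, ENNReal.ofReal (L * r ^ 2) := by
        gcongr _ * ?_
        apply setLIntegral_mono' measurableSet_Ioc
        intro t ht
        exact avg_scaled (ug u) L p hp r hr t ht.1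
    _ = _ := by
        rw [setLIntegral_const, Real.volume_Ioc, sub_zero, ENNReal.ofReal_one, mul_one,
          ← ENNReal.ofReal_mul hr.le]
        congr 1; ring

def badSet (g : E2 → ENNReal) (Λ : ℝ) : Set E2 :=
  {p | ∃ r > 0, ENNReal.ofReal (Λ ^ 2 * r ^ 2) < ∫⁻ z in Metric.closedBall p r, g z ^ 2}

lemma volume_badSet (g : E2 → ENNReal) (hg : Measurable g) (Λ : ℝ) (hΛ : 0 < Λ) (C : ℝ) (hC : 0 ≤ C)
    (hD : ∫⁻ z, g z ^ 2 ≤ ENNReal.ofReal C) :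
    volume (badSet g Λ) ≤ ENNReal.ofReal (16 * Real.pi / Λ ^ 2 * C) := by
  have hch : ∀ p : E2, ∃ r : ℝ, p ∈ badSet g Λ →
    0 < r ∧ ENNReal.ofReal (Λ ^ 2 * r ^ 2) < ∫⁻ z in Metric.closedBall p r, g z ^ 2 := by
    intro p
    by_cases h : p ∈ badSet g Λ
    · obtain ⟨r, h1, h2⟩ := h
      exact ⟨r, fun _ => ⟨h1, h2⟩⟩
    · exact ⟨0, fun h' => absurd h' h⟩
  choose r hr using hch
  have hrR : ∀ p ∈ badSet g Λ, r p ≤ Real.sqrt C / Λ := by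
    intro p hp
    obtain ⟨h1, h2⟩ := hr p hp
    have h3 : ENNReal.ofReal (Λ ^ 2 * (r p) ^ 2) ≤ ENNReal.ofReal C :=
      h2.le.trans ((setLIntegral_le_lintegral _ _).trans hD)
    rw [ENNReal.ofReal_le_ofReal_iff hC] at h3
    rw [le_div_iff₀ hΛ]
    apply Real.le_sqrt_of_sq_le
    nlinarith
  obtain ⟨v, hvt, hdisj, hcov⟩ := Vitali.exists_disjoint_subfamily_covering_enlargement_closedBall
    (badSet g Λ) (fun p : E2 => p) r _ hrR 4 (by norm_num)
  have hcount : v.Countable := by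
    apply hdisj.countable_of_nonempty_interior
    intro p hp
    refine ⟨p, Metric.ball_subset_interior_closedBall ?_⟩
    exact Metric.mem_ball_self (hr p (hvt hp)).1
  have hsub : badSet g Λ ⊆ ⋃ p ∈ v, Metric.closedBall p (4 * r p) := by
    intro p hp
    obtain ⟨b, hb, hb2⟩ := hcov p hp
    exact Set.mem_biUnion hb (hb2 (Metric.mem_closedBall_self (hr p hp).1.le))
  calc volume (badSet g Λ) ≤ volume (⋃ p ∈ v, Metric.closedBall p (4 * r p)) := measure_mono hsub
    _ ≤ ∑' p : v, volume (Metric.closedBall (p:E2) (4 * r p)) := measure_biUnion_le _ hcount _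
    _ ≤ ∑' p : v, ENNReal.ofReal (16 * Real.pi / Λ ^ 2) *
          ∫⁻ z in Metric.closedBall (p:E2) (r p), g z ^ 2 := by
        apply ENNReal.tsum_le_tsum
        intro p
        obtain ⟨h1, h2⟩ := hr p (hvt p.2)
        refine le_trans (le_of_eq ?_) (mul_le_mul_right h2.le _)
        rw [EuclideanSpace.volume_closedBall_fin_two, ← ENNReal.ofReal_mul (by positivity),
          ← ENNReal.ofReal_pow (by positivity)]
        rw [← ENNReal.ofReal_mul (by positivity)]
        congr 1
        field_simp
        norm_num
    _ = ENNReal.ofReal (16 * Real.pi / Λ ^ 2) *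
          ∫⁻ z in ⋃ p ∈ v, Metric.closedBall (p:E2) (r p), g z ^ 2 := by
        rw [ENNReal.tsum_mul_left, lintegral_biUnion hcount]
        · exact fun p _ => Metric.isClosed_closedBall.measurableSet
        · exact hdisj
    _ ≤ ENNReal.ofReal (16 * Real.pi / Λ ^ 2) * ENNReal.ofReal C := by
        gcongr
        exact (setLIntegral_le_lintegral _ _).trans hD
    _ = _ := by rw [← ENNReal.ofReal_mul (by positivity)]

lemma vol_cball (p : E2) (r : ℝ) (hr : 0 ≤ r) :
    volume (Metric.closedBall p r) = ENNReal.ofReal (Real.pi * r ^ 2) := by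
  rw [EuclideanSpace.volume_closedBall_fin_two, ← ENNReal.ofReal_pow (by positivity)]
  rw [← ENNReal.ofReal_mul (by positivity), mul_comm]

lemma good_avg (g : E2 → ENNReal) (Λ : ℝ) (hΛ : 0 < Λ) (p : E2)
    (hp : p ∉ badSet g Λ) (ρ : ℝ) (hρ : 0 < ρ) :
    ∫⁻ z in Metric.closedBall p ρ, g z ≤ ENNReal.ofReal (5 * Λ * ρ ^ 2) := by
  have h1 : ∫⁻ z in Metric.closedBall p ρ, g z ^ 2 ≤ ENNReal.ofReal (Λ ^ 2 * ρ ^ 2) := by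
    by_contra h
    exact hp ⟨ρ, hρ, not_le.1 h⟩
  have h2 : ∀ a : ENNReal, a ≤ ENNReal.ofReal Λ⁻¹ * a ^ 2 + ENNReal.ofReal Λ := by
    intro a
    rcases eq_or_ne a ⊤ with rfl | ha
    · simp [ENNReal.mul_top, hΛ]
    · lift a to NNReal using ha
      have : (a : ENNReal) = ENNReal.ofReal a := by simp
      rw [this, ← ENNReal.ofReal_pow (by positivity), ← ENNReal.ofReal_mul (by positivity),
        ← ENNReal.ofReal_add (by positivity) (by positivity)]
      apply ENNReal.ofReal_le_ofReal
      have : Λ⁻¹ * (a:ℝ)^2 + Λ - a = Λ⁻¹ * ((a - Λ/2)^2 + 3/4 * Λ^2) := by field_simp; ring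
      have h3 : 0 ≤ Λ⁻¹ * (((a:ℝ) - Λ/2)^2 + 3/4 * Λ^2) := by positivity
      linarith
  calc _ ≤ ∫⁻ z in Metric.closedBall p ρ, (ENNReal.ofReal Λ⁻¹ * g z ^ 2 + ENNReal.ofReal Λ) :=
        lintegral_mono fun z => h2 _
    _ = ENNReal.ofReal Λ⁻¹ * (∫⁻ z in Metric.closedBall p ρ, g z ^ 2) +
          ENNReal.ofReal Λ * volume (Metric.closedBall p ρ) := by
        rw [lintegral_add_right _ measurable_const, lintegral_const_mul' _ _ ENNReal.ofReal_ne_top,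
          setLIntegral_const]
    _ ≤ ENNReal.ofReal Λ⁻¹ * ENNReal.ofReal (Λ ^ 2 * ρ ^ 2) +
          ENNReal.ofReal Λ * ENNReal.ofReal (Real.pi * ρ ^ 2) := by
        rw [vol_cball _ _ hρ.le]
        gcongr
    _ ≤ _ := by
        rw [← ENNReal.ofReal_mul (by positivity), ← ENNReal.ofReal_mul (by positivity),
          ← ENNReal.ofReal_add (by positivity) (by positivity)]
        apply ENNReal.ofReal_le_ofReal
        have : Λ⁻¹ * (Λ ^ 2 * ρ ^ 2) = Λ * ρ ^ 2 := by field_simp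
        rw [this]
        have h4 := Real.pi_le_four
        have h5 : 0 < Λ * ρ ^ 2 := by positivity
        nlinarith

/-- If `p` is good, and a ball of radius `d` inside `closedBall p (3 * d)` carries
constant value `c`, then `u p` is close to `c`. -/
lemma good_close (u : E2 → ℝ) (hu : ContDiff ℝ 1 u) (hu0 : ∀ x ∈ unitSqBdry, u x = 0)
    (Λ : ℝ) (hΛ : 0 < Λ) (p : E2) (hpS : p ∈ unitSq) (hp : p ∉ badSet (ug u) Λ)
    (q : E2) (d : ℝ) (hd : 0 < d) (hq : dist q p ≤ 2 * d) (hq0 : ∀ z ∈ Metric.ball q d, z ∉ unitSq) :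
    |u p| ≤ 135 * Λ * d := by
  have h1 := ball_avg u hu hu0 (5 * Λ) p hpS (good_avg _ Λ hΛ p hp) (3 * d) (by positivity)
  have hsub : Metric.ball q d ⊆ Metric.closedBall p (3 * d) := by
    intro z hz
    simp only [Metric.mem_ball, Metric.mem_closedBall] at hz ⊢
    have := dist_triangle z q p
    linarith
  have h2 : ENNReal.ofReal |u p| * ENNReal.ofReal (Real.pi * d ^ 2) ≤
      ENNReal.ofReal (5 * Λ * (3 * d) ^ 3) := by
    refine le_trans ?_ ((lintegral_mono_set hsub).trans h1)
    have : ∫⁻ z in Metric.ball q d, ‖unitSq.indicator u z - u p‖ₑ =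
        ∫⁻ z in Metric.ball q d, ENNReal.ofReal |u p| := by
      apply setLIntegral_congr_fun Metric.isOpen_ball.measurableSet
      intro z hz
      simp only [Set.indicator_of_notMem (hq0 z hz), zero_sub, enorm_neg]
      rw [← ofReal_norm, Real.norm_eq_abs]
    rw [this, setLIntegral_const, ← Measure.addHaar_closedBall_eq_addHaar_ball,
      vol_cball _ _ hd.le]
  rw [← ENNReal.ofReal_mul (by positivity), ENNReal.ofReal_le_ofReal_iff (by positivity)] at h2
  have h3 : |u p| * d ^ 2 ≤ |u p| * (Real.pi * d ^ 2) := by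
    have := Real.pi_gt_three
    have h4 : 0 ≤ |u p| * d ^ 2 := by positivity
    nlinarith
  have h5 : |u p| * d ^ 2 ≤ (135 * Λ * d) * d ^ 2 := by linarith
  exact le_of_mul_le_mul_right h5 (by positivity)

lemma good_good (u : E2 → ℝ) (hu : ContDiff ℝ 1 u) (hu0 : ∀ x ∈ unitSqBdry, u x = 0)
    (Λ : ℝ) (hΛ : 0 < Λ) (p : E2) (hpS : p ∈ unitSq) (hp : p ∉ badSet (ug u) Λ)
    (q : E2) (hqS : q ∈ unitSq) (hq : q ∉ badSet (ug u) Λ) :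
    |u p - u q| ≤ 135 * Λ * dist p q := by
  rcases eq_or_ne p q with rfl | hne
  · simp
  set d := dist p q with hd_def
  have hd : 0 < d := dist_pos.2 hne
  have h1 := ball_avg u hu hu0 (5 * Λ) p hpS (good_avg _ Λ hΛ p hp) d hd
  have h2 := ball_avg u hu hu0 (5 * Λ) q hqS (good_avg _ Λ hΛ q hq) (2 * d) (by positivity)
  have hsub : Metric.closedBall p d ⊆ Metric.closedBall q (2 * d) := by
    intro z hz
    simp only [Metric.mem_closedBall] at hz ⊢
    have := dist_triangle z p q
    linarith
  have h3 : ENNReal.ofReal |u p - u q| * ENNReal.ofReal (Real.pi * d ^ 2) ≤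
      ENNReal.ofReal (5 * Λ * d ^ 3) + ENNReal.ofReal (5 * Λ * (2 * d) ^ 3) := by
    refine le_trans ?_ (add_le_add h1 ((lintegral_mono_set hsub).trans h2))
    rw [← vol_cball p d hd.le, ← setLIntegral_const]
    have hmeas : Measurable fun z => ‖unitSq.indicator u z - u p‖ₑ :=
      ((hu.continuous.measurable.indicator isClosed_unitSq.measurableSet).sub_const _).enorm
    rw [← lintegral_add_left hmeas]
    apply lintegral_mono
    intro z
    simp only
    rw [← Real.norm_eq_abs, ofReal_norm]
    have e : u p - u q = (unitSq.indicator u z - u q) - (unitSq.indicator u z - u p) := by ring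
    rw [e, add_comm]
    exact enorm_sub_le
  rw [← ENNReal.ofReal_mul (by positivity), ← ENNReal.ofReal_add (by positivity) (by positivity),
    ENNReal.ofReal_le_ofReal_iff (by positivity)] at h3
  have h4 : |u p - u q| * d ^ 2 ≤ |u p - u q| * (Real.pi * d ^ 2) := by
    have := Real.pi_gt_three
    have h4 : 0 ≤ |u p - u q| * d ^ 2 := by positivity
    nlinarith
  have h5 : |u p - u q| * d ^ 2 ≤ (135 * Λ * d) * d ^ 2 := by
    have : 0 < Λ * d ^ 3 := by positivity
    nlinarith
  exact le_of_mul_le_mul_right h5 (by positivity)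

lemma good_bdry (u : E2 → ℝ) (hu : ContDiff ℝ 1 u) (hu0 : ∀ x ∈ unitSqBdry, u x = 0)
    (Λ : ℝ) (hΛ : 0 < Λ) (p : E2) (hpS : p ∈ unitSq) (hp : p ∉ badSet (ug u) Λ)
    (q : E2) (hqS : q ∈ unitSqBdry) :
    |u p - u q| ≤ 135 * Λ * dist p q := by
  rw [hu0 q hqS, sub_zero]
  obtain ⟨_, i, hi⟩ := hqS
  have hcoord : ∀ x y : E2, |x i - y i| ≤ dist x y := by
    intro x y
    rw [dist_eq_norm]
    have := PiLp.norm_apply_le (x - y) i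
    simpa using this
  by_cases hpB : p ∈ unitSqBdry
  · rw [hu0 p hpB, abs_zero]; positivity
  have hpne : p i ≠ 0 ∧ p i ≠ 1 := by
    constructor
    · intro h; exact hpB ⟨hpS, i, Or.inl h⟩
    · intro h; exact hpB ⟨hpS, i, Or.inr h⟩
  have hp0 : 0 < p i := lt_of_le_of_ne (hpS i).1 (Ne.symm hpne.1)
  have hp1 : p i < 1 := lt_of_le_of_ne (hpS i).2 hpne.2
  rcases hi with hi | hi
  · have hle : p i ≤ dist p q := by
      have := hcoord p q
      rw [hi, sub_zero] at this
      exact (le_abs_self _).trans this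
    refine le_trans (good_close u hu hu0 Λ hΛ p hpS hp
      (p - EuclideanSpace.single i (2 * p i)) (p i) hp0 ?_ ?_) (by gcongr)
    · rw [dist_eq_norm]
      simp [abs_of_pos hp0]
    · intro z hz hzS
      have h1 := hcoord z (p - EuclideanSpace.single i (2 * p i))
      have h2 := hz
      rw [Metric.mem_ball] at h2
      have h3 := (hzS i).1
      have h4 := le_abs_self (z i - (p - EuclideanSpace.single i (2 * p i)) i)
      have h5 : (p - EuclideanSpace.single i (2 * p i)) i = p i - 2 * p i := by simp
      rw [h5] at h4 h1
      linarith
  · have hle : 1 - p i ≤ dist p q := by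
      have := hcoord p q
      rw [hi, abs_sub_comm] at this
      exact (le_abs_self _).trans this
    refine le_trans (good_close u hu hu0 Λ hΛ p hpS hp
      (p + EuclideanSpace.single i (2 * (1 - p i))) (1 - p i) (by linarith) ?_ ?_) (by gcongr)
    · rw [dist_eq_norm]
      simp [abs_of_pos (sub_pos.2 hp1)]
    · intro z hz hzS
      have h1 := hcoord z (p + EuclideanSpace.single i (2 * (1 - p i)))
      have h2 := hz
      rw [Metric.mem_ball] at h2
      have h3 := (hzS i).2
      have h4 := neg_abs_le (z i - (p + EuclideanSpace.single i (2 * (1 - p i))) i)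
      have h5 : (p + EuclideanSpace.single i (2 * (1 - p i))) i = p i + 2 * (1 - p i) := by simp
      rw [h5] at h4 h1
      linarith

/-- Lipschitz truncation. -/
lemma lip_trunc (u : E2 → ℝ) (hu : ContDiff ℝ 1 u) (hu0 : ∀ x ∈ unitSqBdry, u x = 0)
    (C : ℝ) (hC : 0 ≤ C) (hD : ∫⁻ z, ug u z ^ 2 ≤ ENNReal.ofReal C) (Λ : ℝ) (hΛ : 0 < Λ) :
    ∃ B : Set E2, MeasurableSet B ∧ volume B ≤ ENNReal.ofReal (16 * Real.pi / Λ ^ 2 * C) ∧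
    ∃ v : E2 → ℝ, LipschitzWith (Real.toNNReal (135 * Λ)) v ∧ (∀ x ∈ unitSq \ B, v x = u x) ∧
      ∀ x ∈ unitSqBdry, v x = 0 := by
  refine ⟨toMeasurable volume (badSet (ug u) Λ), measurableSet_toMeasurable _ _, ?_, ?_⟩
  · rw [measure_toMeasurable]
    exact volume_badSet _ (measurable_ug u hu) Λ hΛ C hC hD
  · have hL : LipschitzOnWith (Real.toNNReal (135 * Λ)) u
        ((unitSq \ badSet (ug u) Λ) ∪ unitSqBdry) := by
      apply LipschitzOnWith.of_dist_le_mul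
      intro x hx y hy
      rw [Real.dist_eq, Real.coe_toNNReal _ (by positivity)]
      rcases hx with hx | hx <;> rcases hy with hy | hy
      · exact good_good u hu hu0 Λ hΛ x hx.1 hx.2 y hy.1 hy.2
      · exact good_bdry u hu hu0 Λ hΛ x hx.1 hx.2 y hy
      · rw [abs_sub_comm, dist_comm]
        exact good_bdry u hu hu0 Λ hΛ y hy.1 hy.2 x hx
      · rw [hu0 x hx, hu0 y hy, sub_zero, abs_zero]; positivity
    obtain ⟨v, hv, heq⟩ := hL.extend_real
    refine ⟨v, hv, fun x hx => ?_, fun x hx => ?_⟩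
    · exact (heq (Or.inl ⟨hx.1, fun h => hx.2 (subset_toMeasurable _ _ h)⟩)).symm
    · rw [← heq (Or.inr hx), hu0 x hx]


lemma vol_antilip (f : E2 → E2) (K : NNReal) (hf : AntilipschitzWith K f) (X : Set E2) :
    volume X ≤ (K : ENNReal) ^ 2 * volume (f '' X) := by
  have hfin : Module.finrank ℝ E2 = 2 := by simp
  have : (Measure.hausdorffMeasure (2:ℝ) : Measure E2).IsAddHaarMeasure := by
    have := isAddHaarMeasure_hausdorffMeasure (E := E2)
    rw [hfin] at this
    exact_mod_cast this
  obtain ⟨c, hc⟩ : ∃ c : NNReal, (volume : Measure E2) = c • Measure.hausdorffMeasure (2:ℝ) :=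
    ⟨_, Measure.isAddLeftInvariant_eq_smul (volume : Measure E2) (Measure.hausdorffMeasure (2:ℝ))⟩
  have h := hf.le_hausdorffMeasure_image (d := 2) (by norm_num) X
  rw [hc]
  simp only [Measure.smul_apply, ENNReal.smul_def, smul_eq_mul]
  calc _ ≤ (c : ENNReal) * ((K:ENNReal) ^ (2:ℝ) * Measure.hausdorffMeasure 2 (f '' X)) := by gcongr
    _ = _ := by
      rw [ENNReal.rpow_two]; ring

def shiftMap (v : E2 → ℝ) (i : Fin 2) (t : ℝ) (x : E2) : E2 :=
  x + (t * v x) • EuclideanSpace.single i (1:ℝ)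

section shift
variable {v : E2 → ℝ} {i : Fin 2} {t s : ℝ}

lemma shift_sub (hv : ∀ x y, t * |v x - v y| ≤ s * ‖x - y‖) (ht : 0 < t) (x y : E2) :
    ‖(shiftMap v i t x - shiftMap v i t y) - (x - y)‖ ≤ s * ‖x - y‖ := by
  have : (shiftMap v i t x - shiftMap v i t y) - (x - y) =
      (t * (v x - v y)) • EuclideanSpace.single i (1:ℝ) := by
    simp only [shiftMap, mul_sub, sub_smul]; abel
  rw [this, norm_smul]
  simp only [PiLp.norm_single, norm_one, mul_one, Real.norm_eq_abs, abs_mul, abs_of_pos ht]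
  exact hv x y

lemma shift_upper (hv : ∀ x y, t * |v x - v y| ≤ s * ‖x - y‖) (ht : 0 < t) (x y : E2) :
    ‖shiftMap v i t x - shiftMap v i t y‖ ≤ (1 + s) * ‖x - y‖ := by
  have h1 := shift_sub (i := i) hv ht x y
  have h2 := norm_sub_norm_le (shiftMap v i t x - shiftMap v i t y) (x - y)
  linarith

lemma shift_lower (hv : ∀ x y, t * |v x - v y| ≤ s * ‖x - y‖) (ht : 0 < t) (x y : E2) :
    (1 - s) * ‖x - y‖ ≤ ‖shiftMap v i t x - shiftMap v i t y‖ := by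
  have h1 := shift_sub (i := i) hv ht x y
  have h2 := norm_sub_norm_le (x - y) (shiftMap v i t x - shiftMap v i t y)
  rw [norm_sub_rev (x - y) (shiftMap v i t x - shiftMap v i t y)] at h2
  linarith

lemma shift_apply_ne (x : E2) (j : Fin 2) (hj : j ≠ i) : shiftMap v i t x j = x j := by
  simp [shiftMap, hj]

lemma shift_apply_self (x : E2) : shiftMap v i t x i = x i + t * v x := by
  simp [shiftMap]

/-- replace the `i`-th coordinate -/
def setc (x : E2) (i : Fin 2) (r : ℝ) : E2 := x + (r - x i) • EuclideanSpace.single i (1:ℝ)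

lemma setc_self (x : E2) (i : Fin 2) (r : ℝ) : setc x i r i = r := by simp [setc]
lemma setc_ne (x : E2) (i j : Fin 2) (r : ℝ) (h : j ≠ i) : setc x i r j = x j := by simp [setc, h]

lemma setc_mem (x : E2) (hx : x ∈ unitSq) (i : Fin 2) (r : ℝ) (hr : r ∈ Set.Icc (0:ℝ) 1) :
    setc x i r ∈ unitSq := by
  intro j
  by_cases h : j = i
  · subst h; rw [setc_self]; exact hr
  · rw [setc_ne _ _ _ _ h]; exact hx j

lemma norm_sub_setc (x : E2) (i : Fin 2) (r : ℝ) : ‖x - setc x i r‖ = |x i - r| := by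
  have : x - setc x i r = (x i - r) • EuclideanSpace.single i (1:ℝ) := by
    simp only [setc, sub_smul]; abel
  rw [this, norm_smul]; simp

lemma shift_mem (hv : ∀ x y, t * |v x - v y| ≤ s * ‖x - y‖) (ht : 0 < t) (hs : s ≤ 1)
    (hv0 : ∀ x ∈ unitSqBdry, v x = 0) (x : E2) (hx : x ∈ unitSq) :
    shiftMap v i t x ∈ unitSq := by
  intro j
  by_cases h : j = i
  swap
  · rw [shift_apply_ne x j h]; exact hx j
  subst h
  rw [shift_apply_self]
  have hx0 := (hx j).1
  have hx1 := (hx j).2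
  have h0 := hv x (setc x j 0)
  have h1 := hv x (setc x j 1)
  rw [hv0 (setc x j 0) ⟨setc_mem x hx j 0 (by simp), j, Or.inl (setc_self _ _ _)⟩,
    norm_sub_setc, sub_zero, sub_zero, abs_of_nonneg hx0] at h0
  rw [hv0 (setc x j 1) ⟨setc_mem x hx j 1 (by simp), j, Or.inr (setc_self _ _ _)⟩,
    norm_sub_setc, sub_zero, abs_sub_comm, abs_of_nonneg (sub_nonneg.2 hx1)] at h1
  have h2 : s * x j ≤ x j := by nlinarith
  have h3 : s * (1 - x j) ≤ 1 - x j := by nlinarith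
  have h4 : |t * v x| = t * |v x| := by rw [abs_mul, abs_of_pos ht]
  have h5 := neg_abs_le (t * v x)
  have h6 := le_abs_self (t * v x)
  constructor <;> linarith

lemma shift_bdry (hv0 : ∀ x ∈ unitSqBdry, v x = 0) (x : E2) (hx : x ∈ unitSqBdry) :
    shiftMap v i t x = x := by
  simp [shiftMap, hv0 x hx]

lemma shift_bij (hvc : Continuous v) (hv : ∀ x y, t * |v x - v y| ≤ s * ‖x - y‖) (ht : 0 < t)
    (hs : s < 1) (hv0 : ∀ x ∈ unitSqBdry, v x = 0) :
    Set.BijOn (shiftMap v i t) unitSq unitSq := by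
  refine ⟨fun x hx => shift_mem hv ht hs.le hv0 x hx, ?_, ?_⟩
  · intro x _ y _ hxy
    have := shift_lower (i := i) hv ht x y
    rw [hxy, sub_self, norm_zero] at this
    have h2 : ‖x - y‖ ≤ 0 := by
      by_contra h
      push Not at h
      nlinarith
    exact sub_eq_zero.1 (norm_le_zero_iff.1 h2)
  · intro y hy
    let h : ℝ → ℝ := fun r => r + t * v (setc y i r)
    have hc : Continuous h := by
      have : Continuous (fun r => setc y i r) := by unfold setc; fun_prop
      fun_prop
    have h0 : h 0 = 0 := by
      simp only [h]
      rw [hv0 _ ⟨setc_mem y hy i 0 (by simp), i, Or.inl (setc_self _ _ _)⟩]; simp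
    have h1 : h 1 = 1 := by
      simp only [h]
      rw [hv0 _ ⟨setc_mem y hy i 1 (by simp), i, Or.inr (setc_self _ _ _)⟩]; simp
    have hivt := intermediate_value_Icc (zero_le_one' ℝ) hc.continuousOn
    rw [h0, h1] at hivt
    obtain ⟨r, hr, hr2⟩ := hivt (hy i)
    refine ⟨setc y i r, setc_mem y hy i r hr, ?_⟩
    ext j
    by_cases hj : j = i
    · subst hj
      rw [shift_apply_self, setc_self]; exact hr2
    · rw [shift_apply_ne _ j hj, setc_ne _ _ _ _ hj]

lemma shift_antilip (hv : ∀ x y, t * |v x - v y| ≤ s * ‖x - y‖) (ht : 0 < t) (hs : s < 1) :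
    AntilipschitzWith (Real.toNNReal (1 - s)⁻¹) (shiftMap v i t) := by
  have h1s : 0 < 1 - s := by linarith
  apply AntilipschitzWith.of_le_mul_dist
  intro x y
  rw [Real.coe_toNNReal _ (by positivity), dist_eq_norm, dist_eq_norm, inv_mul_eq_div,
    le_div_iff₀ h1s, mul_comm]
  exact shift_lower hv ht x y

lemma det_rank_one (L : E2 →L[ℝ] ℝ) (i : Fin 2) :
    (ContinuousLinearMap.id ℝ E2 + L.smulRight (EuclideanSpace.single i (1:ℝ))).det =
      1 + L (EuclideanSpace.single i (1:ℝ)) := by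
  rw [ContinuousLinearMap.det, ← LinearMap.det_toMatrix (EuclideanSpace.basisFun (Fin 2) ℝ).toBasis,
    Matrix.det_fin_two]
  fin_cases i <;> simp [LinearMap.toMatrix_apply]

end shift

lemma shift_vol_good (u v : E2 → ℝ) (hu : ContDiff ℝ 1 u) (i : Fin 2) (t : ℝ) (X : Set E2)
    (hX : MeasurableSet X) (heq : ∀ x ∈ X, v x = u x) (hinj : Set.InjOn (shiftMap v i t) X) :
    ∫⁻ x in X, ENNReal.ofReal (1 + t * fderiv ℝ u x (EuclideanSpace.single i 1)) ≤
      volume (shiftMap v i t '' X) := by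
  rw [← lintegral_abs_det_fderiv_eq_addHaar_image volume hX (f' := fun x =>
    ContinuousLinearMap.id ℝ E2 + (t • fderiv ℝ u x).smulRight (EuclideanSpace.single i (1:ℝ))) _ hinj]
  · apply lintegral_mono
    intro x
    apply ENNReal.ofReal_le_ofReal
    rw [det_rank_one]
    exact le_abs_self _
  · intro x hx
    have h1 : HasFDerivAt (shiftMap u i t) (ContinuousLinearMap.id ℝ E2 +
        (t • fderiv ℝ u x).smulRight (EuclideanSpace.single i (1:ℝ))) x := by
      have := ((hu.differentiable one_ne_zero) x).hasFDerivAt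
      exact (hasFDerivAt_id x).add ((this.const_mul t).smul_const _)
    apply h1.hasFDerivWithinAt.congr
    · intro y hy; simp [shiftMap, heq y hy]
    · simp [shiftMap, heq x hx]


lemma amgm_ennreal (Λ : ℝ) (hΛ : 0 < Λ) (a : ENNReal) :
    a ≤ ENNReal.ofReal Λ⁻¹ * a ^ 2 + ENNReal.ofReal Λ := by
  rcases eq_or_ne a ⊤ with rfl | ha
  · simp [ENNReal.mul_top, hΛ]
  · lift a to NNReal using ha
    have : (a : ENNReal) = ENNReal.ofReal a := by simp
    rw [this, ← ENNReal.ofReal_pow (by positivity), ← ENNReal.ofReal_mul (by positivity),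
      ← ENNReal.ofReal_add (by positivity) (by positivity)]
    apply ENNReal.ofReal_le_ofReal
    have : Λ⁻¹ * (a:ℝ)^2 + Λ - a = Λ⁻¹ * ((a - Λ/2)^2 + 3/4 * Λ^2) := by field_simp; ring
    have h3 : 0 ≤ Λ⁻¹ * (((a:ℝ) - Λ/2)^2 + 3/4 * Λ^2) := by positivity
    linarith

lemma isCompact_unitSq : IsCompact unitSq := by
  apply Metric.isCompact_of_isClosed_isBounded isClosed_unitSq
  rw [isBounded_iff_forall_norm_le]
  refine ⟨Real.sqrt 2, fun x hx => ?_⟩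
  rw [EuclideanSpace.norm_eq]
  apply Real.sqrt_le_sqrt
  rw [Fin.sum_univ_two]
  have h0 := hx 0
  have h1 := hx 1
  simp only [Real.norm_eq_abs, sq_abs]
  nlinarith [h0.1, h0.2, h1.1, h1.2]

lemma small_int (u : E2 → ℝ) (i : Fin 2) (C : ℝ) (hC : 0 ≤ C)
    (hD : ∫⁻ z, ug u z ^ 2 ≤ ENNReal.ofReal C) (Λ : ℝ) (hΛ : 0 < Λ) (X : Set E2)
    (hX : MeasurableSet X) (hXS : X ⊆ unitSq) (b : ℝ) (hb : 0 ≤ b) (hXb : volume X ≤ ENNReal.ofReal b) :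
    |∫ x in X, fderiv ℝ u x (EuclideanSpace.single i 1)| ≤ C / Λ + Λ * b := by
  rw [← ENNReal.ofReal_le_ofReal_iff (by positivity), ← Real.norm_eq_abs, ofReal_norm]
  calc _ ≤ ∫⁻ x in X, ‖fderiv ℝ u x (EuclideanSpace.single i 1)‖ₑ :=
        enorm_integral_le_lintegral_enorm _
    _ ≤ ∫⁻ x in X, (ENNReal.ofReal Λ⁻¹ * ug u x ^ 2 + ENNReal.ofReal Λ) := by
        apply setLIntegral_mono' hX
        intro x hx
        refine le_trans ?_ (amgm_ennreal Λ hΛ _)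
        rw [ug, Set.indicator_of_mem (hXS hx)]
        refine (ContinuousLinearMap.le_opENorm _ _).trans ?_
        rw [← ofReal_norm (EuclideanSpace.single i (1:ℝ))]
        simp
    _ = ENNReal.ofReal Λ⁻¹ * (∫⁻ x in X, ug u x ^ 2) + ENNReal.ofReal Λ * volume X := by
        rw [lintegral_add_right _ measurable_const, lintegral_const_mul' _ _ ENNReal.ofReal_ne_top,
          setLIntegral_const]
    _ ≤ ENNReal.ofReal Λ⁻¹ * ENNReal.ofReal C + ENNReal.ofReal Λ * ENNReal.ofReal b := by
        gcongr
        exact (setLIntegral_le_lintegral _ _).trans hD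
    _ = _ := by
        rw [← ENNReal.ofReal_mul (by positivity), ← ENNReal.ofReal_mul (by positivity),
          ← ENNReal.ofReal_add (by positivity) (by positivity), div_eq_inv_mul]

lemma ofReal_integral_le {X : Set E2} (f : E2 → ℝ) (hf : IntegrableOn f X volume) :
    ENNReal.ofReal (∫ x in X, f x) ≤ ∫⁻ x in X, ENNReal.ofReal (f x) := by
  rw [integral_eq_lintegral_pos_part_sub_lintegral_neg_part hf]
  refine le_trans (ENNReal.ofReal_le_ofReal (sub_le_self _ ENNReal.toReal_nonneg)) ?_
  exact ENNReal.ofReal_toReal_le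

lemma main_map (c0 C η : ℝ) (hc0 : 0 < c0) (hC : 0 < C) (hη : 0 < η) :
    ∃ ε : ℝ, 0 < ε ∧ ∀ A : Set E2, A ⊆ unitSq → MeasurableSet A →
      ∀ (u : E2 → ℝ) (i : Fin 2), ContDiff ℝ 1 u → (∀ x ∈ unitSqBdry, u x = 0) →
      ∫⁻ z, ug u z ^ 2 ≤ ENNReal.ofReal C →
      c0 ≤ ∫ x in A, fderiv ℝ u x (EuclideanSpace.single i 1) →
      ∃ φ : E2 → E2, Set.BijOn φ unitSq unitSq ∧
          (∀ x ∈ unitSq, ∀ y ∈ unitSq,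
            (1 + η)⁻¹ * ‖x - y‖ ≤ ‖φ x - φ y‖ ∧ ‖φ x - φ y‖ ≤ (1 + η) * ‖x - y‖) ∧
          (∀ x ∈ unitSqBdry, φ x = x) ∧
          volume A + ENNReal.ofReal ε ≤ volume (φ '' A) := by
  have hpi := Real.pi_pos
  set m : ℝ := 16 * Real.pi * C with hm
  have hm0 : 0 < m := by positivity
  set c1 : ℝ := C + m + 270 * m with hc1
  have hc10 : 0 < c1 := by positivity
  set Λ : ℝ := 2 * c1 / c0 with hΛd
  have hΛ : 0 < Λ := by positivity
  set s : ℝ := η / (1 + η) with hsd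
  have hs0 : 0 < s := by positivity
  have hs1 : s < 1 := by rw [hsd, div_lt_one (by positivity)]; linarith
  have h1s : 1 - s = (1 + η)⁻¹ := by rw [hsd]; field_simp; ring
  have hsη : s ≤ η := by rw [hsd]; apply div_le_self hη.le; linarith
  set t : ℝ := s / (135 * Λ) with htd
  have ht : 0 < t := by positivity
  have hts : t * (135 * Λ) = s := by rw [htd]; field_simp
  refine ⟨t * (c0 / 2), by positivity, ?_⟩
  intro A hAS hA u i hu hu0 hD hgain
  obtain ⟨B, hB, hBvol, v, hvlip, hvu, hv0⟩ := lip_trunc u hu hu0 C hC.le hD Λ hΛ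
  have hv : ∀ x y, t * |v x - v y| ≤ s * ‖x - y‖ := by
    intro x y
    have := hvlip.dist_le_mul x y
    rw [Real.dist_eq, Real.coe_toNNReal _ (by positivity), dist_eq_norm] at this
    calc t * |v x - v y| ≤ t * (135 * Λ * ‖x - y‖) := by gcongr
      _ = s * ‖x - y‖ := by rw [← hts]; ring
  have hbij := shift_bij (i := i) hvlip.continuous hv ht hs1 hv0
  have hanti := shift_antilip (i := i) hv ht hs1
  refine ⟨shiftMap v i t, hbij, ?_, ?_, ?_⟩
  · intro x _ y _
    constructor
    · rw [← h1s]; exact shift_lower hv ht x y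
    · refine (shift_upper hv ht x y).trans ?_
      gcongr
  · exact fun x hx => shift_bdry hv0 x hx
  have hAfin : volume A ≠ ⊤ :=
    ((measure_mono hAS).trans_lt isCompact_unitSq.measure_lt_top).ne
  have hABfin : volume (A ∩ B) ≠ ⊤ :=
    ((measure_mono Set.inter_subset_left).trans_lt hAfin.lt_top).ne
  -- the two pieces
  have hcont : Continuous (shiftMap v i t) := by
    have := hvlip.continuous
    unfold shiftMap; fun_prop
  have hinj : Function.Injective (shiftMap v i t) := hanti.injective
  have hsplit : volume (shiftMap v i t '' A) =
      volume (shiftMap v i t '' (A ∩ B)) + volume (shiftMap v i t '' (A \ B)) := by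
    rw [← measure_union]
    · rw [← Set.image_union, Set.inter_union_sdiff]
    · rw [Set.disjoint_image_iff hinj]
      exact Set.disjoint_sdiff_inter.symm
    · exact (hA.diff hB).image_of_continuousOn_injOn hcont.continuousOn hinj.injOn
  set b : ℝ := (volume (A ∩ B)).toReal with hbd
  have hb0 : 0 ≤ b := ENNReal.toReal_nonneg
  have hbm : b ≤ m / Λ ^ 2 := by
    have h1 : volume (A ∩ B) ≤ ENNReal.ofReal (16 * Real.pi / Λ ^ 2 * C) :=
      (measure_mono Set.inter_subset_right).trans hBvol
    have h2 := ENNReal.toReal_le_of_le_ofReal (by positivity) h1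
    refine h2.trans (le_of_eq ?_)
    rw [hm]; ring
  have hbad : ENNReal.ofReal ((1 - s) ^ 2 * b) ≤ volume (shiftMap v i t '' (A ∩ B)) := by
    have h1 := vol_antilip _ _ hanti (A ∩ B)
    have h1s' : 0 < 1 - s := by linarith
    have h2 : ENNReal.ofReal ((1 - s) ^ 2) * volume (A ∩ B) ≤
        ENNReal.ofReal ((1 - s) ^ 2) * ((Real.toNNReal (1 - s)⁻¹ : ENNReal) ^ 2 *
          volume (shiftMap v i t '' (A ∩ B))) := by gcongr
    rw [← mul_assoc] at h2
    have h3 : ENNReal.ofReal ((1 - s) ^ 2) * (Real.toNNReal (1 - s)⁻¹ : ENNReal) ^ 2 = 1 := by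
      change ENNReal.ofReal ((1 - s) ^ 2) * (ENNReal.ofReal (1 - s)⁻¹) ^ 2 = 1
      rw [← ENNReal.ofReal_pow (by positivity), ← ENNReal.ofReal_mul (by positivity)]
      have : (1 - s) ^ 2 * (1 - s)⁻¹ ^ 2 = 1 := by field_simp
      rw [this, ENNReal.ofReal_one]
    rw [h3, one_mul] at h2
    refine le_trans (le_of_eq ?_) h2
    rw [ENNReal.ofReal_mul (by positivity), hbd, ENNReal.ofReal_toReal hABfin]
  set G : E2 → ℝ := fun x => fderiv ℝ u x (EuclideanSpace.single i 1) with hG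
  have hGc : Continuous G := by
    have := hu.continuous_fderiv one_ne_zero
    fun_prop
  have hGS : IntegrableOn G unitSq volume := hGc.continuousOn.integrableOn_compact isCompact_unitSq
  have hGA : IntegrableOn G A volume := hGS.mono_set hAS
  have hGAB : IntegrableOn G (A \ B) volume := hGA.mono_set Set.sdiff_subset
  have h1AB : IntegrableOn (fun _ : E2 => (1:ℝ)) (A \ B) volume := by
    refine integrableOn_const ?_ (by simp)
    exact ((measure_mono Set.sdiff_subset).trans_lt hAfin.lt_top).ne
  have hgood : ENNReal.ofReal (∫ x in A \ B, (1 + t * G x)) ≤ volume (shiftMap v i t '' (A \ B)) := by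
    refine le_trans (ofReal_integral_le _ (h1AB.add (hGAB.const_mul t))) ?_
    exact shift_vol_good u v hu i t (A \ B) (hA.diff hB)
      (fun x hx => hvu x ⟨hAS hx.1, hx.2⟩) hinj.injOn
  have hIntg : ∫ x in A \ B, (1 + t * G x) = (volume A).toReal - b +
      t * ((∫ x in A, G x) - ∫ x in A ∩ B, G x) := by
    rw [integral_add h1AB (hGAB.const_mul t), integral_const_mul]
    have e1 := integral_inter_add_sdiff hB hGA
    have e2 := measure_inter_add_sdiff A hB (μ := volume)
    have e3 : (volume A).toReal = b + (volume (A \ B)).toReal := by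
      rw [← e2, ENNReal.toReal_add hABfin]
      exact ((measure_mono Set.sdiff_subset).trans_lt hAfin.lt_top).ne
    have e4 : ∫ x in A \ B, (1:ℝ) = (volume (A \ B)).toReal := by
      simp [Measure.real]
    rw [e4, e3, ← e1]; ring
  have hsm := small_int u i C hC.le hD Λ hΛ (A ∩ B) (hA.inter hB)
    (Set.inter_subset_left.trans hAS) b hb0 (by rw [hbd, ENNReal.ofReal_toReal hABfin])
  have hΛb : Λ * b ≤ m / Λ := by
    calc Λ * b ≤ Λ * (m / Λ ^ 2) := by gcongr
      _ = m / Λ := by field_simp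
  have hc1Λ : c1 / Λ = c0 / 2 := by rw [hΛd]; field_simp
  have hfinal : (volume A).toReal + t * (c0 / 2) ≤
      (1 - s) ^ 2 * b + ∫ x in A \ B, (1 + t * G x) := by
    rw [hIntg]
    have h1 : ∫ x in A ∩ B, G x ≤ C / Λ + m / Λ := by
      have := le_abs_self (∫ x in A ∩ B, G x)
      linarith
    have h2 : s * b ≤ t * (135 * (m / Λ)) := by
      rw [← hts]
      nlinarith
    have h3 : C / Λ + m / Λ + 270 * (m / Λ) = c0 / 2 := by
      rw [← hc1Λ, hc1]; ring
    have h4 : t * (c0 - (C / Λ + m / Λ)) ≤ t * ((∫ x in A, G x) - ∫ x in A ∩ B, G x) := by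
      gcongr
    have h5 : 0 ≤ s ^ 2 * b := by positivity
    have h6 : t * (c0 - (C / Λ + m / Λ)) = t * (c0 / 2) + 2 * (t * (135 * (m / Λ))) := by
      have : C / Λ + m / Λ = c0 / 2 - 270 * (m / Λ) := by linarith
      rw [this]; ring
    nlinarith
  calc volume A + ENNReal.ofReal (t * (c0 / 2))
      = ENNReal.ofReal ((volume A).toReal + t * (c0 / 2)) := by
        rw [ENNReal.ofReal_add ENNReal.toReal_nonneg (by positivity), ENNReal.ofReal_toReal hAfin]
    _ ≤ ENNReal.ofReal ((1 - s) ^ 2 * b + ∫ x in A \ B, (1 + t * G x)) :=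
        ENNReal.ofReal_le_ofReal hfinal
    _ ≤ ENNReal.ofReal ((1 - s) ^ 2 * b) + ENNReal.ofReal (∫ x in A \ B, (1 + t * G x)) :=
        ENNReal.ofReal_add_le
    _ ≤ _ := by
        rw [hsplit]
        exact add_le_add hbad hgood


lemma prod_integral (i j : Fin 2) (hij : i ≠ j) (F G : ℝ → ℝ) :
    ∫ x in unitSq, F (x i) * G (x j) = (∫ y in (0:ℝ)..1, F y) * ∫ y in (0:ℝ)..1, G y := by
  let H : Fin 2 → ℝ → ℝ := fun m => if m = i then F else G
  have h2 : ∀ K : Fin 2 → ℝ, ∏ m, K m = K i * K j := by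
    intro K
    rw [Fin.prod_univ_two]
    fin_cases i <;> fin_cases j <;> simp_all [mul_comm]
  have e1 : (fun x : E2 => F (x i) * G (x j)) = fun x : E2 => ∏ m, H m (x m) := by
    funext x
    rw [h2]
    simp [H, hij.symm]
  have hS : unitSq = (WithLp.ofLp : E2 → (Fin 2 → ℝ)) ⁻¹' (Set.univ.pi fun _ => Set.Icc (0:ℝ) 1) := by
    ext x; exact ⟨fun h m _ => h m, fun h m => h m trivial⟩
  have hmp := PiLp.volume_preserving_ofLp (Fin 2)
  have hemb : MeasurableEmbedding (WithLp.ofLp : E2 → (Fin 2 → ℝ)) :=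
    (MeasurableEquiv.toLp 2 (Fin 2 → ℝ)).symm.measurableEmbedding
  rw [e1, hS, hmp.setIntegral_preimage_emb hemb (fun y : Fin 2 → ℝ => ∏ m, H m (y m))]
  rw [volume_pi, Measure.restrict_pi_pi, integral_fintype_prod_eq_prod, h2]
  rw [intervalIntegral.integral_of_le zero_le_one, intervalIntegral.integral_of_le zero_le_one,
    integral_Icc_eq_integral_Ioc, integral_Icc_eq_integral_Ioc]
  simp [H, hij.symm]

def cs (k : ℕ) (y : ℝ) : ℝ := Real.cos (Real.pi * k * y)
def sn (k : ℕ) (y : ℝ) : ℝ := Real.sin (Real.pi * k * y)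

lemma continuous_cs (k : ℕ) : Continuous (cs k) := by unfold cs; fun_prop
lemma continuous_sn (k : ℕ) : Continuous (sn k) := by unfold sn; fun_prop

lemma int_cos (n : ℤ) (hn : n ≠ 0) : ∫ y in (0:ℝ)..1, Real.cos (Real.pi * n * y) = 0 := by
  have h : Real.pi * (n:ℝ) ≠ 0 := mul_ne_zero Real.pi_ne_zero (by exact_mod_cast hn)
  rw [intervalIntegral.integral_comp_mul_left (fun y => Real.cos y) h, integral_cos]
  have : Real.sin (Real.pi * n * 1) = 0 := by
    rw [mul_one, mul_comm]; exact Real.sin_int_mul_pi n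
  rw [this]; simp

lemma cs_mul (k l : ℕ) (y : ℝ) : cs k y * cs l y =
    1 / 2 * Real.cos (Real.pi * ((k - l : ℤ) : ℝ) * y) +
    1 / 2 * Real.cos (Real.pi * ((k + l : ℤ) : ℝ) * y) := by
  unfold cs
  push_cast
  have e1 : Real.pi * ((k:ℝ) - l) * y = Real.pi * k * y - Real.pi * l * y := by ring
  have e2 : Real.pi * ((k:ℝ) + l) * y = Real.pi * k * y + Real.pi * l * y := by ring
  rw [e1, e2, Real.cos_sub, Real.cos_add]; ring

lemma sn_mul (k l : ℕ) (y : ℝ) : sn k y * sn l y =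
    1 / 2 * Real.cos (Real.pi * ((k - l : ℤ) : ℝ) * y) -
    1 / 2 * Real.cos (Real.pi * ((k + l : ℤ) : ℝ) * y) := by
  unfold sn
  push_cast
  have e1 : Real.pi * ((k:ℝ) - l) * y = Real.pi * k * y - Real.pi * l * y := by ring
  have e2 : Real.pi * ((k:ℝ) + l) * y = Real.pi * k * y + Real.pi * l * y := by ring
  rw [e1, e2, Real.cos_sub, Real.cos_add]; ring

lemma int_cs_cs (k l : ℕ) (h : k ≠ l) : ∫ y in (0:ℝ)..1, cs k y * cs l y = 0 := by
  simp_rw [cs_mul]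
  rw [intervalIntegral.integral_add (Continuous.intervalIntegrable (by fun_prop) _ _)
    (Continuous.intervalIntegrable (by fun_prop) _ _), intervalIntegral.integral_const_mul,
    intervalIntegral.integral_const_mul, int_cos _ (by lia), int_cos _ (by lia)]
  simp

lemma int_sn_sn (k l : ℕ) (h : k ≠ l) : ∫ y in (0:ℝ)..1, sn k y * sn l y = 0 := by
  simp_rw [sn_mul]
  rw [intervalIntegral.integral_sub (Continuous.intervalIntegrable (by fun_prop) _ _)
    (Continuous.intervalIntegrable (by fun_prop) _ _), intervalIntegral.integral_const_mul,
    intervalIntegral.integral_const_mul, int_cos _ (by lia), int_cos _ (by lia)]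
  simp

lemma int_sn_le (k : ℕ) : ∫ y in (0:ℝ)..1, sn k y * sn k y ≤ ∫ y in (0:ℝ)..1, cs k y * cs k y := by
  rcases Nat.eq_zero_or_pos k with rfl | hk
  · simp [sn, cs]
  · apply le_of_eq
    simp_rw [sn_mul, cs_mul]
    rw [intervalIntegral.integral_sub (Continuous.intervalIntegrable (by fun_prop) _ _)
      (Continuous.intervalIntegrable (by fun_prop) _ _),
      intervalIntegral.integral_add (Continuous.intervalIntegrable (by fun_prop) _ _)
      (Continuous.intervalIntegrable (by fun_prop) _ _), intervalIntegral.integral_const_mul,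
      intervalIntegral.integral_const_mul, int_cos (k + k) (by lia)]
    simp

lemma int_sq_nonneg (P : ℝ → ℝ) : 0 ≤ ∫ y in (0:ℝ)..1, P y * P y :=
  intervalIntegral.integral_nonneg zero_le_one fun y _ => mul_self_nonneg _

lemma intOn {f : E2 → ℝ} (hf : Continuous f) : IntegrableOn f unitSq volume :=
  hf.continuousOn.integrableOn_compact isCompact_unitSq

lemma parseval (i j : Fin 2) (hij : i ≠ j) (P Q : ℕ → ℝ → ℝ) (hPc : ∀ k, Continuous (P k))
    (hQc : ∀ k, Continuous (Q k)) (hP : ∀ k l, k ≠ l → ∫ y in (0:ℝ)..1, P k y * P l y = 0)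
    (hQ : ∀ k l, k ≠ l → ∫ y in (0:ℝ)..1, Q k y * Q l y = 0)
    (s : Finset (Fin 2 → ℕ)) (b : (Fin 2 → ℕ) → ℝ) :
    ∫ x in unitSq, (∑ k ∈ s, b k * (P (k i) (x i) * Q (k j) (x j))) ^ 2 =
      ∑ k ∈ s, b k ^ 2 * ((∫ y in (0:ℝ)..1, P (k i) y * P (k i) y) *
        ∫ y in (0:ℝ)..1, Q (k j) y * Q (k j) y) := by
  have hc : ∀ k l : Fin 2 → ℕ, Continuous fun x : E2 => b k * b l * ((P (k i) (x i) * P (l i) (x i)) *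
      (Q (k j) (x j) * Q (l j) (x j))) := by
    intro k l
    have h1 := hPc (k i)
    have h2 := hPc (l i)
    have h3 := hQc (k j)
    have h4 := hQc (l j)
    fun_prop
  have e : ∀ x : E2, (∑ k ∈ s, b k * (P (k i) (x i) * Q (k j) (x j))) ^ 2 =
      ∑ k ∈ s, ∑ l ∈ s, b k * b l * ((P (k i) (x i) * P (l i) (x i)) *
        (Q (k j) (x j) * Q (l j) (x j))) := by
    intro x
    rw [sq, Finset.sum_mul_sum]
    refine Finset.sum_congr rfl fun k _ => Finset.sum_congr rfl fun l _ => ?_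
    ring
  simp_rw [e]
  rw [integral_finsetSum _ fun k _ => integrable_finsetSum _ fun l _ => intOn (hc k l)]
  refine Finset.sum_congr rfl fun k hk => ?_
  rw [integral_finsetSum _ fun l _ => intOn (hc k l), Finset.sum_eq_single k]
  · rw [integral_const_mul, prod_integral i j hij (fun y => P (k i) y * P (k i) y)
      (fun y => Q (k j) y * Q (k j) y), sq]
  · intro l _ hlk
    rw [integral_const_mul, prod_integral i j hij (fun y => P (k i) y * P (l i) y)
      (fun y => Q (k j) y * Q (l j) y)]
    by_cases h1 : k i = l i
    · by_cases h2 : k j = l j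
      · exfalso
        apply hlk
        funext m
        fin_cases i <;> fin_cases j <;> fin_cases m <;> simp_all
      · rw [hQ _ _ h2]; simp
    · rw [hP _ _ h1]; simp
  · intro h; exact absurd hk h

/-- the trigonometric polynomial -/
def tp (s : Finset (Fin 2 → ℕ)) (a : (Fin 2 → ℕ) → ℝ) (x : E2) : ℝ :=
  ∑ k ∈ s, a k * (cs (k 0) (x 0) * cs (k 1) (x 1))

lemma tp_eq (i j : Fin 2) (hij : i ≠ j) (s : Finset (Fin 2 → ℕ)) (a : (Fin 2 → ℕ) → ℝ) (x : E2) :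
    tp s a x = ∑ k ∈ s, a k * (cs (k i) (x i) * cs (k j) (x j)) := by
  unfold tp
  refine Finset.sum_congr rfl fun k _ => ?_
  fin_cases i <;> fin_cases j <;> simp_all [mul_comm]

lemma continuous_tp (s : Finset (Fin 2 → ℕ)) (a : (Fin 2 → ℕ) → ℝ) : Continuous (tp s a) := by
  unfold tp cs; fun_prop

lemma bessel_le (i j : Fin 2) (hij : i ≠ j) (P Q : ℕ → ℝ → ℝ) (hPc : ∀ k, Continuous (P k))
    (hQc : ∀ k, Continuous (Q k)) (hP : ∀ k l, k ≠ l → ∫ y in (0:ℝ)..1, P k y * P l y = 0)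
    (hQ : ∀ k l, k ≠ l → ∫ y in (0:ℝ)..1, Q k y * Q l y = 0)
    (hPle : ∀ k, ∫ y in (0:ℝ)..1, P k y * P k y ≤ ∫ y in (0:ℝ)..1, cs k y * cs k y)
    (hQle : ∀ k, ∫ y in (0:ℝ)..1, Q k y * Q k y ≤ ∫ y in (0:ℝ)..1, cs k y * cs k y)
    (s : Finset (Fin 2 → ℕ)) (a b : (Fin 2 → ℕ) → ℝ) (hab : ∀ k, b k ^ 2 ≤ a k ^ 2) :
    ∫ x in unitSq, (∑ k ∈ s, b k * (P (k i) (x i) * Q (k j) (x j))) ^ 2 ≤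
      ∫ x in unitSq, (tp s a x) ^ 2 := by
  simp_rw [tp_eq i j hij]
  rw [parseval i j hij P Q hPc hQc hP hQ,
    parseval i j hij cs cs continuous_cs continuous_cs int_cs_cs int_cs_cs]
  refine Finset.sum_le_sum fun k _ => ?_
  have := int_sq_nonneg (P (k i))
  have := int_sq_nonneg (Q (k j))
  have := int_sq_nonneg (cs (k i))
  have := hPle (k i)
  have := hQle (k j)
  have := hab k
  gcongr

lemma int_tp (s : Finset (Fin 2 → ℕ)) (a : (Fin 2 → ℕ) → ℝ) (h0 : 0 ∈ s) :
    ∫ x in unitSq, tp s a x = a 0 := by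
  unfold tp
  have hc : ∀ k : Fin 2 → ℕ, Continuous fun x : E2 => a k * (cs (k 0) (x 0) * cs (k 1) (x 1)) := by
    intro k; unfold cs; fun_prop
  rw [integral_finsetSum _ fun k _ => intOn (hc k), Finset.sum_eq_single 0]
  · rw [integral_const_mul, prod_integral 0 1 (by decide)]
    simp [cs]
  · intro k _ hk
    rw [integral_const_mul, prod_integral 0 1 (by decide)]
    have hz : ∀ n : ℕ, n ≠ 0 → ∫ y in (0:ℝ)..1, cs n y = 0 := by
      intro n hn
      have := int_cos n (by exact_mod_cast hn)
      simpa [cs] using this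
    by_cases h1 : k 0 = 0
    · by_cases h2 : k 1 = 0
      · exfalso; apply hk; funext m; fin_cases m <;> simp_all
      · rw [hz _ h2]; simp
    · rw [hz _ h1]; simp
  · exact fun h => absurd h0 h


/-- basis functions on the square -/
def ek (k : Fin 2 → ℕ) : C(unitSq, ℝ) :=
  ⟨fun x => cs (k 0) (x.1 0) * cs (k 1) (x.1 1), by unfold cs; fun_prop⟩

lemma cs_mul' (k l : ℕ) (y : ℝ) : cs k y * cs l y =
    1 / 2 * cs ((k - l : ℤ).natAbs) y + 1 / 2 * cs (k + l) y := by
  rw [cs_mul]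
  have h1 : Real.cos (Real.pi * ((k - l : ℤ) : ℝ) * y) = cs ((k - l : ℤ).natAbs) y := by
    unfold cs
    rcases Int.natAbs_eq (k - l : ℤ) with h | h
    · conv_lhs => rw [h]
      simp
    · conv_lhs => rw [h]
      rw [← Real.cos_neg]
      rw [Int.cast_neg, Int.cast_natCast]
      congr 1
      ring
  rw [h1]
  simp [cs]

lemma ek_mul (k l : Fin 2 → ℕ) : ek k * ek l ∈ Submodule.span ℝ (Set.range ek) := by
  let d : Fin 2 → ℕ := fun m => (k m - l m : ℤ).natAbs
  let p : Fin 2 → ℕ := fun m => k m + l m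
  have : ek k * ek l = (1 / 4 : ℝ) • ek d + (1 / 4 : ℝ) • ek ![d 0, p 1] +
      (1 / 4 : ℝ) • ek ![p 0, d 1] + (1 / 4 : ℝ) • ek p := by
    ext x
    have h0 := cs_mul' (k 0) (l 0) (x.1 0)
    have h1 := cs_mul' (k 1) (l 1) (x.1 1)
    simp only [ek, ContinuousMap.mul_apply, ContinuousMap.coe_mk, ContinuousMap.add_apply,
      ContinuousMap.smul_apply, smul_eq_mul, Matrix.cons_val_zero, Matrix.cons_val_one, d, p]
    calc _ = (cs (k 0) (x.1 0) * cs (l 0) (x.1 0)) * (cs (k 1) (x.1 1) * cs (l 1) (x.1 1)) := by ring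
      _ = _ := by rw [h0, h1]; ring
  rw [this]
  have hm : ∀ q, (1 / 4 : ℝ) • ek q ∈ Submodule.span ℝ (Set.range ek) := fun q =>
    Submodule.smul_mem _ _ (Submodule.subset_span ⟨q, rfl⟩)
  exact Submodule.add_mem _ (Submodule.add_mem _ (Submodule.add_mem _ (hm _) (hm _)) (hm _)) (hm _)

lemma span_mul (x y : C(unitSq, ℝ)) (hx : x ∈ Submodule.span ℝ (Set.range ek))
    (hy : y ∈ Submodule.span ℝ (Set.range ek)) : x * y ∈ Submodule.span ℝ (Set.range ek) := by
  have h : Submodule.span ℝ (Set.range ek) * Submodule.span ℝ (Set.range ek) ≤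
      Submodule.span ℝ (Set.range ek) := by
    rw [Submodule.span_mul_span, Submodule.span_le]
    rintro _ ⟨_, ⟨k, rfl⟩, _, ⟨l, rfl⟩, rfl⟩
    exact ek_mul k l
  exact h (Submodule.mul_mem_mul hx hy)

lemma one_mem_ek : (1 : C(unitSq, ℝ)) ∈ Submodule.span ℝ (Set.range ek) := by
  refine Submodule.subset_span ⟨0, ?_⟩
  ext x
  simp [ek, cs]

lemma tp_dense (g : E2 → ℝ) (hg : Continuous g) (θ : ℝ) (hθ : 0 < θ) :
    ∃ (s : Finset (Fin 2 → ℕ)) (a : (Fin 2 → ℕ) → ℝ), 0 ∈ s ∧ ∀ x ∈ unitSq, |tp s a x - g x| ≤ θ := by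
  haveI : CompactSpace unitSq := isCompact_iff_compactSpace.mp isCompact_unitSq
  let Al : Subalgebra ℝ C(unitSq, ℝ) :=
    (Submodule.span ℝ (Set.range ek)).toSubalgebra one_mem_ek span_mul
  have hsep : Al.SeparatesPoints := by
    intro x y hxy
    have : ∃ i : Fin 2, x.1 i ≠ y.1 i := by
      by_contra! h
      apply hxy
      apply Subtype.ext
      ext i
      exact h i
    obtain ⟨i, hi⟩ := this
    have hne : cs 1 (x.1 i) ≠ cs 1 (y.1 i) := by
      intro h
      have hx := x.2 i
      have hy := y.2 i
      have hpi := Real.pi_pos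
      simp only [cs, Nat.cast_one, mul_one] at h
      have := Real.injOn_cos ⟨by nlinarith [hx.1], by nlinarith [hx.2]⟩
        ⟨by nlinarith [hy.1], by nlinarith [hy.2]⟩ h
      exact hi (mul_left_cancel₀ hpi.ne' this)
    refine ⟨ek (Pi.single i 1), ⟨ek (Pi.single i 1), Submodule.subset_span ⟨_, rfl⟩, rfl⟩, ?_⟩
    have hz : ∀ y, cs 0 y = 1 := fun y => by simp [cs]
    fin_cases i
    · simpa [ek, hz] using hne
    · simpa [ek, hz] using hne
  obtain ⟨⟨f, hf⟩, hfg⟩ := ContinuousMap.exists_mem_subalgebra_near_continuous_of_separatesPoints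
    Al hsep (fun x => g x.1) (by fun_prop) θ hθ
  have hf' : f ∈ Submodule.span ℝ (Set.range ek) := hf
  obtain ⟨c, hc⟩ := Finsupp.mem_span_range_iff_exists_finsupp.1 hf'
  refine ⟨insert 0 c.support, c, Finset.mem_insert_self _ _, fun x hx => ?_⟩
  have h1 := hfg ⟨x, hx⟩
  have h2 : f ⟨x, hx⟩ = tp (insert 0 c.support) c x := by
    rw [← hc, Finsupp.sum_of_support_subset c (Finset.subset_insert 0 c.support) _ (by simp)]
    simp [tp, ek, ContinuousMap.sum_apply]
  have h3 : |f ⟨x, hx⟩ - g x| < θ := h1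
  rw [h2] at h3
  exact h3.le

lemma vol_unitSq : (volume : Measure E2).real unitSq = 1 := by
  have := prod_integral 0 1 (by decide) (fun _ => 1) (fun _ => 1)
  simpa using this

lemma approx_tp (A : Set E2) (hA : A ⊆ unitSq) (hm : MeasurableSet A) (θ : ℝ) (hθ : 0 < θ) :
    ∃ (s : Finset (Fin 2 → ℕ)) (a : (Fin 2 → ℕ) → ℝ), 0 ∈ s ∧
      ∫ x in unitSq, (tp s a x - A.indicator 1 x) ^ 2 ≤ θ ^ 2 := by
  have hfin : volume A ≠ ⊤ := ((measure_mono hA).trans_lt isCompact_unitSq.measure_lt_top).ne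
  have hLp : MemLp (A.indicator (fun _ => (1:ℝ))) (ENNReal.ofReal 2) (volume : Measure E2) :=
    memLp_indicator_const _ hm _ (Or.inr hfin)
  obtain ⟨g, -, hg, hgc, hgL⟩ := hLp.exists_hasCompactSupport_integral_rpow_sub_le (p := 2)
    (by norm_num) (ε := θ ^ 2 / 4) (by positivity)
  obtain ⟨s, a, h0, hs⟩ := tp_dense g hgc (θ / 2) (by positivity)
  refine ⟨s, a, h0, ?_⟩
  have e : A.indicator (1 : E2 → ℝ) = A.indicator (fun _ => (1:ℝ)) := rfl
  rw [e]
  set F := A.indicator (fun _ : E2 => (1:ℝ)) with hF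
  have hIntg : Integrable (fun x => (F x - g x) ^ 2) (volume : Measure E2) := by
    have := (hLp.sub hgL).integrable_norm_rpow (by simp) (by simp)
    simpa using this
  simp only [Real.norm_eq_abs, Real.rpow_two, sq_abs] at hg
  have hpt : ∀ x ∈ unitSq, (tp s a x - F x) ^ 2 ≤ θ ^ 2 / 2 + 2 * (F x - g x) ^ 2 := by
    intro x hx
    have h1 := hs x hx
    have h2 : (tp s a x - g x) ^ 2 ≤ (θ / 2) ^ 2 := by
      rw [← sq_abs]; gcongr
    nlinarith [sq_nonneg ((tp s a x - g x) + (F x - g x))]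
  have hFm : Measurable F := measurable_const.indicator hm
  have hrhs : IntegrableOn (fun x => θ ^ 2 / 2 + 2 * (F x - g x) ^ 2) unitSq volume :=
    (intOn continuous_const).add (hIntg.integrableOn.const_mul 2)
  have hlhs : IntegrableOn (fun x => (tp s a x - F x) ^ 2) unitSq volume := by
    refine Integrable.mono' hrhs ?_ ?_
    · exact (((continuous_tp s a).measurable.sub hFm).pow_const 2).aestronglyMeasurable
    · refine (ae_restrict_iff' isClosed_unitSq.measurableSet).2 (Filter.Eventually.of_forall fun x hx => ?_)
      rw [Real.norm_of_nonneg (sq_nonneg _)]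
      exact hpt x hx
  calc _ ≤ ∫ x in unitSq, (θ ^ 2 / 2 + 2 * (F x - g x) ^ 2) :=
        setIntegral_mono_on hlhs hrhs isClosed_unitSq.measurableSet hpt
    _ = θ ^ 2 / 2 + 2 * ∫ x in unitSq, (F x - g x) ^ 2 := by
        rw [integral_add (intOn continuous_const) (hIntg.integrableOn.const_mul 2), integral_const_mul,
          setIntegral_const, vol_unitSq]
        simp
    _ ≤ θ ^ 2 / 2 + 2 * ∫ x, (F x - g x) ^ 2 := by
        gcongr
        · exact Filter.Eventually.of_forall fun x => sq_nonneg _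
        · exact Measure.restrict_le_self
    _ ≤ θ ^ 2 := by linarith

/-- the coefficient `k_i ^ 2 / |k| ^ 2` sum -/
def Hf (i j : Fin 2) (s : Finset (Fin 2 → ℕ)) (a : (Fin 2 → ℕ) → ℝ) (x : E2) : ℝ :=
  ∑ k ∈ s, (a k * ((k i : ℝ) ^ 2 / ((k i : ℝ) ^ 2 + (k j : ℝ) ^ 2))) *
    (cs (k i) (x i) * cs (k j) (x j))

/-- the mixed part of the derivative -/
def Mf (i j : Fin 2) (s : Finset (Fin 2 → ℕ)) (a : (Fin 2 → ℕ) → ℝ) (x : E2) : ℝ :=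
  ∑ k ∈ s, (a k * ((k i : ℝ) * (k j : ℝ) / ((k i : ℝ) ^ 2 + (k j : ℝ) ^ 2))) *
    (sn (k i) (x i) * sn (k j) (x j))

/-- the potential -/
def Vf (i j : Fin 2) (s : Finset (Fin 2 → ℕ)) (a : (Fin 2 → ℕ) → ℝ) (x : E2) : ℝ :=
  ∑ k ∈ s, (a k * ((k i : ℝ) / (Real.pi * ((k i : ℝ) ^ 2 + (k j : ℝ) ^ 2)))) *
    (sn (k i) (x i) * cs (k j) (x j))

lemma sq_coef (a c : ℝ) (h0 : 0 ≤ c) (h1 : c ≤ 1) : (a * c) ^ 2 ≤ a ^ 2 := by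
  rw [mul_pow]
  exact mul_le_of_le_one_right (sq_nonneg a) (pow_le_one₀ h0 h1)

lemma Hf_le (i j : Fin 2) (hij : i ≠ j) (s : Finset (Fin 2 → ℕ)) (a : (Fin 2 → ℕ) → ℝ) :
    ∫ x in unitSq, (Hf i j s a x) ^ 2 ≤ ∫ x in unitSq, (tp s a x) ^ 2 := by
  refine bessel_le i j hij cs cs continuous_cs continuous_cs int_cs_cs int_cs_cs
    (fun _ => le_rfl) (fun _ => le_rfl) s a _ fun k => sq_coef _ _ (by positivity) ?_
  exact div_le_one_of_le₀ (by nlinarith [sq_nonneg (k j : ℝ)]) (by positivity)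

lemma Mf_le (i j : Fin 2) (hij : i ≠ j) (s : Finset (Fin 2 → ℕ)) (a : (Fin 2 → ℕ) → ℝ) :
    ∫ x in unitSq, (Mf i j s a x) ^ 2 ≤ ∫ x in unitSq, (tp s a x) ^ 2 := by
  refine bessel_le i j hij sn sn continuous_sn continuous_sn int_sn_sn int_sn_sn
    int_sn_le int_sn_le s a _ fun k => sq_coef _ _ (by positivity) ?_
  have h := sq_nonneg ((k i : ℝ) - k j)
  have h' : 0 ≤ (k i : ℝ) * k j := by positivity
  exact div_le_one_of_le₀ (by nlinarith) (by positivity)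

lemma Vf_le (i j : Fin 2) (hij : i ≠ j) (s : Finset (Fin 2 → ℕ)) (a : (Fin 2 → ℕ) → ℝ) :
    ∫ x in unitSq, (Vf i j s a x) ^ 2 ≤ ∫ x in unitSq, (tp s a x) ^ 2 := by
  refine bessel_le i j hij sn cs continuous_sn continuous_cs int_sn_sn int_cs_cs
    int_sn_le (fun _ => le_rfl) s a _ fun k => sq_coef _ _ (by have := Real.pi_pos; positivity) ?_
  have hpi := Real.pi_gt_three
  have h1 : (k i : ℝ) ≤ (k i : ℝ) ^ 2 := by
    have : k i ≤ k i ^ 2 := Nat.le_self_pow (by norm_num) _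
    exact_mod_cast this
  exact div_le_one_of_le₀ (by nlinarith [sq_nonneg ((k i : ℝ)), sq_nonneg (k j : ℝ)]) (by positivity)

lemma Hf_add (s : Finset (Fin 2 → ℕ)) (a : (Fin 2 → ℕ) → ℝ) (h0 : 0 ∈ s) (x : E2) :
    Hf 0 1 s a x + Hf 1 0 s a x = tp s a x - a 0 := by
  have e : a 0 = ∑ k ∈ s, if k = 0 then a k else 0 := by
    rw [Finset.sum_ite_eq' s 0 a]; simp [h0]
  unfold Hf tp
  rw [e, ← Finset.sum_add_distrib, ← Finset.sum_sub_distrib]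
  refine Finset.sum_congr rfl fun k _ => ?_
  by_cases hk : k = 0
  · subst hk
    simp [cs]
  · have hne : (k 0 : ℝ) ^ 2 + (k 1 : ℝ) ^ 2 ≠ 0 := by
      intro h
      apply hk
      have h1 : (k 0 : ℝ) = 0 := by nlinarith [sq_nonneg (k 0 : ℝ), sq_nonneg (k 1 : ℝ)]
      have h2 : (k 1 : ℝ) = 0 := by nlinarith [sq_nonneg (k 0 : ℝ), sq_nonneg (k 1 : ℝ)]
      funext m
      fin_cases m
      · simpa using h1
      · simpa using h2
    have hne' : (k 1 : ℝ) ^ 2 + (k 0 : ℝ) ^ 2 ≠ 0 := by rwa [add_comm]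
    rw [if_neg hk]
    field_simp
    ring

lemma hasDerivAt_sn (k : ℕ) (y : ℝ) : HasDerivAt (sn k) (Real.pi * k * cs k y) y := by
  have := ((hasDerivAt_id y).const_mul (Real.pi * k)).sin
  have h2 : HasDerivAt (sn k) _ y := this
  refine h2.congr_deriv ?_
  simp [cs]; ring

lemma hasDerivAt_cs (k : ℕ) (y : ℝ) : HasDerivAt (cs k) (-(Real.pi * k * sn k y)) y := by
  have := ((hasDerivAt_id y).const_mul (Real.pi * k)).cos
  have h2 : HasDerivAt (cs k) _ y := this
  refine h2.congr_deriv ?_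
  simp [sn]; ring

lemma hasFDerivAt_Vf (i j : Fin 2) (s : Finset (Fin 2 → ℕ)) (a : (Fin 2 → ℕ) → ℝ)
    (x : E2) : HasFDerivAt (Vf i j s a)
      (Hf i j s a x • (EuclideanSpace.proj i : E2 →L[ℝ] ℝ) - Mf i j s a x •
        (EuclideanSpace.proj j : E2 →L[ℝ] ℝ)) x := by
  unfold Vf Hf Mf
  rw [Finset.sum_smul, Finset.sum_smul, ← Finset.sum_sub_distrib]
  refine HasFDerivAt.fun_sum fun k _ => ?_
  have hi : HasFDerivAt (fun x : E2 => x i) (EuclideanSpace.proj i : E2 →L[ℝ] ℝ) x :=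
    (EuclideanSpace.proj i : E2 →L[ℝ] ℝ).hasFDerivAt
  have hj : HasFDerivAt (fun x : E2 => x j) (EuclideanSpace.proj j : E2 →L[ℝ] ℝ) x :=
    (EuclideanSpace.proj j : E2 →L[ℝ] ℝ).hasFDerivAt
  have h1 := (hasDerivAt_sn (k i) (x i)).comp_hasFDerivAt x hi
  have h2 := (hasDerivAt_cs (k j) (x j)).comp_hasFDerivAt x hj
  have h3 := (h1.mul h2).const_mul
    (a k * ((k i : ℝ) / (Real.pi * ((k i : ℝ) ^ 2 + (k j : ℝ) ^ 2))))
  refine h3.congr_fderiv ?_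
  have hpi := Real.pi_ne_zero
  have c1 : (a k * ((k i : ℝ) / (Real.pi * ((k i : ℝ) ^ 2 + (k j : ℝ) ^ 2)))) * (Real.pi * k i) =
      a k * ((k i : ℝ) ^ 2 / ((k i : ℝ) ^ 2 + (k j : ℝ) ^ 2)) := by
    rw [← div_div]
    have : (k i : ℝ) / Real.pi * Real.pi = k i := div_mul_cancel₀ _ hpi
    calc _ = a k * (k i * ((k i : ℝ) / Real.pi * Real.pi)) / ((k i : ℝ) ^ 2 + (k j : ℝ) ^ 2) := by ring
      _ = _ := by rw [this]; ring
  have c2 : (a k * ((k i : ℝ) / (Real.pi * ((k i : ℝ) ^ 2 + (k j : ℝ) ^ 2)))) * (Real.pi * k j) =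
      a k * ((k i : ℝ) * (k j : ℝ) / ((k i : ℝ) ^ 2 + (k j : ℝ) ^ 2)) := by
    rw [← div_div]
    have : (k i : ℝ) / Real.pi * Real.pi = k i := div_mul_cancel₀ _ hpi
    calc _ = a k * (k j * ((k i : ℝ) / Real.pi * Real.pi)) / ((k i : ℝ) ^ 2 + (k j : ℝ) ^ 2) := by ring
      _ = _ := by rw [this]; ring
  rw [← c1, ← c2]
  simp only [Function.comp_apply]
  module

lemma contDiff_Vf (i j : Fin 2) (s : Finset (Fin 2 → ℕ)) (a : (Fin 2 → ℕ) → ℝ) :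
    ContDiff ℝ 1 (Vf i j s a) := by
  unfold Vf sn cs
  fun_prop

lemma continuous_Hf (i j : Fin 2) (s : Finset (Fin 2 → ℕ)) (a : (Fin 2 → ℕ) → ℝ) :
    Continuous (Hf i j s a) := by
  unfold Hf cs
  fun_prop

lemma continuous_Mf (i j : Fin 2) (s : Finset (Fin 2 → ℕ)) (a : (Fin 2 → ℕ) → ℝ) :
    Continuous (Mf i j s a) := by
  unfold Mf sn
  fun_prop

/-- the cutoff defect -/
def psi (n : ℕ) (y : ℝ) : ℝ := (2 * y - 1) ^ (2 * n)

lemma hasDerivAt_psi (n : ℕ) (y : ℝ) :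
    HasDerivAt (psi n) (4 * n * (2 * y - 1) ^ (2 * n - 1)) y := by
  have := (((hasDerivAt_id y).const_mul 2).sub_const 1).pow (2 * n)
  refine this.congr_deriv ?_
  simp
  ring

lemma psi_mem (n : ℕ) (y : ℝ) (hy : y ∈ Set.Icc (0:ℝ) 1) : psi n y ∈ Set.Icc (0:ℝ) 1 := by
  unfold psi
  rw [pow_mul]
  exact ⟨by positivity, pow_le_one₀ (sq_nonneg _) (by nlinarith [hy.1, hy.2])⟩

lemma int_psi (n : ℕ) : ∫ y in (0:ℝ)..1, psi n y ^ 2 = 1 / (4 * n + 1) := by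
  have e : ∀ y, psi n y ^ 2 = (fun z : ℝ => z ^ (4 * n)) (2 * y - 1) := by
    intro y
    simp only [psi]
    rw [← pow_mul]
    ring_nf
  simp_rw [e]
  rw [intervalIntegral.integral_comp_mul_sub (fun z : ℝ => z ^ (4 * n)) (by norm_num), integral_pow]
  have h1 : (2 * (0:ℝ) - 1) ^ (4 * n + 1) = -1 := by
    rw [pow_succ, pow_mul]; norm_num
  rw [h1]
  push_cast
  have : (4 * (n:ℝ) + 1) ≠ 0 := by positivity
  simp
  field_simp
  norm_num

/-- the test function -/
def Uf (n : ℕ) (i j : Fin 2) (s : Finset (Fin 2 → ℕ)) (a : (Fin 2 → ℕ) → ℝ) (x : E2) : ℝ :=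
  Vf i j s a x * (1 - psi n (x j))

lemma contDiff_Uf (n : ℕ) (i j : Fin 2) (s : Finset (Fin 2 → ℕ)) (a : (Fin 2 → ℕ) → ℝ) :
    ContDiff ℝ 1 (Uf n i j s a) := by
  have := contDiff_Vf i j s a
  unfold Uf psi
  fun_prop

lemma fderiv_Uf (n : ℕ) (i j : Fin 2) (s : Finset (Fin 2 → ℕ)) (a : (Fin 2 → ℕ) → ℝ) (x : E2) :
    fderiv ℝ (Uf n i j s a) x = ((1 - psi n (x j)) * Hf i j s a x) •
      (EuclideanSpace.proj i : E2 →L[ℝ] ℝ) - ((1 - psi n (x j)) * Mf i j s a x +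
        Vf i j s a x * (4 * n * (2 * x j - 1) ^ (2 * n - 1))) •
        (EuclideanSpace.proj j : E2 →L[ℝ] ℝ) := by
  have hj : HasFDerivAt (fun x : E2 => x j) (EuclideanSpace.proj j : E2 →L[ℝ] ℝ) x :=
    (EuclideanSpace.proj j : E2 →L[ℝ] ℝ).hasFDerivAt
  have h1 := ((hasDerivAt_psi n (x j)).comp_hasFDerivAt x hj).const_sub 1
  have h2 := (hasFDerivAt_Vf i j s a x).mul h1
  have h3 : HasFDerivAt (Uf n i j s a) _ x := h2
  rw [h3.fderiv]
  simp only [Function.comp_apply]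
  module

lemma Uf_bdry (n : ℕ) (i j : Fin 2) (hij : i ≠ j) (s : Finset (Fin 2 → ℕ))
    (a : (Fin 2 → ℕ) → ℝ) (x : E2) (hx : x ∈ unitSqBdry) : Uf n i j s a x = 0 := by
  obtain ⟨-, m, hm⟩ := hx
  have hmm : m = i ∨ m = j := by
    fin_cases i <;> fin_cases j <;> fin_cases m <;> simp_all
  unfold Uf
  rcases hmm with rfl | rfl
  · have : ∀ k, sn k (x m) = 0 := by
      intro k
      rcases hm with h | h
      · simp [sn, h]
      · rw [h, sn, mul_one, mul_comm]; exact Real.sin_nat_mul_pi k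
    simp [Vf, this]
  · have : psi n (x m) = 1 := by
      rcases hm with h | h
      · rw [h, psi, pow_mul]; norm_num
      · rw [h, psi]; norm_num
    simp [this]

lemma norm_proj_le (i : Fin 2) : ‖(EuclideanSpace.proj i : E2 →L[ℝ] ℝ)‖ ≤ 1 :=
  ContinuousLinearMap.opNorm_le_bound _ zero_le_one fun x => by
    simpa using PiLp.norm_apply_le x i

lemma norm_fderiv_Uf (n : ℕ) (i j : Fin 2) (s : Finset (Fin 2 → ℕ)) (a : (Fin 2 → ℕ) → ℝ) (x : E2)
    (hx : x ∈ unitSq) : ‖fderiv ℝ (Uf n i j s a) x‖ ≤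
      |Hf i j s a x| + |Mf i j s a x| + 4 * n * |Vf i j s a x| := by
  rw [fderiv_Uf]
  have hp := psi_mem n (x j) (hx j)
  have hc : |1 - psi n (x j)| ≤ 1 := by rw [abs_le]; constructor <;> linarith [hp.1, hp.2]
  have hd : |(2 * x j - 1) ^ (2 * n - 1)| ≤ 1 := by
    rw [abs_pow]
    refine pow_le_one₀ (abs_nonneg _) ?_
    rw [abs_le]; constructor <;> linarith [(hx j).1, (hx j).2]
  have hs : ∀ (c : ℝ) (m : Fin 2), ‖c • (EuclideanSpace.proj m : E2 →L[ℝ] ℝ)‖ ≤ |c| := by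
    intro c m
    rw [norm_smul, Real.norm_eq_abs]
    exact mul_le_of_le_one_right (abs_nonneg _) (norm_proj_le m)
  refine (norm_sub_le _ _).trans ((add_le_add (hs _ _) (hs _ _)).trans ?_)
  rw [add_assoc]
  refine add_le_add ?_ ((abs_add_le _ _).trans (add_le_add ?_ ?_))
  · rw [abs_mul]; exact mul_le_of_le_one_left (abs_nonneg _) hc
  · rw [abs_mul]; exact mul_le_of_le_one_left (abs_nonneg _) hc
  · rw [abs_mul, abs_mul, abs_of_nonneg (by positivity : (0:ℝ) ≤ 4 * n), mul_comm]
    refine mul_le_mul_of_nonneg_right ?_ (abs_nonneg _)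
    exact mul_le_of_le_one_right (by positivity) hd

lemma ug_Uf (n : ℕ) (i j : Fin 2) (hij : i ≠ j) (s : Finset (Fin 2 → ℕ)) (a : (Fin 2 → ℕ) → ℝ) :
    ∫⁻ z, ug (Uf n i j s a) z ^ 2 ≤
      ENNReal.ofReal (3 * (2 + 16 * n ^ 2) * ∫ x in unitSq, (tp s a x) ^ 2) := by
  have hH := continuous_Hf i j s a
  have hM := continuous_Mf i j s a
  have hV := (contDiff_Vf i j s a).continuous
  let B : E2 → ℝ := fun x => 3 * (Hf i j s a x ^ 2 + Mf i j s a x ^ 2 + 16 * n ^ 2 * Vf i j s a x ^ 2)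
  have hB : Continuous B := by fun_prop
  have h1 : ∀ z, ug (Uf n i j s a) z ^ 2 ≤ unitSq.indicator (fun z => ENNReal.ofReal (B z)) z := by
    intro z
    unfold ug
    by_cases hz : z ∈ unitSq
    · rw [Set.indicator_of_mem hz, Set.indicator_of_mem hz, ← ofReal_norm,
        ← ENNReal.ofReal_pow (norm_nonneg _)]
      apply ENNReal.ofReal_le_ofReal
      have h2 := norm_fderiv_Uf n i j s a z hz
      have h3 : ‖fderiv ℝ (Uf n i j s a) z‖ ^ 2 ≤
        (|Hf i j s a z| + |Mf i j s a z| + 4 * n * |Vf i j s a z|) ^ 2 := by gcongr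
      refine h3.trans ?_
      simp only [B]
      rw [← sq_abs (Hf i j s a z), ← sq_abs (Mf i j s a z), ← sq_abs (Vf i j s a z)]
      generalize |Hf i j s a z| = p
      generalize |Mf i j s a z| = q
      generalize |Vf i j s a z| = r
      nlinarith [sq_nonneg (p - q), sq_nonneg (p - 4 * n * r), sq_nonneg (q - 4 * n * r)]
    · simp [hz]
  calc _ ≤ ∫⁻ z, unitSq.indicator (fun z => ENNReal.ofReal (B z)) z := lintegral_mono h1
    _ = ∫⁻ z in unitSq, ENNReal.ofReal (B z) := lintegral_indicator isClosed_unitSq.measurableSet _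
    _ = ENNReal.ofReal (∫ z in unitSq, B z) := by
        rw [ofReal_integral_eq_lintegral_ofReal (intOn hB)
          (Filter.Eventually.of_forall fun x => by simp only [B, Pi.zero_apply]; positivity)]
    _ ≤ _ := by
        apply ENNReal.ofReal_le_ofReal
        simp only [B]
        rw [integral_const_mul, integral_add (intOn (by fun_prop)) (intOn (by fun_prop)),
          integral_add (intOn (by fun_prop)) (intOn (by fun_prop)), integral_const_mul]
        have := Hf_le i j hij s a
        have := Mf_le i j hij s a
        have h4 := mul_le_mul_of_nonneg_left (Vf_le i j hij s a)
          (by positivity : (0:ℝ) ≤ 16 * n ^ 2)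
        nlinarith

lemma fderiv_Uf_single (n : ℕ) (i j : Fin 2) (hij : i ≠ j) (s : Finset (Fin 2 → ℕ))
    (a : (Fin 2 → ℕ) → ℝ) (x : E2) :
    fderiv ℝ (Uf n i j s a) x (EuclideanSpace.single i 1) =
      Hf i j s a x - psi n (x j) * Hf i j s a x := by
  rw [fderiv_Uf]
  simp [hij.symm]
  ring

lemma err_bound (n : ℕ) (i j : Fin 2) (hij : i ≠ j) (s : Finset (Fin 2 → ℕ))
    (a : (Fin 2 → ℕ) → ℝ) (A : Set E2) (hA : A ⊆ unitSq) (τ : ℝ) (hτ : 0 < τ) :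
    ∫ x in A, psi n (x j) * Hf i j s a x ≤
      τ * (∫ x in unitSq, (tp s a x) ^ 2) + τ⁻¹ * (1 / (4 * n + 1)) := by
  have hH := continuous_Hf i j s a
  have hpsi : Continuous (psi n) := by unfold psi; fun_prop
  have hpt : ∀ x : E2, psi n (x j) * Hf i j s a x ≤
      τ * (Hf i j s a x) ^ 2 + τ⁻¹ * psi n (x j) ^ 2 := by
    intro x
    have h1 : τ * τ⁻¹ = 1 := mul_inv_cancel₀ hτ.ne'
    have h2 : 0 < τ⁻¹ := inv_pos.2 hτ
    generalize psi n (x j) = p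
    generalize Hf i j s a x = q
    have h3 : τ * q ^ 2 + τ⁻¹ * p ^ 2 - 2 * (p * q) = τ⁻¹ * (p - τ * q) ^ 2 := by
      field_simp; ring
    have h4 : 0 ≤ τ⁻¹ * (p - τ * q) ^ 2 := by positivity
    have h5 : 0 ≤ τ * q ^ 2 + τ⁻¹ * p ^ 2 := by positivity
    linarith
  have hIntg : IntegrableOn (fun x : E2 => τ * (Hf i j s a x) ^ 2 + τ⁻¹ * psi n (x j) ^ 2) unitSq
    volume := intOn (by fun_prop)
  calc _ ≤ ∫ x in A, (τ * (Hf i j s a x) ^ 2 + τ⁻¹ * psi n (x j) ^ 2) :=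
        setIntegral_mono ((intOn (by fun_prop)).mono_set hA) (hIntg.mono_set hA) hpt
    _ ≤ ∫ x in unitSq, (τ * (Hf i j s a x) ^ 2 + τ⁻¹ * psi n (x j) ^ 2) :=
        setIntegral_mono_set hIntg (Filter.Eventually.of_forall fun x => by
          simp only [Pi.zero_apply]; positivity) hA.eventuallyLE
    _ = τ * (∫ x in unitSq, (Hf i j s a x) ^ 2) + τ⁻¹ * (1 / (4 * n + 1)) := by
        rw [integral_add (intOn (by fun_prop)) (intOn (by fun_prop)), integral_const_mul,
          integral_const_mul]
        have := prod_integral i j hij (fun _ => 1) (fun y => psi n y ^ 2)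
        simp only [one_mul, int_psi] at this
        rw [this]
        simp
    _ ≤ _ := by
        have := Hf_le i j hij s a
        gcongr

lemma gain (m : ℝ) (hm0 : 0 < m) (hm1 : m ≤ 1) (n : ℕ) (hn : 1024 / m ^ 2 ≤ 4 * n + 1)
    (A : Set E2) (hA : A ⊆ unitSq) (hAm : MeasurableSet A)
    (hm : m ≤ volume.real A * (1 - volume.real A)) :
    ∃ (u : E2 → ℝ) (i : Fin 2), ContDiff ℝ 1 u ∧ (∀ x ∈ unitSqBdry, u x = 0) ∧
      ∫⁻ z, ug u z ^ 2 ≤ ENNReal.ofReal (3 * (2 + 16 * n ^ 2) * 4) ∧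
      m / 4 ≤ ∫ x in A, fderiv ℝ u x (EuclideanSpace.single i 1) := by
  obtain ⟨s, a, h0, hs⟩ := approx_tp A hA hAm (m / 8) (by positivity)
  set θ := m / 8 with hθ
  have hθ0 : 0 < θ := by positivity
  set N := ∫ x in unitSq, (tp s a x) ^ 2 with hN
  set v := volume.real A with hv
  have hSm := isClosed_unitSq.measurableSet
  set F : E2 → ℝ := A.indicator 1 with hF
  have hv1 : v ≤ 1 := by
    rw [← vol_unitSq]
    exact measureReal_mono hA isCompact_unitSq.measure_ne_top
  have hv0 : 0 ≤ v := measureReal_nonneg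
  have hFm : Measurable F := measurable_const.indicator hAm
  have hFi : IntegrableOn F unitSq volume := by
    have : IntegrableOn (fun _ : E2 => (1:ℝ)) unitSq volume := intOn continuous_const
    exact this.indicator hAm
  have htp := continuous_tp s a
  have hF2 : ∀ x, F x ^ 2 = F x := by
    intro x
    by_cases hx : x ∈ A <;> simp [hF, hx]
  have hFint : ∫ x in unitSq, F x = v := by
    rw [hF, integral_indicator_one hAm, measureReal_restrict_apply hAm, Set.inter_eq_left.2 hA]
  have htF : IntegrableOn (fun x => tp s a x * F x) unitSq volume := by
    have : IntegrableOn (A.indicator (tp s a)) unitSq volume := (intOn htp).indicator hAm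
    refine this.congr (Filter.Eventually.of_forall fun x => ?_)
    by_cases hx : x ∈ A <;> simp [hF, hx]
  have hdi : IntegrableOn (fun x => (tp s a x - F x) ^ 2) unitSq volume := by
    have : IntegrableOn (fun x => (tp s a x) ^ 2 - 2 * (tp s a x * F x) + F x) unitSq volume :=
      ((intOn (htp.pow 2)).sub (htF.const_mul 2)).add hFi
    refine this.congr (Filter.Eventually.of_forall fun x => ?_)
    have := hF2 x
    simp only
    linear_combination -this
  have hgi : IntegrableOn (fun x => tp s a x - F x) unitSq volume := (intOn htp).sub hFi
  -- L1 bound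
  have hL1 : ∫ x in unitSq, |tp s a x - F x| ≤ θ := by
    have hr : IntegrableOn (fun x => θ / 2 + (2 * θ)⁻¹ * (tp s a x - F x) ^ 2) unitSq volume :=
      (intOn continuous_const).add (hdi.const_mul _)
    calc _ ≤ ∫ x in unitSq, (θ / 2 + (2 * θ)⁻¹ * (tp s a x - F x) ^ 2) := by
          refine setIntegral_mono hgi.abs hr fun x => ?_
          simp only
          rw [← sq_abs]
          generalize |tp s a x - F x| = q
          have : θ / 2 + (2 * θ)⁻¹ * q ^ 2 - q = (2 * θ)⁻¹ * (q - θ) ^ 2 := by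
            field_simp; ring
          have : 0 ≤ (2 * θ)⁻¹ * (q - θ) ^ 2 := by positivity
          linarith
      _ = θ / 2 + (2 * θ)⁻¹ * ∫ x in unitSq, (tp s a x - F x) ^ 2 := by
          rw [integral_add (intOn continuous_const) (hdi.const_mul _), integral_const_mul,
            setIntegral_const, vol_unitSq]
          simp
      _ ≤ θ / 2 + (2 * θ)⁻¹ * θ ^ 2 := by gcongr
      _ = θ := by field_simp; ring
  have ha0 : a 0 ≤ v + θ := by
    have h1 : ∫ x in unitSq, (tp s a x - F x) = a 0 - v := by
      rw [integral_sub (intOn htp) hFi, int_tp s a h0, hFint]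
    have h2 : ∫ x in unitSq, (tp s a x - F x) ≤ ∫ x in unitSq, |tp s a x - F x| :=
      setIntegral_mono hgi hgi.abs fun x => le_abs_self _
    linarith
  have htA : IntegrableOn (tp s a) A volume := (intOn htp).mono_set hA
  have hAfin : volume A ≠ ⊤ := ((measure_mono hA).trans_lt isCompact_unitSq.measure_lt_top).ne
  have hc : ∀ c : ℝ, IntegrableOn (fun _ : E2 => c) A volume := fun c =>
    IntegrableOn.mono_set (intOn continuous_const) hA
  have hAt : v - θ ≤ ∫ x in A, tp s a x := by
    have h1 : v - ∫ x in A, tp s a x = ∫ x in A, (1 - tp s a x) := by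
      rw [integral_sub (hc 1) htA, setIntegral_const]; simp [hv]
    have h2 : ∫ x in A, (1 - tp s a x) ≤ ∫ x in A, |tp s a x - F x| := by
      refine setIntegral_mono_on ((hc 1).sub htA) (IntegrableOn.mono_set hgi.abs hA) hAm fun x hx => ?_
      have : F x = 1 := by simp [hF, hx]
      rw [this, abs_sub_comm]
      exact le_abs_self _
    have h3 : ∫ x in A, |tp s a x - F x| ≤ ∫ x in unitSq, |tp s a x - F x| :=
      setIntegral_mono_set hgi.abs (Filter.Eventually.of_forall fun x => abs_nonneg _)
        hA.eventuallyLE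
    linarith
  have hN4 : N ≤ 4 := by
    have h1 : N ≤ ∫ x in unitSq, (2 * (tp s a x - F x) ^ 2 + 2 * F x) := by
      refine setIntegral_mono (intOn (htp.pow 2)) ((hdi.const_mul 2).add (hFi.const_mul 2)) fun x => ?_
      have := hF2 x
      simp only
      nlinarith [sq_nonneg (tp s a x - F x - F x)]
    rw [integral_add (hdi.const_mul 2) (hFi.const_mul 2), integral_const_mul, integral_const_mul,
      hFint] at h1
    have : θ ^ 2 ≤ 1 := pow_le_one₀ hθ0.le (by linarith)
    linarith
  have hN0 : 0 ≤ N := integral_nonneg fun x => sq_nonneg _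
  have hHA : ∀ i j : Fin 2, IntegrableOn (Hf i j s a) A volume := fun i j =>
    (intOn (continuous_Hf i j s a)).mono_set hA
  have hpH : ∀ i j : Fin 2, IntegrableOn (fun x => psi n (x j) * Hf i j s a x) A volume := by
    intro i j
    have := continuous_Hf i j s a
    refine (intOn ?_).mono_set hA
    unfold psi
    fun_prop
  have herr : ∀ i j : Fin 2, i ≠ j → ∫ x in A, psi n (x j) * Hf i j s a x ≤ m / 8 := by
    intro i j hij
    have h1 := err_bound n i j hij s a A hA (m / 64) (by positivity)
    have h2 : (m / 64)⁻¹ * (1 / (4 * n + 1)) ≤ m / 16 := by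
      have h3 : 1024 ≤ (4 * (n:ℝ) + 1) * m ^ 2 := by
        rwa [div_le_iff₀ (by positivity)] at hn
      have h4 : (0:ℝ) < 4 * n + 1 := by positivity
      rw [inv_div, div_mul_div_comm, div_le_div_iff₀ (by positivity) (by norm_num)]
      nlinarith
    have h5 : m / 64 * N ≤ m / 64 * 4 := by gcongr
    linarith
  have hval : ∀ i j : Fin 2, i ≠ j →
      ∫ x in A, fderiv ℝ (Uf n i j s a) x (EuclideanSpace.single i 1) =
        (∫ x in A, Hf i j s a x) - ∫ x in A, psi n (x j) * Hf i j s a x := by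
    intro i j hij
    simp_rw [fderiv_Uf_single n i j hij]
    exact integral_sub (hHA i j) (hpH i j)
  have hsum : (∫ x in A, Hf 0 1 s a x) + ∫ x in A, Hf 1 0 s a x =
      (∫ x in A, tp s a x) - v * a 0 := by
    rw [← integral_add (hHA 0 1) (hHA 1 0)]
    simp_rw [Hf_add s a h0]
    rw [integral_sub htA (hc _), setIntegral_const]
    simp [hv]
  have hva : v * a 0 ≤ v * v + θ := by
    have : v * a 0 ≤ v * (v + θ) := by gcongr
    nlinarith
  have hug : ∀ i j : Fin 2, i ≠ j → ∫⁻ z, ug (Uf n i j s a) z ^ 2 ≤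
      ENNReal.ofReal (3 * (2 + 16 * n ^ 2) * 4) := by
    intro i j hij
    refine (ug_Uf n i j hij s a).trans (ENNReal.ofReal_le_ofReal ?_)
    gcongr
  have e1 := hval 0 1 (by decide)
  have e2 := hval 1 0 (by decide)
  have f1 := herr 0 1 (by decide)
  have f2 := herr 1 0 (by decide)
  by_cases hcase : m / 4 ≤ ∫ x in A, fderiv ℝ (Uf n 0 1 s a) x (EuclideanSpace.single 0 1)
  · exact ⟨Uf n 0 1 s a, 0, contDiff_Uf n 0 1 s a, Uf_bdry n 0 1 (by decide) s a,
      hug 0 1 (by decide), hcase⟩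
  · refine ⟨Uf n 1 0 s a, 1, contDiff_Uf n 1 0 s a, Uf_bdry n 1 0 (by decide) s a,
      hug 1 0 (by decide), ?_⟩
    push Not at hcase
    nlinarith

theorem stmt_1 (γ γ' η : ℝ) (hγ : 0 < γ) (hγγ' : γ < 1 - γ') (hγ' : 1 - γ' < 1)
    (hη : 0 < η) :
    ∃ ε : ℝ, 0 < ε ∧
      ∀ A : Set (EuclideanSpace ℝ (Fin 2)), A ⊆ unitSq → MeasurableSet A →
        ENNReal.ofReal γ ≤ volume A → volume A ≤ ENNReal.ofReal (1 - γ') →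
        ∃ φ : EuclideanSpace ℝ (Fin 2) → EuclideanSpace ℝ (Fin 2),
          Set.BijOn φ unitSq unitSq ∧
          (∀ x ∈ unitSq, ∀ y ∈ unitSq,
            (1 + η)⁻¹ * ‖x - y‖ ≤ ‖φ x - φ y‖ ∧ ‖φ x - φ y‖ ≤ (1 + η) * ‖x - y‖) ∧
          (∀ x ∈ unitSqBdry, φ x = x) ∧
          volume A + ENNReal.ofReal ε ≤ volume (φ '' A) := by
  have hγp : 0 < γ' := by linarith
  have hm0 : 0 < γ * γ' := mul_pos hγ hγp
  have hm1 : γ * γ' ≤ 1 := by nlinarith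
  obtain ⟨n, hn⟩ := exists_nat_ge (1024 / (γ * γ') ^ 2)
  have hn' : 1024 / (γ * γ') ^ 2 ≤ 4 * (n:ℝ) + 1 := by
    have : (0:ℝ) ≤ n := Nat.cast_nonneg n
    linarith
  obtain ⟨ε, hε, H⟩ := main_map (γ * γ' / 4) (3 * (2 + 16 * (n:ℝ) ^ 2) * 4) η (by positivity)
    (by positivity) hη
  refine ⟨ε, hε, fun A hA hAm h1 h2 => ?_⟩
  have hAfin : volume A ≠ ⊤ := ((measure_mono hA).trans_lt isCompact_unitSq.measure_lt_top).ne
  have hv1 : γ ≤ volume.real A := (ENNReal.ofReal_le_iff_le_toReal hAfin).1 h1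
  have hv2 : volume.real A ≤ 1 - γ' := ENNReal.toReal_le_of_le_ofReal (by linarith) h2
  have hm : γ * γ' ≤ volume.real A * (1 - volume.real A) :=
    mul_le_mul hv1 (by linarith) hγp.le measureReal_nonneg
  obtain ⟨u, i, hu, hu0, hug, hg⟩ := gain (γ * γ') hm0 hm1 n hn' A hA hAm hm
  exact H A hA hAm u i hu hu0 hug hg
end
end
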